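/- Let A be a function on ℝ such that A' ∈ BMO(ℝ) with ‖A'‖_{BMO(ℝ)} = 1. Then there exists a constant C depending only on m such that for all a_1,…,a_m ∈ L¹(ℝ) and all f, |{x ∈ ℝ : |C_{m+1,A}(a_1,…,a_m; f)(x)| > 1}| ≤ C ( Σ_{j=1}^m ‖a_j‖_{L¹(ℝ)} + ∫_ℝ |f(y)| log(e + |f(y)|) dy ). -/

import Mathlib

open MeasureTheory Filter Set
open scoped ENNReal BigOperators

noncomputable section

/-- `Adiff g x y = ∫_y^x g`, i.e. `G x - G y` for an antiderivative `G` of `g`. -/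
def Adiff (g : ℝ → ℝ) (x y : ℝ) : ℝ := ∫ t in y..x, g t

/-- `P₂(A; x, y) = A x - A y - A' y * (x - y)`. -/
def P2 (A A' : ℝ → ℝ) (x y : ℝ) : ℝ := A x - A y - A' y * (x - y)

/-- The generalized Calderón commutator `𝒞_{m+1,A}(a₁,…,a_m; f)`, defined as a
principal value. -/
def CcommA (m : ℕ) (A A' : ℝ → ℝ) (a : Fin m → ℝ → ℝ) (f : ℝ → ℝ) (x : ℝ) : ℝ :=
  limUnder (nhdsWithin 0 (Ioi 0)) fun ε : ℝ =>
    ∫ y in {y : ℝ | ε < |x - y|},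
      (P2 A A' x y * ∏ j, Adiff (a j) x y) / (x - y) ^ (m + 2) * f y

/-- The `(m+1)`-th order Calderón commutator `𝒞_{m+1}(a₁,…,a_m; f)`. -/
def Ccomm (m : ℕ) (a : Fin m → ℝ → ℝ) (f : ℝ → ℝ) (x : ℝ) : ℝ :=
  limUnder (nhdsWithin 0 (Ioi 0)) fun ε : ℝ =>
    ∫ y in {y : ℝ | ε < |x - y|},
      (∏ j, Adiff (a j) x y) / (x - y) ^ (m + 1) * f y

/-- The BMO norm of `g` over intervals in `ℝ`. -/
def bmoNorm (g : ℝ → ℝ) : ℝ :=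
  sSup {c : ℝ | ∃ u v : ℝ, u < v ∧
    c = (v - u)⁻¹ * ∫ y in Ioc u v, |g y - (v - u)⁻¹ * ∫ z in Ioc u v, g z|}

/-- Average (in `ℝ≥0∞`) of a nonnegative function over an interval. -/
def avgE (g : ℝ → ℝ) (u v : ℝ) : ℝ≥0∞ :=
  (ENNReal.ofReal (v - u))⁻¹ * ∫⁻ y in Ioc u v, ENNReal.ofReal (g y)

/-- Weighted `L^p` norm `(∫ |g|^p w)^{1/p}`. -/
def wLpNorm (p : ℝ) (w g : ℝ → ℝ) : ℝ≥0∞ :=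
  (∫⁻ x, ENNReal.ofReal (|g x| ^ p * w x)) ^ (1 / p)

/-- `L^p` norm. -/
def LpNorm (p : ℝ) (g : ℝ → ℝ) : ℝ≥0∞ :=
  (∫⁻ x, ENNReal.ofReal (|g x| ^ p)) ^ (1 / p)

/-- Weak `L^p` quasinorm. -/
def wkNorm (p : ℝ) (g : ℝ → ℝ) : ℝ≥0∞ :=
  ⨆ (t : ℝ) (_ : 0 < t), ENNReal.ofReal t * (volume {x : ℝ | t < |g x|}) ^ (1 / p)

/-- The multiple weight `ν_{→w} = ∏ w_i^{p/p_i}`. -/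
def nuW (k : ℕ) (ptot : ℝ) (p : Fin k → ℝ) (w : Fin k → ℝ → ℝ) : ℝ → ℝ :=
  fun x => ∏ i, w i x ^ (ptot / p i)

/-- The multilinear Muckenhoupt `A_{→P}` constant (for exponents `p i > 1`). -/
def APconst (k : ℕ) (ptot : ℝ) (p : Fin k → ℝ) (w : Fin k → ℝ → ℝ) : ℝ≥0∞ :=
  ⨆ (u : ℝ) (v : ℝ) (_ : u < v),
    avgE (nuW k ptot p w) u v *
      ∏ i, (avgE (fun y => w i y ^ (-(1 / (p i - 1)))) u v) ^ (ptot * (1 - 1 / p i))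

/-- Hardy–Littlewood maximal operator on `ℝ` (over intervals). -/
def Mop1 (g : ℝ → ℝ) (x : ℝ) : ℝ≥0∞ :=
  ⨆ (u : ℝ) (v : ℝ) (_ : u < v) (_ : x ∈ Ioc u v), avgE (fun y => |g y|) u v

/-- The Fujii–Wilson `A_∞` constant of a weight `u` on `ℝ`. -/
def AinfConst (u : ℝ → ℝ) : ℝ≥0∞ :=
  ⨆ (c : ℝ) (d : ℝ) (_ : c < d),
    (∫⁻ y in Ioc c d, ENNReal.ofReal (u y))⁻¹ *
      ∫⁻ x in Ioc c d, Mop1 (Set.indicator (Ioc c d) u) x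

/-- The `A_{(1,…,1)}` constant of a vector weight. -/
def A11const (k : ℕ) (w : Fin k → ℝ → ℝ) : ℝ≥0∞ :=
  ⨆ (u : ℝ) (v : ℝ) (_ : u < v),
    avgE (fun x => ∏ i, w i x ^ ((1 : ℝ) / k)) u v *
      ∏ i, ((ENNReal.ofReal (essInf (w i) (volume.restrict (Ioc u v))))⁻¹) ^ ((1 : ℝ) / k)

/-- Luxemburg norm `‖f‖_{L(log L)^γ, (u,v)}` over the interval `(u, v]`. -/
def luxNormI (γ : ℝ) (u v : ℝ) (f : ℝ → ℝ) : ℝ :=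
  sInf {t : ℝ | 0 < t ∧
    ∫⁻ y in Ioc u v, ENNReal.ofReal (|f y| / t * Real.log (Real.exp 1 + |f y| / t) ^ γ)
      ≤ ENNReal.ofReal (v - u)}

/-- The interval with the same center as `(u,v]` and `lam` times its length. -/
def scaleI (lam u v : ℝ) : ℝ × ℝ :=
  ((u + v) / 2 - lam * (v - u) / 2, (u + v) / 2 + lam * (v - u) / 2)

/-- Maximal operator `M_{L log L}` on `ℝ`. -/
def MLlogL (f : ℝ → ℝ) (x : ℝ) : ℝ≥0∞ :=
  ⨆ (u : ℝ) (v : ℝ) (_ : u < v) (_ : x ∈ Ioc u v), ENNReal.ofReal (luxNormI 1 u v f)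

/-- John–Strömberg sharp maximal operator `M^♯_{0,s}` on `ℝ`. -/
def Msharp1 (s : ℝ) (g : ℝ → ℝ) (x : ℝ) : ℝ≥0∞ :=
  ⨆ (u : ℝ) (v : ℝ) (_ : u < v) (_ : x ∈ Ioc u v),
    ⨅ (b : ℝ), ⨅ (t : ℝ) (_ : 0 < t)
      (_ : volume {y ∈ Ioc u v | t < |g y - b|} < ENNReal.ofReal s * volume (Ioc u v)),
      ENNReal.ofReal t

/-- Membership in BMO(ℝ). -/
def MemBMO (g : ℝ → ℝ) : Prop :=
  ∃ M : ℝ, ∀ u v : ℝ, u < v →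
    (v - u)⁻¹ * (∫ y in Ioc u v, |g y - (v - u)⁻¹ * ∫ z in Ioc u v, g z|) ≤ M

end

section
namespace CCA

theorem vitali_cover {ν : Measure ℝ} {E : Set ℝ}
    (h : ∀ x ∈ E, ∃ u v : ℝ, u < x ∧ x < v ∧ ENNReal.ofReal (v - u) ≤ ν (Ioo u v)) :
    volume E ≤ 5 * ν univ := by
  by_cases hν : ν univ = ∞
  · rw [hν]; simp
  choose! u v hu hv hE using h
  have hball : ∀ x, Metric.ball ((u x + v x) / 2) ((v x - u x) / 2) = Ioo (u x) (v x) := by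
    intro x; rw [Real.ball_eq_Ioo]; congr 1 <;> ring
  obtain ⟨t, htE, hdisj, hcov⟩ := Vitali.exists_disjoint_subfamily_covering_enlargement_ball E
    (fun x => (u x + v x) / 2) (fun x => (v x - u x) / 2) ((ν univ).toReal) (by
      intro x hx
      have h1 := (hE x hx).trans (measure_mono (subset_univ _))
      have h2 := (ENNReal.ofReal_le_iff_le_toReal hν).1 h1
      have := hu x hx; have := hv x hx
      linarith) 5 (by norm_num)
  simp only [hball] at hdisj hcov
  have hc : t.Countable := hdisj.countable_of_isOpen (fun _ _ => isOpen_Ioo) (fun x hx =>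
    ⟨x, hu x (htE hx), hv x (htE hx)⟩)
  calc volume E ≤ volume (⋃ x ∈ t, Metric.ball ((u x + v x) / 2) (5 * ((v x - u x) / 2))) := by
        apply measure_mono
        intro x hx
        obtain ⟨y, hy, hxy⟩ := hcov x hx
        exact mem_biUnion hy (hxy ⟨hu x hx, hv x hx⟩)
    _ ≤ ∑' x : t, volume (Metric.ball ((u x + v x) / 2) (5 * ((v (x:ℝ) - u x) / 2))) :=
        measure_biUnion_le _ hc _
    _ ≤ ∑' x : t, 5 * ν (Ioo (u x) (v x)) := by
        apply ENNReal.tsum_le_tsum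
        intro x
        rw [Real.volume_ball]
        have : 2 * (5 * ((v (x:ℝ) - u x) / 2)) = 5 * (v x - u x) := by ring
        rw [this, ENNReal.ofReal_mul (by norm_num)]
        have h5 : ENNReal.ofReal 5 = 5 := by norm_num
        rw [h5]
        gcongr
        exact hE x (htE x.2)
    _ = 5 * ∑' x : t, ν (Ioo (u x) (v x)) := ENNReal.tsum_mul_left
    _ = 5 * ν (⋃ x ∈ t, Ioo (u x) (v x)) := by
        rw [measure_biUnion hc hdisj (fun _ _ => measurableSet_Ioo)]
    _ ≤ 5 * ν univ := by gcongr; exact subset_univ _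

theorem components {U : Set ℝ} (hU : IsOpen U) (hvol : volume U < ∞) :
    ∃ p q : ℕ → ℝ, Pairwise (Function.onFun Disjoint fun n => Ioo (p n) (q n)) ∧
      U = ⋃ n, Ioo (p n) (q n) ∧ ∀ n, p n < q n → p n ∉ U ∧ q n ∉ U := by
  let P : Set (ℝ × ℝ) := {z | z.1 < z.2 ∧ Ioo z.1 z.2 ⊆ U ∧ z.1 ∉ U ∧ z.2 ∉ U}
  have hPd : P.PairwiseDisjoint fun z => Ioo z.1 z.2 := by
    rintro ⟨a, b⟩ ⟨h1, h2, h3, h4⟩ ⟨c, d⟩ ⟨h5, h6, h7, h8⟩ hne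
    rw [Function.onFun, Set.disjoint_left]
    rintro x ⟨hx1, hx2⟩ ⟨hx3, hx4⟩
    simp only at *
    apply hne
    have e1 : a = c := by
      rcases lt_trichotomy a c with h | h | h
      · exact absurd (h2 ⟨h, hx3.trans hx2⟩) h7
      · exact h
      · exact absurd (h6 ⟨h, hx1.trans hx4⟩) h3
    have e2 : b = d := by
      rcases lt_trichotomy b d with h | h | h
      · exact absurd (h6 ⟨hx3.trans hx2, h⟩) h4
      · exact h
      · exact absurd (h2 ⟨hx1.trans hx4, h⟩) h8
    rw [e1, e2]
  have hPc : P.Countable := hPd.countable_of_isOpen (fun _ _ => isOpen_Ioo) (fun z hz =>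
    nonempty_Ioo.2 hz.1)
  have hcov : ∀ x ∈ U, ∃ z ∈ P, x ∈ Ioo z.1 z.2 := by
    intro x hx
    have hclosed : IsClosed Uᶜ := hU.isClosed_compl
    have hL : (Uᶜ ∩ Iic x).Nonempty := by
      by_contra hcon
      have : Iic x ⊆ U := by
        intro t ht; by_contra htU; exact hcon ⟨t, htU, ht⟩
      have := measure_mono this (μ := volume)
      simp at this; exact hvol.ne this
    have hR : (Uᶜ ∩ Ici x).Nonempty := by
      by_contra hcon
      have : Ici x ⊆ U := by
        intro t ht; by_contra htU; exact hcon ⟨t, htU, ht⟩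
      have := measure_mono this (μ := volume)
      simp at this; exact hvol.ne this
    have bL : BddAbove (Uᶜ ∩ Iic x) := ⟨x, fun _ h => h.2⟩
    have bR : BddBelow (Uᶜ ∩ Ici x) := ⟨x, fun _ h => h.2⟩
    have mL := (hclosed.inter isClosed_Iic).csSup_mem hL bL
    have mR := (hclosed.inter isClosed_Ici).csInf_mem hR bR
    set p := sSup (Uᶜ ∩ Iic x)
    set q := sInf (Uᶜ ∩ Ici x)
    have hp : p < x := lt_of_le_of_ne mL.2 (fun h => mL.1 (h ▸ hx))
    have hq : x < q := lt_of_le_of_ne mR.2 (fun h => mR.1 (h ▸ hx))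
    refine ⟨(p, q), ⟨hp.trans hq, ?_, mL.1, mR.1⟩, hp, hq⟩
    rintro t ⟨h1, h2⟩
    simp only at h1 h2
    by_contra htU
    rcases le_total t x with h | h
    · exact absurd (le_csSup bL ⟨htU, h⟩) (not_le.2 h1)
    · exact absurd (csInf_le bR ⟨htU, h⟩) (not_le.2 h2)
  have : Countable P := hPc
  obtain ⟨g, hg⟩ := exists_injective_nat P
  classical
  let G : ℕ → ℝ × ℝ := fun n => if h : ∃ z : P, g z = n then (h.choose : ℝ × ℝ) else (0, 0)
  have hGz : ∀ z : P, G (g z) = z := by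
    intro z
    have h : ∃ z' : P, g z' = g z := ⟨z, rfl⟩
    simp only [G, dif_pos h]
    exact congrArg _ (hg h.choose_spec)
  have hGP : ∀ n, (G n).1 < (G n).2 → ∃ z : P, g z = n ∧ G n = z := by
    intro n hn
    by_cases h : ∃ z : P, g z = n
    · obtain ⟨z, hz⟩ := h
      exact ⟨z, hz, by rw [← hz, hGz]⟩
    · have h0 : G n = (0, 0) := dif_neg h
      rw [h0] at hn
      simp at hn
  refine ⟨fun n => (G n).1, fun n => (G n).2, ?_, ?_, ?_⟩
  · intro i j hij
    rw [Function.onFun, Set.disjoint_left]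
    intro x h1 h2
    simp only at h1 h2
    obtain ⟨z, hz, e⟩ := hGP i (h1.1.trans h1.2)
    obtain ⟨z', hz', e'⟩ := hGP j (h2.1.trans h2.2)
    rw [e] at h1
    rw [e'] at h2
    have hne : (z : ℝ × ℝ) ≠ z' := fun h => hij (by rw [← hz, ← hz', Subtype.ext h])
    exact Set.disjoint_left.1 (hPd z.2 z'.2 hne) h1 h2
  · ext x
    simp only [mem_iUnion]
    constructor
    · intro hx
      obtain ⟨z, hz, hxz⟩ := hcov x hx
      exact ⟨g ⟨z, hz⟩, by rw [hGz]; exact hxz⟩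
    · rintro ⟨n, hn⟩
      obtain ⟨z, hz, e⟩ := hGP n (hn.1.trans hn.2)
      rw [e] at hn
      exact z.2.2.1 hn
  · intro n hn
    obtain ⟨z, hz, e⟩ := hGP n hn
    simp only [e]
    exact z.2.2.2

end CCA

end

section
namespace CCA

theorem meas_Ioo_le {ν : Measure ℝ} {p q : ℝ} {c : ℝ≥0∞}
    (h : ∀ u v, p < u → u < v → v < q → ν (Ioc u v) ≤ c) : ν (Ioo p q) ≤ c := by
  rcases le_or_gt q p with hpq | hpq
  · rw [Ioo_eq_empty (not_lt.2 hpq)]; simp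
  let s : ℕ → Set ℝ := fun n => Ioc (p + (q - p) / (n + 3)) (q - (q - p) / (n + 3))
  have hU : Ioo p q ⊆ ⋃ n, s n := by
    intro x hx
    obtain ⟨n, hn⟩ := exists_nat_gt ((q - p) / (min (x - p) (q - x)))
    have hm : 0 < min (x - p) (q - x) := lt_min (sub_pos.2 hx.1) (sub_pos.2 hx.2)
    rw [div_lt_iff₀ hm] at hn
    have hlt : (q - p) / (n + 3) < min (x - p) (q - x) := by
      rw [div_lt_iff₀ (by positivity)]; nlinarith
    have h1 := hlt.trans_le (min_le_left _ _)
    have h2 := hlt.trans_le (min_le_right _ _)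
    exact mem_iUnion.2 ⟨n, by constructor <;> linarith⟩
  have hmono : Monotone s := by
    intro i j hij
    have hij' : (i : ℝ) ≤ j := by exact_mod_cast hij
    have : (q - p) / (j + 3) ≤ (q - p) / (i + 3) := by
      apply div_le_div_of_nonneg_left <;> linarith [Nat.cast_nonneg (α := ℝ) i]
    apply Ioc_subset_Ioc <;> linarith
  refine (measure_mono hU).trans ?_
  rw [hmono.measure_iUnion]
  apply iSup_le
  intro n
  have hn : (0 : ℝ) < n + 3 := by positivity
  have h3 : (q - p) / (n + 3) ≤ (q - p) / 3 := by
    apply div_le_div_of_nonneg_left <;> linarith [Nat.cast_nonneg (α := ℝ) n]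
  have h0 : 0 < (q - p) / (n + 3) := div_pos (sub_pos.2 hpq) hn
  apply h <;> linarith

theorem loc_int_of_bmo {A A' : ℝ → ℝ} (hA : ∀ x, HasDerivAt A (A' x) x)
    (hb : ∀ u v : ℝ, u < v →
      ∫ y in Ioc u v, |A' y - (v - u)⁻¹ * ∫ z in Ioc u v, A' z| ≤ v - u) :
    LocallyIntegrable A' volume := by
  have hAd : A' = deriv A := by ext x; exact (hA x).deriv.symm
  have hmeas : Measurable A' := by rw [hAd]; exact measurable_deriv A
  let U : Set ℝ := {x | IntegrableAtFilter A' (nhds x)}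
  have hUo : IsOpen U := by
    rw [isOpen_iff_mem_nhds]
    rintro x ⟨s, hs, hi⟩
    obtain ⟨t, hts, hto, hxt⟩ := mem_nhds_iff.1 hs
    exact mem_of_superset (hto.mem_nhds hxt) (fun y hy => ⟨t, hto.mem_nhds hy, hi.mono_set hts⟩)
  have hbound : ∀ u v, u < v → Icc u v ⊆ U →
      ∫⁻ y in Ioc u v, ENNReal.ofReal |A' y| ≤ ENNReal.ofReal ((v - u) + |A v - A u|) := by
    intro u v huv hsub
    have hloc : LocallyIntegrableOn A' (Icc u v) := fun x hx =>
      IntegrableAtFilter.filter_mono nhdsWithin_le_nhds (hsub hx)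
    have hi : IntegrableOn A' (Icc u v) := hloc.integrableOn_isCompact isCompact_Icc
    have hi' : IntegrableOn A' (Ioc u v) := hi.mono_set Ioc_subset_Icc_self
    have hFTC : ∫ y in Ioc u v, A' y = A v - A u := by
      rw [← intervalIntegral.integral_of_le huv.le]
      apply intervalIntegral.integral_eq_sub_of_hasDerivAt (fun x _ => hA x)
      rwa [intervalIntegrable_iff_integrableOn_Ioc_of_le huv.le]
    rw [← ofReal_integral_eq_lintegral_ofReal hi'.abs (ae_of_all _ fun _ => abs_nonneg _)]
    apply ENNReal.ofReal_le_ofReal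
    have h1 := hb u v huv
    rw [hFTC] at h1
    set κ := (v - u)⁻¹ * (A v - A u) with hκ
    have hvol : volume (Ioc u v) ≠ ∞ := by simp
    have hconst : IntegrableOn (fun _ : ℝ => κ) (Ioc u v) := integrableOn_const hvol
    have h2 : ∫ y in Ioc u v, |A' y| ≤ ∫ y in Ioc u v, (|A' y - κ| + |κ|) := by
      apply integral_mono hi'.abs
      · exact (hi'.sub hconst).abs.add hconst.abs
      · intro y; simp only
        have := abs_add_le (A' y - κ) κ
        simpa using this
    have hsub2 : IntegrableOn (fun y => |A' y - κ|) (Ioc u v) := (hi'.sub hconst).abs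
    rw [integral_add hsub2 hconst.abs] at h2
    have h3 : ∫ y in Ioc u v, |κ| = |A v - A u| := by
      simp only [integral_const, smul_eq_mul, Measure.real, Measure.restrict_apply_univ,
        Real.volume_Ioc]
      rw [ENNReal.toReal_ofReal (by linarith), hκ, abs_mul, abs_inv, abs_of_pos (sub_pos.2 huv)]
      field_simp [(sub_pos.2 huv).ne']
    linarith
  by_contra hcon
  have hFne : (Uᶜ).Nonempty := by
    by_contra hemp
    rw [not_nonempty_iff_eq_empty, compl_empty_iff] at hemp
    exact hcon (fun x => by have : x ∈ U := hemp ▸ mem_univ x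
                            exact this)
  have hFc : IsClosed Uᶜ := hUo.isClosed_compl
  have : CompleteSpace (Uᶜ : Set ℝ) := hFc.completeSpace_coe
  have : Nonempty (Uᶜ : Set ℝ) := hFne.to_subtype
  let G : ℕ → Set (Uᶜ : Set ℝ) := fun n =>
    {x | ∀ y : ℝ, |y - x| < 1 / ((n : ℝ) + 1) → |A y - A x| ≤ (n + 1) * |y - x|}
  have hAc : Continuous A := continuous_iff_continuousAt.2 fun x => (hA x).continuousAt
  have hGc : ∀ n, IsClosed (G n) := by
    intro n
    have : G n = ⋂ y : ℝ, ({x : (Uᶜ : Set ℝ) | 1 / ((n : ℝ) + 1) ≤ |y - x|} ∪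
        {x : (Uᶜ : Set ℝ) | |A y - A x| ≤ (n + 1) * |y - x|}) := by
      ext x
      simp only [G, mem_setOf_eq, mem_iInter, mem_union]
      apply forall_congr'
      intro y
      rw [imp_iff_not_or, not_lt]
    rw [this]
    apply isClosed_iInter
    intro y
    apply IsClosed.union
    · exact isClosed_le continuous_const (by fun_prop)
    · exact isClosed_le (by fun_prop) (by fun_prop)
  have hGu : ⋃ n, G n = univ := by
    rw [eq_univ_iff_forall]
    intro x
    have h1 := (hA x).isBigO_sub
    obtain ⟨c, hc⟩ := h1.bound
    obtain ⟨δ, hδ, hball⟩ := Metric.eventually_nhds_iff.1 hc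
    obtain ⟨n, hn⟩ := exists_nat_gt (max c (1 / δ))
    refine mem_iUnion.2 ⟨n, ?_⟩
    intro y hy
    have hn1 := (le_max_left _ _).trans_lt hn
    have hn2 := (le_max_right _ _).trans_lt hn
    have h3 : 1 / ((n : ℝ) + 1) < δ := by
      rw [div_lt_iff₀ (by positivity)]
      rw [div_lt_iff₀ hδ] at hn2
      nlinarith
    have h4 := hball (y := y) (by rw [Real.dist_eq]; exact hy.trans h3)
    simp only [Real.norm_eq_abs] at h4
    refine h4.trans ?_
    gcongr
    linarith
  obtain ⟨n, ⟨x0, hx0⟩⟩ := nonempty_interior_of_iUnion_of_closed hGc hGu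
  obtain ⟨r0, hr0, hball⟩ := Metric.isOpen_iff.1 isOpen_interior x0 hx0
  have hball' : ∀ x (hx : x ∈ Uᶜ), |x - x0| < r0 → (⟨x, hx⟩ : (Uᶜ : Set ℝ)) ∈ G n := by
    intro x hx hxr
    apply interior_subset
    apply hball
    rw [Metric.mem_ball, Subtype.dist_eq, Real.dist_eq]
    exact hxr
  set N : ℝ := (n : ℝ) + 1 with hN
  have hNpos : 0 < N := by positivity
  set r := min r0 (1 / (2 * N)) with hr
  have hrpos : 0 < r := lt_min hr0 (by positivity)
  have hr1 : r ≤ r0 := min_le_left _ _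
  have hr2 : 2 * r ≤ 1 / N := by
    have : r ≤ 1 / (2 * N) := min_le_right _ _
    calc 2 * r ≤ 2 * (1 / (2 * N)) := by linarith
      _ = 1 / N := by field_simp
  set J := Ioo ((x0 : ℝ) - r) (x0 + r) with hJ
  have hlip : ∀ e ∈ Uᶜ, e ∈ J → ∀ y, |y - e| < 1 / N → |A y - A e| ≤ N * |y - e| := by
    intro e he heJ y hy
    exact hball' e he (lt_of_lt_of_le (by rw [abs_lt]; constructor <;> linarith [heJ.1, heJ.2]) hr1) y hy
  have hJint : IntegrableOn A' J := by
    refine ⟨hmeas.aestronglyMeasurable, ?_⟩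
    rw [hasFiniteIntegral_iff_norm]
    simp only [Real.norm_eq_abs]
    have hsplit : J = (J ∩ Uᶜ) ∪ (U ∩ J) := by
      ext x; simp only [mem_union, mem_inter_iff, mem_compl_iff]; tauto
    have hUJ : IsOpen (U ∩ J) := hUo.inter isOpen_Ioo
    have hJv : volume J < ∞ := by simp [hJ]
    have hUJv : volume (U ∩ J) < ∞ := (measure_mono inter_subset_right).trans_lt hJv
    obtain ⟨p, q, hd, hun, hend⟩ := components hUJ hUJv
    rw [hsplit]
    refine (lintegral_union_le _ _ _).trans_lt (ENNReal.add_lt_top.2 ⟨?_, ?_⟩)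
    · calc ∫⁻ x in J ∩ Uᶜ, ENNReal.ofReal |A' x| ≤ ∫⁻ x in J ∩ Uᶜ, ENNReal.ofReal N := by
            apply setLIntegral_mono measurable_const
            intro x hx
            apply ENNReal.ofReal_le_ofReal
            apply (hA x).le_of_lip' hNpos.le
            have : ∀ᶠ y in nhds x, |y - x| < 1 / N := by
              have := Metric.ball_mem_nhds x (ε := 1 / N) (by positivity)
              filter_upwards [this] with y hy
              rwa [Metric.mem_ball, Real.dist_eq] at hy
            filter_upwards [this] with y hy
            exact hlip x hx.2 hx.1 y hy
        _ = ENNReal.ofReal N * volume (J ∩ Uᶜ) := by simp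
        _ < ∞ := ENNReal.mul_lt_top ENNReal.ofReal_lt_top
            ((measure_mono inter_subset_left).trans_lt hJv)
    · have hcomp : ∀ k, ∫⁻ x in Ioo (p k) (q k), ENNReal.ofReal |A' x| ≤
          ENNReal.ofReal (1 + 2 * N) * volume (Ioo (p k) (q k)) := by
        intro k
        have key : ∀ u v, p k < u → u < v → v < q k →
            (volume.withDensity fun x => ENNReal.ofReal |A' x|) (Ioc u v) ≤
            ENNReal.ofReal (1 + 2 * N) * volume (Ioo (p k) (q k)) := by
          intro u v hu huv hv
          have hpq : p k < q k := hu.trans (huv.trans hv)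
          obtain ⟨hp, hq⟩ := hend k hpq
          have hsub : Ioo (p k) (q k) ⊆ U ∩ J := by rw [hun]; exact subset_iUnion_of_subset k le_rfl
          rw [withDensity_apply _ measurableSet_Ioc]
          refine (hbound u v huv (fun x hx => (hsub ⟨hu.trans_le hx.1, hx.2.trans_lt hv⟩).1)).trans ?_
          rw [Real.volume_Ioo, ← ENNReal.ofReal_mul (by positivity)]
          apply ENNReal.ofReal_le_ofReal
          have huJ := (hsub ⟨hu, huv.trans hv⟩).2
          have hvJ := (hsub ⟨hu.trans huv, hv⟩).2
          have hpJ : x0 - r ≤ p k := by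
            by_contra hlt
            push Not at hlt
            have := (hsub (a := x0 - r) ⟨hlt, by linarith [huJ.1]⟩).2
            linarith [this.1]
          have hqJ : q k ≤ x0 + r := by
            by_contra hlt
            push Not at hlt
            have := (hsub (a := x0 + r) ⟨by linarith [hvJ.2, hvJ.1], hlt⟩).2
            linarith [this.2]
          have hor : (∃ e, (e = p k ∨ e = q k) ∧ e ∈ Uᶜ ∧ e ∈ J) := by
            by_cases hpp : p k ∈ J
            · exact ⟨p k, Or.inl rfl, fun h => hp ⟨h, hpp⟩, hpp⟩
            by_cases hqq : q k ∈ J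
            · exact ⟨q k, Or.inr rfl, fun h => hq ⟨h, hqq⟩, hqq⟩
            exfalso
            have h1 : p k ≤ x0 - r := by
              by_contra hlt; push Not at hlt
              exact hpp ⟨hlt, by linarith [huJ.2]⟩
            have h2 : x0 + r ≤ q k := by
              by_contra hlt; push Not at hlt
              exact hqq ⟨by linarith [hvJ.1], hlt⟩
            exact x0.2 (hsub ⟨by linarith, by linarith⟩).1
          obtain ⟨e, he, heU, heJ⟩ := hor
          have hue : |u - e| ≤ q k - p k := by
            rcases he with rfl | rfl <;> rw [abs_le] <;> constructor <;> linarith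
          have hve : |v - e| ≤ q k - p k := by
            rcases he with rfl | rfl <;> rw [abs_le] <;> constructor <;> linarith
          have hue' : |u - e| < 1 / N := by
            rcases he with rfl | rfl <;> rw [abs_lt] <;> constructor <;> linarith
          have hve' : |v - e| < 1 / N := by
            rcases he with rfl | rfl <;> rw [abs_lt] <;> constructor <;> linarith
          have e1 := hlip e heU heJ u hue'
          have e2 := hlip e heU heJ v hve'
          have e3 : |A v - A u| ≤ |A v - A e| + |A u - A e| := by
            have := abs_sub (A v - A e) (A u - A e)
            simpa using this
          nlinarith
        have := meas_Ioo_le key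
        rwa [withDensity_apply _ measurableSet_Ioo] at this
      rw [hun] at hUJv ⊢
      calc ∫⁻ x in ⋃ k, Ioo (p k) (q k), ENNReal.ofReal |A' x| 
          = ∑' k, ∫⁻ x in Ioo (p k) (q k), ENNReal.ofReal |A' x| :=
            lintegral_iUnion (fun _ => measurableSet_Ioo) hd _
        _ ≤ ∑' k, ENNReal.ofReal (1 + 2 * N) * volume (Ioo (p k) (q k)) :=
            ENNReal.tsum_le_tsum hcomp
        _ = ENNReal.ofReal (1 + 2 * N) * volume (⋃ k, Ioo (p k) (q k)) := by
            rw [ENNReal.tsum_mul_left, measure_iUnion hd (fun _ => measurableSet_Ioo)]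
        _ < ∞ := ENNReal.mul_lt_top ENNReal.ofReal_lt_top hUJv
  apply x0.2
  exact ⟨J, Ioo_mem_nhds (by linarith) (by linarith), hJint⟩

end CCA

end

section
namespace CCA

/-- sets where the maximal function of a measure is large -/
def Mset (ν : Measure ℝ) (s : ℝ) : Set ℝ :=
  {x | ∃ u v : ℝ, u < x ∧ x < v ∧ ENNReal.ofReal (s * (v - u)) < ν (Ioo u v)}

/-- the measure with density the absolute value of a function -/
noncomputable def dm (g : ℝ → ℝ) : Measure ℝ := volume.withDensity fun x => ENNReal.ofReal |g x|

theorem dm_apply (g : ℝ → ℝ) {E : Set ℝ} (hE : MeasurableSet E) :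
    dm g E = ∫⁻ x in E, ENNReal.ofReal |g x| := withDensity_apply _ hE

theorem dm_eq_ofReal {g : ℝ → ℝ} {E : Set ℝ} (hE : MeasurableSet E) (hg : IntegrableOn g E) :
    dm g E = ENNReal.ofReal (∫ x in E, |g x|) := by
  rw [dm_apply g hE, ofReal_integral_eq_lintegral_ofReal hg.abs (ae_of_all _ fun _ => abs_nonneg _)]

theorem isOpen_Mset (ν : Measure ℝ) (s : ℝ) : IsOpen (Mset ν s) := by
  rw [isOpen_iff_mem_nhds]
  rintro x ⟨u, v, hu, hv, h⟩
  exact mem_of_superset (Ioo_mem_nhds hu hv) fun y hy => ⟨u, v, hy.1, hy.2, h⟩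

theorem vol_Mset_le (ν : Measure ℝ) {s : ℝ} (hs : 0 < s) :
    volume (Mset ν s) ≤ ENNReal.ofReal (5 / s) * ν univ := by
  have h := vitali_cover (ν := ENNReal.ofReal s⁻¹ • ν) (E := Mset ν s) (by
    rintro x ⟨u, v, hu, hv, h⟩
    refine ⟨u, v, hu, hv, ?_⟩
    simp only [Measure.smul_apply, smul_eq_mul]
    calc ENNReal.ofReal (v - u) = ENNReal.ofReal s⁻¹ * ENNReal.ofReal (s * (v - u)) := by
          rw [← ENNReal.ofReal_mul (by positivity)]
          congr 1
          field_simp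
      _ ≤ _ := by gcongr)
  refine h.trans (le_of_eq ?_)
  simp only [Measure.smul_apply, smul_eq_mul]
  rw [← mul_assoc, div_eq_mul_inv, ENNReal.ofReal_mul (by norm_num)]
  congr 2
  norm_num

theorem Mset_le_of_notMem {ν : Measure ℝ} {s : ℝ} {e u v : ℝ} (he : e ∉ Mset ν s)
    (hu : u ≤ e) (hv : e ≤ v) : ν (Ioo u v) ≤ ENNReal.ofReal (s * (v - u)) := by
  have h1 : ∀ τ : ℝ, 0 < τ → ν (Ioo u v) ≤ ENNReal.ofReal (s * (v - u + 2 * τ)) := by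
    intro τ hτ
    have : ν (Ioo (u - τ) (v + τ)) ≤ ENNReal.ofReal (s * ((v + τ) - (u - τ))) := by
      by_contra hcon
      push Not at hcon
      exact he ⟨u - τ, v + τ, by linarith, by linarith, hcon⟩
    refine (measure_mono (Ioo_subset_Ioo (by linarith) (by linarith))).trans (this.trans ?_)
    apply ENNReal.ofReal_le_ofReal
    apply le_of_eq; ring
  have hc : Continuous fun τ : ℝ => ENNReal.ofReal (s * (v - u + 2 * τ)) :=
    ENNReal.continuous_ofReal.comp (by fun_prop)
  have ht : Tendsto (fun τ : ℝ => ENNReal.ofReal (s * (v - u + 2 * τ))) (nhdsWithin 0 (Ioi 0))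
      (nhds (ENNReal.ofReal (s * (v - u)))) := by
    have := (hc.tendsto 0).mono_left (nhdsWithin_le_nhds (s := Ioi 0))
    simpa using this
  exact ge_of_tendsto ht (by filter_upwards [self_mem_nhdsWithin] with τ hτ using h1 τ hτ)

theorem ae_le_of_notMem_Mset {g : ℝ → ℝ} (hg : LocallyIntegrable g volume) {s : ℝ} (hs : 0 ≤ s) :
    ∀ᵐ x, x ∉ Mset (dm g) s → |g x| ≤ s := by
  have hg' : LocallyIntegrable (fun x => |g x|) volume := fun x => by
    obtain ⟨t, ht, hi⟩ := hg x
    exact ⟨t, ht, hi.abs⟩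
  filter_upwards [IsUnifLocDoublingMeasure.ae_tendsto_average (μ := volume) hg' 1] with x hx hxs
  have h1 := hx (l := nhdsWithin (0:ℝ) (Ioi 0)) (fun _ => x) id tendsto_id (by
    filter_upwards [self_mem_nhdsWithin] with τ hτ
    simp only [id, one_mul]
    exact Metric.mem_closedBall_self (le_of_lt hτ))
  refine le_of_tendsto h1 ?_
  filter_upwards [self_mem_nhdsWithin] with τ hτ
  have hτ' : (0:ℝ) < τ := hτ
  simp only [id]
  rw [Real.closedBall_eq_Icc, setAverage_eq]
  have h2 := Mset_le_of_notMem hxs (u := x - τ) (v := x + τ) (by linarith) (by linarith)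
  have hi : IntegrableOn g (Icc (x - τ) (x + τ)) := hg.integrableOn_isCompact isCompact_Icc
  rw [dm_eq_ofReal measurableSet_Ioo (hi.mono_set Ioo_subset_Icc_self)] at h2
  have h3 : ∫ y in Icc (x - τ) (x + τ), |g y| = ∫ y in Ioo (x - τ) (x + τ), |g y| :=
    integral_Icc_eq_integral_Ioo
  rw [h3]
  simp only [Measure.real, Real.volume_Icc, smul_eq_mul]
  rw [ENNReal.toReal_ofReal (by linarith)]
  have h4 : ∫ y in Ioo (x - τ) (x + τ), |g y| ≤ s * (x + τ - (x - τ)) :=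
    (ENNReal.ofReal_le_ofReal_iff (mul_nonneg hs (by linarith))).1 h2
  rw [inv_mul_le_iff₀ (by linarith)]
  linarith

/-- average over an interval -/
noncomputable def avg (b : ℝ → ℝ) (u v : ℝ) : ℝ := (v - u)⁻¹ * ∫ y in Ioc u v, b y

/-- normalized BMO functions -/
structure IsB (b : ℝ → ℝ) : Prop where
  meas : Measurable b
  loc : LocallyIntegrable b volume
  osc : ∀ u v : ℝ, u < v → ∫ y in Ioc u v, |b y - avg b u v| ≤ v - u

theorem IsB.ion {b : ℝ → ℝ} (hb : IsB b) (u v : ℝ) : IntegrableOn b (Ioc u v) :=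
  (hb.loc.integrableOn_isCompact isCompact_Icc).mono_set Ioc_subset_Icc_self

theorem IsB.locsub {b : ℝ → ℝ} (hb : IsB b) (c : ℝ) :
    LocallyIntegrable (fun y => b y - c) volume :=
  hb.loc.sub (locallyIntegrable_const c)

theorem avg_sub_le {b : ℝ → ℝ} (hb : LocallyIntegrable b volume) {u v c κ : ℝ} (huv : u < v)
    (h : ∫ y in Ioc u v, |b y - c| ≤ κ * (v - u)) : |avg b u v - c| ≤ κ := by
  have hi : IntegrableOn b (Ioc u v) :=
    (hb.integrableOn_isCompact isCompact_Icc).mono_set Ioc_subset_Icc_self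
  have hc : IntegrableOn (fun _ : ℝ => c) (Ioc u v) := integrableOn_const (by simp)
  have e : avg b u v - c = (v - u)⁻¹ * ∫ y in Ioc u v, (b y - c) := by
    rw [integral_sub hi hc, avg]
    simp only [integral_const, smul_eq_mul, Measure.real, Measure.restrict_apply_univ,
        Real.volume_Ioc]
    rw [ENNReal.toReal_ofReal (by linarith), mul_sub]
    have : v - u ≠ 0 := by linarith
    field_simp
  rw [e, abs_mul, abs_inv, abs_of_pos (sub_pos.2 huv), inv_mul_le_iff₀ (sub_pos.2 huv), mul_comm]
  exact (abs_integral_le_integral_abs).trans h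

theorem JN_step {b : ℝ → ℝ} (hb : IsB b) {c N : ℝ} (hc : 0 < c) (hN : 0 ≤ N) {X : ℝ≥0∞}
    (hX : ∀ u v : ℝ, u < v → ∫⁻ y in Ioo u v, ENNReal.ofReal (Real.exp (c * min |b y - avg b u v| N))
      ≤ X * ENNReal.ofReal (v - u)) {u v : ℝ} (huv : u < v) :
    ∫⁻ y in Ioo u v, ENNReal.ofReal (Real.exp (c * min |b y - avg b u v| N)) ≤
      ENNReal.ofReal (Real.exp (c * 20)) * (1 + X / 4) * ENNReal.ofReal (v - u) := by
  set β := avg b u v with hβ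
  set g : ℝ → ℝ := indicator (Ioo u v) (fun y => b y - β) with hg
  have hgi0 : IntegrableOn (fun y => b y - β) (Ioo u v) :=
    ((hb.locsub β).integrableOn_isCompact isCompact_Icc).mono_set Ioo_subset_Icc_self
  have hgi : Integrable g := by
    rw [hg, integrable_indicator_iff measurableSet_Ioo]; exact hgi0
  have hgu : dm g univ ≤ ENNReal.ofReal (v - u) := by
    rw [dm_eq_ofReal MeasurableSet.univ hgi.integrableOn]
    apply ENNReal.ofReal_le_ofReal
    refine le_trans (le_of_eq ?_) (hb.osc u v huv)
    rw [Measure.restrict_univ, integral_Ioc_eq_integral_Ioo, ← integral_indicator measurableSet_Ioo]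
    congr 1
    ext x
    by_cases hx : x ∈ Ioo u v <;> simp [hg, hx, hβ]
  set U := Mset (dm g) 20 ∩ Ioo u v with hU
  have hUo : IsOpen U := (isOpen_Mset _ _).inter isOpen_Ioo
  have hUv : volume U ≤ ENNReal.ofReal ((v - u) / 4) := by
    calc volume U ≤ volume (Mset (dm g) 20) := measure_mono inter_subset_left
      _ ≤ ENNReal.ofReal (5 / 20) * dm g univ := vol_Mset_le _ (by norm_num)
      _ ≤ ENNReal.ofReal (5 / 20) * ENNReal.ofReal (v - u) := by gcongr
      _ = ENNReal.ofReal ((v - u) / 4) := by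
        rw [← ENNReal.ofReal_mul (by norm_num)]; congr 1; ring
  obtain ⟨p, q, hd, hun, hend⟩ := components hUo (hUv.trans_lt ENNReal.ofReal_lt_top)
  have hcomp : ∀ k, ∫⁻ y in Ioo (p k) (q k), ENNReal.ofReal (Real.exp (c * min |b y - β| N)) ≤
      ENNReal.ofReal (Real.exp (c * 20)) * X * volume (Ioo (p k) (q k)) := by
    intro k
    rcases le_or_gt (q k) (p k) with hpq | hpq
    · rw [Ioo_eq_empty (not_lt.2 hpq)]; simp
    have hsub : Ioo (p k) (q k) ⊆ U := by rw [hun]; exact subset_iUnion_of_subset k le_rfl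
    have hsub2 : Ioo (p k) (q k) ⊆ Ioo u v := hsub.trans inter_subset_right
    obtain ⟨hup, hqv⟩ := (Ioo_subset_Ioo_iff hpq).1 hsub2
    have hlen : q k - p k ≤ (v - u) / 4 := by
      have := (measure_mono hsub).trans hUv
      rw [Real.volume_Ioo] at this
      exact (ENNReal.ofReal_le_ofReal_iff (by linarith)).1 this
    obtain ⟨hp, hq⟩ := hend k hpq
    have hintg : dm g (Ioo (p k) (q k)) ≤ ENNReal.ofReal (20 * (q k - p k)) := by
      by_cases hpu : u < p k
      · apply Mset_le_of_notMem (e := p k) _ le_rfl hpq.le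
        intro h; exact hp ⟨h, hpu, by linarith⟩
      · apply Mset_le_of_notMem (e := q k) _ hpq.le le_rfl
        intro h; exact hq ⟨h, by linarith, by linarith⟩
    rw [dm_eq_ofReal measurableSet_Ioo hgi.integrableOn,
      ENNReal.ofReal_le_ofReal_iff (by linarith)] at hintg
    have hint2 : ∫ y in Ioc (p k) (q k), |b y - β| ≤ 20 * (q k - p k) := by
      rw [integral_Ioc_eq_integral_Ioo]
      refine le_trans (le_of_eq ?_) hintg
      apply setIntegral_congr_fun measurableSet_Ioo
      intro y hy
      simp only [hg, indicator_of_mem (hsub2 hy)]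
    have hav := avg_sub_le hb.loc hpq hint2
    calc ∫⁻ y in Ioo (p k) (q k), ENNReal.ofReal (Real.exp (c * min |b y - β| N))
        ≤ ∫⁻ y in Ioo (p k) (q k), ENNReal.ofReal (Real.exp (c * 20)) *
          ENNReal.ofReal (Real.exp (c * min |b y - avg b (p k) (q k)| N)) := by
          apply lintegral_mono
          intro y
          simp only
          rw [← ENNReal.ofReal_mul (Real.exp_pos _).le, ← Real.exp_add]
          apply ENNReal.ofReal_le_ofReal
          apply Real.exp_le_exp.2
          rw [← mul_add]
          apply mul_le_mul_of_nonneg_left _ hc.le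
          have h1 : |b y - β| ≤ |b y - avg b (p k) (q k)| + 20 := by
            have := abs_add_le (b y - avg b (p k) (q k)) (avg b (p k) (q k) - β)
            simp at this; linarith
          rcases le_total |b y - avg b (p k) (q k)| N with h | h
          · rw [min_eq_left h]; linarith [min_le_left |b y - β| N]
          · rw [min_eq_right h]; linarith [min_le_right |b y - β| N]
      _ = ENNReal.ofReal (Real.exp (c * 20)) * ∫⁻ y in Ioo (p k) (q k),
          ENNReal.ofReal (Real.exp (c * min |b y - avg b (p k) (q k)| N)) := by
          rw [lintegral_const_mul']
          exact ENNReal.ofReal_ne_top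
      _ ≤ ENNReal.ofReal (Real.exp (c * 20)) * (X * ENNReal.ofReal (q k - p k)) := by
          gcongr
          exact hX _ _ hpq
      _ = _ := by rw [Real.volume_Ioo, mul_assoc]
  have hsplit : Ioo u v = (Ioo u v \ U) ∪ U := by
    rw [diff_union_of_subset]; exact inter_subset_right
  have hae := ae_le_of_notMem_Mset hgi.locallyIntegrable (s := 20) (by norm_num)
  calc ∫⁻ y in Ioo u v, ENNReal.ofReal (Real.exp (c * min |b y - β| N))
      ≤ (∫⁻ y in Ioo u v \ U, ENNReal.ofReal (Real.exp (c * min |b y - β| N))) +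
        ∫⁻ y in U, ENNReal.ofReal (Real.exp (c * min |b y - β| N)) := by
        conv_lhs => rw [hsplit]
        exact lintegral_union_le _ _ _
    _ ≤ ENNReal.ofReal (Real.exp (c * 20)) * ENNReal.ofReal (v - u) +
        ENNReal.ofReal (Real.exp (c * 20)) * X * ENNReal.ofReal ((v - u) / 4) := by
        gcongr
        · calc ∫⁻ y in Ioo u v \ U, ENNReal.ofReal (Real.exp (c * min |b y - β| N))
              ≤ ∫⁻ y in Ioo u v \ U, ENNReal.ofReal (Real.exp (c * 20)) := by
                apply setLIntegral_mono_ae' (measurableSet_Ioo.diff hUo.measurableSet)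
                filter_upwards [hae] with y hy hyU
                have h1 := hy (fun h => hyU.2 ⟨h, hyU.1⟩)
                rw [hg, indicator_of_mem hyU.1] at h1
                apply ENNReal.ofReal_le_ofReal
                apply Real.exp_le_exp.2
                apply mul_le_mul_of_nonneg_left _ hc.le
                exact (min_le_left _ _).trans h1
            _ = ENNReal.ofReal (Real.exp (c * 20)) * volume (Ioo u v \ U) := by simp
            _ ≤ _ := by
                gcongr
                refine (measure_mono diff_subset).trans ?_
                rw [Real.volume_Ioo]
        · calc ∫⁻ y in U, ENNReal.ofReal (Real.exp (c * min |b y - β| N))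
              = ∑' k, ∫⁻ y in Ioo (p k) (q k), ENNReal.ofReal (Real.exp (c * min |b y - β| N)) := by
                rw [hun]; exact lintegral_iUnion (fun _ => measurableSet_Ioo) hd _
            _ ≤ ∑' k, ENNReal.ofReal (Real.exp (c * 20)) * X * volume (Ioo (p k) (q k)) :=
                ENNReal.tsum_le_tsum hcomp
            _ = ENNReal.ofReal (Real.exp (c * 20)) * X * volume U := by
                rw [ENNReal.tsum_mul_left, hun, measure_iUnion hd (fun _ => measurableSet_Ioo)]
            _ ≤ _ := by gcongr
    _ = _ := by
        rw [ENNReal.ofReal_div_of_pos (by norm_num)]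
        have h4 : ENNReal.ofReal 4 = 4 := by norm_num
        rw [h4, div_eq_mul_inv, div_eq_mul_inv]
        ring

theorem JN {b : ℝ → ℝ} (hb : IsB b) {u v : ℝ} (huv : u < v) :
    ∫⁻ y in Ioo u v, ENNReal.ofReal (Real.exp (1 / 100 * |b y - avg b u v|)) ≤
      2 * ENNReal.ofReal (v - u) := by
  have hexp : Real.exp (1 / 100 * 20) ≤ 4 / 3 := by
    have h1 : Real.exp (1 / 100 * 20) ^ 5 = Real.exp 1 := by
      rw [← Real.exp_nat_mul]; norm_num
    have h2 := Real.exp_one_lt_d9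
    by_contra hcon
    push Not at hcon
    have h3 : (4 / 3 : ℝ) ^ 5 < Real.exp (1 / 100 * 20) ^ 5 := by
      gcongr
    rw [h1] at h3
    norm_num at h3 h2
    linarith
  have key : ∀ N : ℕ, ∀ u v : ℝ, u < v →
      ∫⁻ y in Ioo u v, ENNReal.ofReal (Real.exp (1 / 100 * min |b y - avg b u v| N)) ≤
      2 * ENNReal.ofReal (v - u) := by
    intro N
    set X : ℝ≥0∞ := ⨆ (z : {z : ℝ × ℝ // z.1 < z.2}),
      (∫⁻ y in Ioo z.1.1 z.1.2, ENNReal.ofReal (Real.exp (1 / 100 * min |b y - avg b z.1.1 z.1.2| N))) /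
        ENNReal.ofReal (z.1.2 - z.1.1) with hXdef
    have hX : ∀ u v : ℝ, u < v →
        ∫⁻ y in Ioo u v, ENNReal.ofReal (Real.exp (1 / 100 * min |b y - avg b u v| N))
        ≤ X * ENNReal.ofReal (v - u) := by
      intro u v huv
      have h0 : ENNReal.ofReal (v - u) ≠ 0 := by
        rw [Ne, ENNReal.ofReal_eq_zero]; linarith
      rw [← ENNReal.div_le_iff h0 ENNReal.ofReal_ne_top]
      exact le_iSup (fun z : {z : ℝ × ℝ // z.1 < z.2} =>
        (∫⁻ y in Ioo z.1.1 z.1.2, ENNReal.ofReal (Real.exp (1 / 100 * min |b y - avg b z.1.1 z.1.2| N))) /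
        ENNReal.ofReal (z.1.2 - z.1.1)) ⟨(u, v), huv⟩
    have hXle : ∀ Y : ℝ≥0∞, (∀ u v : ℝ, u < v →
        ∫⁻ y in Ioo u v, ENNReal.ofReal (Real.exp (1 / 100 * min |b y - avg b u v| N))
        ≤ Y * ENNReal.ofReal (v - u)) → X ≤ Y := by
      intro Y hY
      apply iSup_le
      rintro ⟨⟨u, v⟩, huv⟩
      have huv' : u < v := huv
      have h0 : ENNReal.ofReal (v - u) ≠ 0 := by
        rw [Ne, ENNReal.ofReal_eq_zero]; linarith
      rw [ENNReal.div_le_iff h0 ENNReal.ofReal_ne_top]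
      exact hY u v huv
    have hXfin : X ≠ ∞ := by
      apply ne_top_of_le_ne_top (ENNReal.ofReal_ne_top (r := Real.exp (1 / 100 * N)))
      apply hXle
      intro u v huv
      calc ∫⁻ y in Ioo u v, ENNReal.ofReal (Real.exp (1 / 100 * min |b y - avg b u v| N))
          ≤ ∫⁻ y in Ioo u v, ENNReal.ofReal (Real.exp (1 / 100 * N)) := by
            apply lintegral_mono
            intro y
            apply ENNReal.ofReal_le_ofReal
            apply Real.exp_le_exp.2
            gcongr
            exact min_le_right _ _
        _ = _ := by simp
    have hX2 : X ≤ ENNReal.ofReal (4 / 3) * (1 + X / 4) := by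
      apply hXle
      intro u v huv
      refine (JN_step hb (by norm_num) (Nat.cast_nonneg N) hX huv).trans ?_
      gcongr
    have hX3 : X ≤ 2 := by
      lift X to NNReal using hXfin with x hx
      have : (x : ℝ) ≤ 4 / 3 * (1 + x / 4) := by
        have h := ENNReal.toReal_mono (by finiteness) hX2
        rw [ENNReal.toReal_mul, ENNReal.toReal_add (by simp) (by finiteness), ENNReal.toReal_div,
          ENNReal.toReal_ofReal (by norm_num)] at h
        simpa using h
      have h2 : (x : ℝ) ≤ 2 := by linarith
      exact_mod_cast h2
    intro u v huv
    refine (hX u v huv).trans ?_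
    gcongr
  have hlim : ∀ y, ENNReal.ofReal (Real.exp (1 / 100 * |b y - avg b u v|)) =
      liminf (fun N : ℕ => ENNReal.ofReal (Real.exp (1 / 100 * min |b y - avg b u v| N))) atTop := by
    intro y
    symm
    apply Tendsto.liminf_eq
    apply tendsto_const_nhds.congr'
    obtain ⟨n, hn⟩ := exists_nat_ge |b y - avg b u v|
    filter_upwards [eventually_ge_atTop n] with N hN
    rw [min_eq_left]
    exact hn.trans (by exact_mod_cast hN)
  simp_rw [hlim]
  refine (lintegral_liminf_le ?_).trans ?_
  · intro N
    have := hb.meas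
    fun_prop
  · apply liminf_le_of_le (by isBoundedDefault)
    intro B hB
    obtain ⟨N, hN⟩ := hB.exists
    exact hN.trans (key N u v huv)

end CCA

end

section
namespace CCA

/-- the pointwise Young function -/
noncomputable def phi (t : ℝ) : ℝ := |t| * Real.log (Real.exp 1 + |t|)

noncomputable def Phi (f : ℝ → ℝ) : ℝ≥0∞ := ∫⁻ y, ENNReal.ofReal (phi (f y))

theorem log_e_ge {t : ℝ} (ht : 0 ≤ t) : 1 ≤ Real.log (Real.exp 1 + t) := by
  rw [Real.le_log_iff_exp_le (by positivity)]; linarith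

theorem phi_nonneg (t : ℝ) : 0 ≤ phi t :=
  mul_nonneg (abs_nonneg _) (zero_le_one.trans (log_e_ge (abs_nonneg _)))

theorem abs_le_phi (t : ℝ) : |t| ≤ phi t :=
  le_mul_of_one_le_right (abs_nonneg _) (log_e_ge (abs_nonneg _))

theorem phi_mul_le {c : ℝ} (hc : 1 ≤ c) (t : ℝ) : phi (c * t) ≤ c ^ 2 * phi t := by
  have h0 := abs_nonneg t
  have hl := log_e_ge h0
  have hlog : Real.log (Real.exp 1 + c * |t|) ≤ c * Real.log (Real.exp 1 + |t|) := by
    have h1 : Real.log (Real.exp 1 + c * |t|) ≤ Real.log (c * (Real.exp 1 + |t|)) := by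
      apply Real.log_le_log (by positivity)
      nlinarith [Real.exp_pos 1]
    rw [Real.log_mul (by positivity) (by positivity)] at h1
    have h2 := Real.log_le_sub_one_of_pos (show 0 < c by linarith)
    nlinarith
  unfold phi
  rw [abs_mul, abs_of_nonneg (by linarith : 0 ≤ c)]
  calc c * |t| * Real.log (Real.exp 1 + c * |t|) ≤ c * |t| * (c * Real.log (Real.exp 1 + |t|)) := by
        gcongr
    _ = _ := by ring

theorem phi_mono {s t : ℝ} (h : |s| ≤ |t|) : phi s ≤ phi t := by
  unfold phi
  have := log_e_ge (abs_nonneg t)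
  have := log_e_ge (abs_nonneg s)
  gcongr

theorem phi_mul_le' {c : ℝ} (h0 : 0 ≤ c) (hc : c ≤ 1) (t : ℝ) : phi (c * t) ≤ c * phi t := by
  unfold phi
  rw [abs_mul, abs_of_nonneg h0, mul_assoc]
  have := abs_nonneg t
  have := log_e_ge this
  gcongr
  nlinarith

theorem Phi_mul_le {c : ℝ} (hc : 1 ≤ c) (f : ℝ → ℝ) :
    Phi (fun x => c * f x) ≤ ENNReal.ofReal (c ^ 2) * Phi f := by
  unfold Phi
  rw [← lintegral_const_mul' _ _ ENNReal.ofReal_ne_top]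
  apply lintegral_mono
  intro x
  simp only
  rw [← ENNReal.ofReal_mul (by positivity)]
  exact ENNReal.ofReal_le_ofReal (phi_mul_le hc _)

theorem Phi_mul_le' {c : ℝ} (h0 : 0 ≤ c) (hc : c ≤ 1) (f : ℝ → ℝ) :
    Phi (fun x => c * f x) ≤ ENNReal.ofReal c * Phi f := by
  unfold Phi
  rw [← lintegral_const_mul' _ _ ENNReal.ofReal_ne_top]
  apply lintegral_mono
  intro x
  simp only
  rw [← ENNReal.ofReal_mul (by positivity)]
  exact ENNReal.ofReal_le_ofReal (phi_mul_le' h0 hc _)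

theorem Phi_mono {f g : ℝ → ℝ} (h : ∀ x, |f x| ≤ |g x|) : Phi f ≤ Phi g :=
  lintegral_mono fun x => ENNReal.ofReal_le_ofReal (phi_mono (h x))

theorem young {s t : ℝ} (hs : 0 ≤ s) (ht : 0 ≤ t) :
    s * t ≤ s * Real.log (1 + s) + Real.exp t := by
  have h1 : Real.exp t = (1 + s) * Real.exp (t - Real.log (1 + s)) := by
    rw [Real.exp_sub, Real.exp_log (by linarith)]
    field_simp
  have h2 := Real.add_one_le_exp (t - Real.log (1 + s))
  have h3 := Real.log_le_sub_one_of_pos (show 0 < 1 + s by linarith)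
  have h4 : (1 + s) * (t - Real.log (1 + s) + 1) ≤ Real.exp t := by
    rw [h1]; gcongr
  nlinarith

theorem young_phi (F : ℝ) {t : ℝ} (ht : 0 ≤ t) :
    |F| * (1 + t) ≤ 701 * phi F + 1 / 4 * Real.exp (1 / 100 * t) := by
  have h := young (s := 400 * |F|) (t := 1 / 100 * t) (by positivity) (by positivity)
  have h0 := abs_nonneg F
  have h1 := abs_le_phi F
  have hl := log_e_ge h0
  have h2 : Real.log (1 + 400 * |F|) ≤ 7 * Real.log (Real.exp 1 + |F|) := by
    have h3 : Real.log (1 + 400 * |F|) ≤ Real.log (400 * (Real.exp 1 + |F|)) := by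
      apply Real.log_le_log (by positivity)
      nlinarith [Real.add_one_le_exp 1]
    rw [Real.log_mul (by positivity) (by positivity)] at h3
    have h4 : Real.log 400 ≤ 6 := by
      rw [Real.log_le_iff_le_exp (by norm_num)]
      have h5 : Real.exp 6 = Real.exp 1 ^ 6 := by rw [← Real.exp_nat_mul]; norm_num
      rw [h5]
      have h6 := Real.exp_one_gt_d9
      calc (400 : ℝ) ≤ 2.718 ^ 6 := by norm_num
        _ ≤ _ := by gcongr; linarith
    linarith
  have h3 : 400 * |F| * Real.log (1 + 400 * |F|) ≤ 2800 * phi F := by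
    unfold phi
    nlinarith
  nlinarith

/-- sets where the BMO adapted maximal function of a function is large -/
def Nset (b f : ℝ → ℝ) (s : ℝ) : Set ℝ :=
  {x | ∃ u v : ℝ, u < x ∧ x < v ∧ ENNReal.ofReal (s * (v - u)) <
    ∫⁻ y in Ioo u v, ENNReal.ofReal (|f y| * (1 + |b y - avg b u v|))}

theorem isOpen_Nset (b f : ℝ → ℝ) (s : ℝ) : IsOpen (Nset b f s) := by
  rw [isOpen_iff_mem_nhds]
  rintro x ⟨u, v, hu, hv, h⟩
  exact mem_of_superset (Ioo_mem_nhds hu hv) fun y hy => ⟨u, v, hy.1, hy.2, h⟩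

theorem loc_young {b : ℝ → ℝ} (hb : IsB b) (f : ℝ → ℝ) {u v : ℝ} (huv : u < v) :
    ∫⁻ y in Ioo u v, ENNReal.ofReal (|f y| * (1 + |b y - avg b u v|)) ≤
      701 * (∫⁻ y in Ioo u v, ENNReal.ofReal (phi (f y))) + ENNReal.ofReal ((v - u) / 2) := by
  have hm := hb.meas
  calc ∫⁻ y in Ioo u v, ENNReal.ofReal (|f y| * (1 + |b y - avg b u v|))
      ≤ ∫⁻ y in Ioo u v, (701 * ENNReal.ofReal (phi (f y)) +
        ENNReal.ofReal (1 / 4) * ENNReal.ofReal (Real.exp (1 / 100 * |b y - avg b u v|))) := by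
        apply lintegral_mono
        intro y
        simp only
        have h701 : (701 : ℝ≥0∞) = ENNReal.ofReal 701 := by norm_num
        rw [h701, ← ENNReal.ofReal_mul (by norm_num), ← ENNReal.ofReal_mul (by norm_num),
          ← ENNReal.ofReal_add (mul_nonneg (by norm_num) (phi_nonneg _)) (by positivity)]
        exact ENNReal.ofReal_le_ofReal (young_phi _ (abs_nonneg _))
    _ = 701 * (∫⁻ y in Ioo u v, ENNReal.ofReal (phi (f y))) +
        ENNReal.ofReal (1 / 4) * ∫⁻ y in Ioo u v,
          ENNReal.ofReal (Real.exp (1 / 100 * |b y - avg b u v|)) := by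
        rw [lintegral_add_right _ (by fun_prop), lintegral_const_mul' _ _ (by simp),
          lintegral_const_mul' _ _ (by simp)]
    _ ≤ 701 * (∫⁻ y in Ioo u v, ENNReal.ofReal (phi (f y))) +
        ENNReal.ofReal (1 / 4) * (2 * ENNReal.ofReal (v - u)) := by
        gcongr
        exact JN hb huv
    _ = _ := by
        congr 1
        have h2 : (2 : ℝ≥0∞) = ENNReal.ofReal 2 := by norm_num
        rw [h2, ← ENNReal.ofReal_mul (by norm_num), ← ENNReal.ofReal_mul (by norm_num)]
        congr 1; ring

theorem vol_Nset_one_le {b : ℝ → ℝ} (hb : IsB b) (f : ℝ → ℝ) :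
    volume (Nset b f 1) ≤ 7010 * Phi f := by
  have h := vitali_cover (ν := (1402 : ℝ≥0∞) • volume.withDensity (fun y => ENNReal.ofReal (phi (f y))))
    (E := Nset b f 1) (by
    rintro x ⟨u, v, hu, hv, h⟩
    refine ⟨u, v, hu, hv, ?_⟩
    rw [Measure.smul_apply, smul_eq_mul, withDensity_apply _ measurableSet_Ioo]
    have h1 := h.le.trans (loc_young hb f (hu.trans hv))
    rw [one_mul] at h1
    have e : ENNReal.ofReal (v - u) = ENNReal.ofReal ((v - u) / 2) + ENNReal.ofReal ((v - u) / 2) := by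
      rw [← ENNReal.ofReal_add (by linarith) (by linarith)]; congr 1; ring
    have h2 : ENNReal.ofReal ((v - u) / 2) ≤ 701 * (∫⁻ y in Ioo u v, ENNReal.ofReal (phi (f y))) := by
      rw [e] at h1
      exact (ENNReal.add_le_add_iff_right ENNReal.ofReal_ne_top).1 h1
    rw [e]
    calc _ ≤ 701 * (∫⁻ y in Ioo u v, ENNReal.ofReal (phi (f y))) +
          701 * (∫⁻ y in Ioo u v, ENNReal.ofReal (phi (f y))) := add_le_add h2 h2
      _ = _ := by rw [← add_mul]; norm_num)
  refine h.trans (le_of_eq ?_)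
  rw [Measure.smul_apply, smul_eq_mul, withDensity_apply _ MeasurableSet.univ, ← mul_assoc,
    Measure.restrict_univ, Phi]
  norm_num

theorem Nset_scale (b f : ℝ → ℝ) {s : ℝ} (hs : 0 < s) :
    Nset b f s = Nset b (fun x => s⁻¹ * f x) 1 := by
  ext x
  simp only [Nset, mem_setOf_eq]
  have : ∀ u v : ℝ, (ENNReal.ofReal (s * (v - u)) <
      ∫⁻ y in Ioo u v, ENNReal.ofReal (|f y| * (1 + |b y - avg b u v|))) ↔
      (ENNReal.ofReal (1 * (v - u)) <
      ∫⁻ y in Ioo u v, ENNReal.ofReal (|s⁻¹ * f y| * (1 + |b y - avg b u v|))) := by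
    intro u v
    have e1 : ∀ y, ENNReal.ofReal (|s⁻¹ * f y| * (1 + |b y - avg b u v|)) =
      ENNReal.ofReal s⁻¹ * ENNReal.ofReal (|f y| * (1 + |b y - avg b u v|)) := by
      intro y
      rw [abs_mul, abs_of_pos (inv_pos.2 hs), mul_assoc, ENNReal.ofReal_mul (by positivity)]
    simp_rw [e1]
    rw [lintegral_const_mul' _ _ ENNReal.ofReal_ne_top]
    have e2 : ENNReal.ofReal (1 * (v - u)) = ENNReal.ofReal s⁻¹ * ENNReal.ofReal (s * (v - u)) := by
      rw [← ENNReal.ofReal_mul (by positivity)]; congr 1; field_simp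
    rw [e2, ENNReal.mul_lt_mul_iff_right (by simpa using hs) ENNReal.ofReal_ne_top]
  simp_rw [this]

theorem vol_Nset_le {b : ℝ → ℝ} (hb : IsB b) (f : ℝ → ℝ) {s : ℝ} (hs : 0 < s) (hs1 : s ≤ 1) :
    volume (Nset b f s) ≤ ENNReal.ofReal (7010 / s ^ 2) * Phi f := by
  rw [Nset_scale b f hs]
  refine (vol_Nset_one_le hb _).trans ?_
  calc 7010 * Phi (fun x => s⁻¹ * f x) ≤ 7010 * (ENNReal.ofReal (s⁻¹ ^ 2) * Phi f) := by
        gcongr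
        exact Phi_mul_le ((one_le_inv₀ hs).2 hs1) f
    _ = _ := by
        rw [← mul_assoc]
        congr 1
        have h2 : (7010 : ℝ≥0∞) = ENNReal.ofReal 7010 := by norm_num
        rw [h2, ← ENNReal.ofReal_mul (by norm_num)]
        congr 1; field_simp

theorem vol_Nset_le' {b : ℝ → ℝ} (hb : IsB b) (f : ℝ → ℝ) {s : ℝ} (hs1 : 1 ≤ s) :
    volume (Nset b f s) ≤ ENNReal.ofReal (7010 / s) * Phi f := by
  have hs : 0 < s := by linarith
  rw [Nset_scale b f hs]
  refine (vol_Nset_one_le hb _).trans ?_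
  calc 7010 * Phi (fun x => s⁻¹ * f x) ≤ 7010 * (ENNReal.ofReal (s⁻¹) * Phi f) := by
        gcongr
        exact Phi_mul_le' (by positivity) (inv_le_one_of_one_le₀ hs1) f
    _ = _ := by
        rw [← mul_assoc]
        congr 1
        have h2 : (7010 : ℝ≥0∞) = ENNReal.ofReal 7010 := by norm_num
        rw [h2, ← ENNReal.ofReal_mul (by norm_num)]
        congr 1

theorem Nset_le_of_notMem {b f : ℝ → ℝ} {s : ℝ} {e u v : ℝ} (he : e ∉ Nset b f s)
    (hu : u < e) (hv : e < v) :
    ∫⁻ y in Ioo u v, ENNReal.ofReal (|f y| * (1 + |b y - avg b u v|)) ≤ ENNReal.ofReal (s * (v - u)) := by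
  by_contra hcon
  push Not at hcon
  exact he ⟨u, v, hu, hv, hcon⟩

end CCA

end

section
namespace CCA

def Lip1 {ι : Type} (A : ι → ℝ → ℝ) : Prop := ∀ j x y, |A j x - A j y| ≤ |x - y|

theorem Lip1.cont {ι : Type} {A : ι → ℝ → ℝ} (h : Lip1 A) (j : ι) : Continuous (A j) := by
  have : LipschitzWith 1 (A j) := LipschitzWith.of_dist_le_mul (by
    intro x y; simpa [Real.dist_eq] using h j x y)
  exact this.continuous

theorem Lip1.slope {ι : Type} {A : ι → ℝ → ℝ} (h : Lip1 A) (j : ι) (x y : ℝ) :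
    |(A j x - A j y) / (x - y)| ≤ 1 := by
  rw [abs_div]
  exact div_le_one_of_le₀ (h j x y) (abs_nonneg _)

variable {ι : Type} [Fintype ι]

noncomputable def KS (A : ι → ℝ → ℝ) (x y : ℝ) : ℝ := (∏ j, ((A j x - A j y) / (x - y))) / (x - y)

noncomputable def kd (A : ι → ℝ → ℝ) (δ : ℝ) (x y : ℝ) : ℝ := if δ < |x - y| then KS A x y else 0

noncomputable def SS (A : ι → ℝ → ℝ) (x y z : ℝ) : ℝ :=
  KS A x y * KS A x z + KS A y z * KS A y x + KS A z x * KS A z y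

theorem abs_prod_le_one {s : Finset ι} {u : ι → ℝ} (h : ∀ j ∈ s, |u j| ≤ 1) :
    |∏ j ∈ s, u j| ≤ 1 := by
  rw [Finset.abs_prod]
  exact Finset.prod_le_one (fun _ _ => abs_nonneg _) h

theorem KS_abs_le {A : ι → ℝ → ℝ} (h : Lip1 A) (x y : ℝ) : |KS A x y| ≤ 1 / |x - y| := by
  unfold KS
  rw [abs_div]
  gcongr
  exact abs_prod_le_one fun j _ => h.slope j x y

theorem KS_anti (A : ι → ℝ → ℝ) (x y : ℝ) : KS A x y = - KS A y x := by
  unfold KS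
  have : ∀ j, (A j x - A j y) / (x - y) = (A j y - A j x) / (y - x) := fun j => by
    rw [← neg_sub (A j y), ← neg_sub y, neg_div_neg_eq]
  simp_rw [this]
  rw [← neg_sub y x, div_neg]

theorem SS_cyc (A : ι → ℝ → ℝ) (x y z : ℝ) : SS A x y z = SS A y z x := by unfold SS; ring
theorem SS_swap (A : ι → ℝ → ℝ) (x y z : ℝ) : SS A x y z = SS A x z y := by
  unfold SS; ring

theorem prod_interp (s : Finset ι) {u v : ι → ℝ} {θ : ℝ} (h0 : 0 ≤ θ) (h1 : θ ≤ 1)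
    (hu : ∀ j, |u j| ≤ 1) (hv : ∀ j, |v j| ≤ 1) :
    |∏ j ∈ s, u j - ∏ j ∈ s, v j| ≤ ∑ j ∈ s, |u j - v j| ∧
    ∃ R : ℝ, ∏ j ∈ s, (θ * u j + (1 - θ) * v j) =
      θ * ∏ j ∈ s, u j + (1 - θ) * ∏ j ∈ s, v j + θ * (1 - θ) * R ∧
      |R| ≤ (∑ j ∈ s, |u j - v j|) ^ 2 := by
  classical
  induction s using Finset.induction_on with
  | empty => exact ⟨by simp, 0, by simp, by simp⟩
  | insert i s hi ih =>
    obtain ⟨ih1, R, hR, hRb⟩ := ih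
    simp only [Finset.prod_insert hi, Finset.sum_insert hi]
    have hP1 : |∏ j ∈ s, u j| ≤ 1 := abs_prod_le_one fun j _ => hu j
    have hP0 : |∏ j ∈ s, v j| ≤ 1 := abs_prod_le_one fun j _ => hv j
    set P1 := ∏ j ∈ s, u j
    set P0 := ∏ j ∈ s, v j
    set σ := ∑ j ∈ s, |u j - v j|
    have hσ : 0 ≤ σ := Finset.sum_nonneg fun _ _ => abs_nonneg _
    constructor
    · have e : u i * P1 - v i * P0 = (u i - v i) * P1 + v i * (P1 - P0) := by ring
      rw [e]
      refine (abs_add_le _ _).trans ?_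
      rw [abs_mul, abs_mul]
      have := abs_nonneg (u i - v i)
      have := abs_nonneg (P1 - P0)
      nlinarith [hu i, hv i]
    · refine ⟨R * (θ * u i + (1 - θ) * v i) - (P1 - P0) * (u i - v i), ?_, ?_⟩
      · rw [hR]; ring
      · have hl : |θ * u i + (1 - θ) * v i| ≤ 1 := by
          have h3 := abs_le.1 (hu i)
          have h4 := abs_le.1 (hv i)
          rw [abs_le]; constructor <;> nlinarith
        refine (abs_sub _ _).trans ?_
        rw [abs_mul, abs_mul]
        have h5 : |R| * |θ * u i + (1 - θ) * v i| ≤ σ ^ 2 := by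
          nlinarith [abs_nonneg R, abs_nonneg (θ * u i + (1 - θ) * v i)]
        have h6 : |P1 - P0| * |u i - v i| ≤ σ * |u i - v i| := by gcongr
        nlinarith [abs_nonneg (u i - v i)]

theorem prod_sub_le {u v : ι → ℝ} (hu : ∀ j, |u j| ≤ 1) (hv : ∀ j, |v j| ≤ 1) :
    |∏ j, u j - ∏ j, v j| ≤ ∑ j, |u j - v j| :=
  (prod_interp Finset.univ (θ := 0) le_rfl zero_le_one hu hv).1

theorem SS_formula_aux {P1 P0 Pθ R θ d : ℝ} (hd : d ≠ 0) (h0 : θ ≠ 0) (h1 : 1 - θ ≠ 0)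
    (h : Pθ = θ * P1 + (1 - θ) * P0 + θ * (1 - θ) * R) :
    P1 / (θ * d) * (Pθ / d) + P0 / ((1 - θ) * d) * (- (P1 / (θ * d))) +
      (Pθ / d) * (P0 / ((1 - θ) * d)) = ((P1 - P0) ^ 2 + R * ((1 - θ) * P1 + θ * P0)) / d ^ 2 := by
  rw [h]
  field_simp
  ring

/-- the second difference quotient of one function -/
noncomputable def WW (g : ℝ → ℝ) (x y z : ℝ) : ℝ := SS (fun _ : Unit => g) x y z

theorem SS_ord {A : ι → ℝ → ℝ} (h : Lip1 A) {x y z : ℝ} (hxy : y < x) (hyz : z < y) :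
    (∀ j, WW (A j) x y z = (((A j x - A j y) / (x - y) - (A j y - A j z) / (y - z)) / (x - z)) ^ 2) ∧
    |SS A x y z| ≤ 2 * Fintype.card ι * ∑ j, WW (A j) x y z := by
  have hd : x - z ≠ 0 := by linarith
  have hd12 : x - y ≠ 0 := by linarith
  have hd23 : y - z ≠ 0 := by linarith
  set d := x - z with hdd
  set θ := (x - y) / d with hθ
  have e12 : x - y = θ * d := by rw [hθ]; field_simp
  have e23 : y - z = (1 - θ) * d := by rw [hθ]; field_simp; rw [hdd]; ring
  have hθ0 : θ ≠ 0 := by intro h; rw [h, zero_mul] at e12; exact hd12 e12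
  have hθ1 : 1 - θ ≠ 0 := by intro h; rw [h, zero_mul] at e23; exact hd23 e23
  have hdpos : 0 < d := by linarith
  have t0 : 0 ≤ θ := div_nonneg (by linarith) hdpos.le
  have t1 : θ ≤ 1 := by rw [hθ, div_le_one hdpos]; linarith
  have slope : ∀ g : ℝ → ℝ, (g x - g z) / d =
      θ * ((g x - g y) / (x - y)) + (1 - θ) * ((g y - g z) / (y - z)) := by
    intro g
    rw [e12, e23]; field_simp; ring
  have gen : ∀ {κ : Type} [Fintype κ] (B : κ → ℝ → ℝ), Lip1 B → ∃ R : ℝ,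
      |∏ j, ((B j x - B j y) / (x - y)) - ∏ j, ((B j y - B j z) / (y - z))| ≤
        ∑ j, |(B j x - B j y) / (x - y) - (B j y - B j z) / (y - z)| ∧
      |R| ≤ (∑ j, |(B j x - B j y) / (x - y) - (B j y - B j z) / (y - z)|) ^ 2 ∧
      (∏ j, ((B j x - B j z) / d) = θ * ∏ j, ((B j x - B j y) / (x - y)) +
        (1 - θ) * ∏ j, ((B j y - B j z) / (y - z)) + θ * (1 - θ) * R) ∧
      SS B x y z = ((∏ j, ((B j x - B j y) / (x - y)) - ∏ j, ((B j y - B j z) / (y - z))) ^ 2 +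
        R * ((1 - θ) * ∏ j, ((B j x - B j y) / (x - y)) + θ * ∏ j, ((B j y - B j z) / (y - z)))) / d ^ 2 := by
    intro κ _ B hB
    obtain ⟨h1, R, hR, hRb⟩ := prod_interp Finset.univ t0 t1
      (u := fun j => (B j x - B j y) / (x - y)) (v := fun j => (B j y - B j z) / (y - z))
      (fun j => hB.slope j x y) (fun j => hB.slope j y z)
    have hR' : ∏ j, ((B j x - B j z) / d) = θ * ∏ j, ((B j x - B j y) / (x - y)) +
        (1 - θ) * ∏ j, ((B j y - B j z) / (y - z)) + θ * (1 - θ) * R := by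
      rw [← hR]
      apply Finset.prod_congr rfl
      intro j _
      rw [slope]
    refine ⟨R, h1, hRb, hR', ?_⟩
    unfold SS
    rw [KS_anti B y x, KS_anti B z x, KS_anti B z y, neg_mul_neg, ← SS_formula_aux hd hθ0 hθ1 hR']
    unfold KS
    rw [← e12, ← e23, hdd]
  have hWW : ∀ j, WW (A j) x y z =
      (((A j x - A j y) / (x - y) - (A j y - A j z) / (y - z)) / (x - z)) ^ 2 := by
    intro j
    obtain ⟨R, h1, h2, h3, h4⟩ := gen (fun _ : Unit => A j) (fun _ => h j)
    simp only [Finset.univ_unique, Finset.prod_singleton] at h3 h4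
    have hR0 : R = 0 := by
      rw [slope] at h3
      have h5 : θ * (1 - θ) * R = 0 := by linarith
      rcases mul_eq_zero.1 h5 with h6 | h6
      · exact absurd h6 (mul_ne_zero hθ0 hθ1)
      · exact h6
    unfold WW
    rw [h4, hR0, div_pow, zero_mul, add_zero]
  refine ⟨hWW, ?_⟩
  obtain ⟨R, h1, h2, h3, h4⟩ := gen A h
  simp_rw [hWW]
  have hP1 : |∏ j, ((A j x - A j y) / (x - y))| ≤ 1 := abs_prod_le_one fun j _ => h.slope j x y
  have hP0 : |∏ j, ((A j y - A j z) / (y - z))| ≤ 1 := abs_prod_le_one fun j _ => h.slope j y z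
  set P1 := ∏ j, ((A j x - A j y) / (x - y))
  set P0 := ∏ j, ((A j y - A j z) / (y - z))
  set w : ι → ℝ := fun j => (A j x - A j y) / (x - y) - (A j y - A j z) / (y - z)
  have hcs : (∑ j, |w j|) ^ 2 ≤ Fintype.card ι * ∑ j, (w j) ^ 2 := by
    have := sq_sum_le_card_mul_sum_sq (s := Finset.univ) (f := fun j => |w j|)
    simpa [sq_abs] using this
  have e : ∑ j, ((w j) / d) ^ 2 = (∑ j, (w j) ^ 2) / d ^ 2 := by
    rw [Finset.sum_div]; simp_rw [div_pow]
  change |SS A x y z| ≤ 2 * Fintype.card ι * ∑ j, ((w j) / d) ^ 2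
  rw [e, h4, abs_div, abs_of_pos (by positivity : 0 < d ^ 2), ← mul_div_assoc]
  gcongr
  refine (abs_add_le _ _).trans ?_
  have hcomb : |(1 - θ) * P1 + θ * P0| ≤ 1 := by
    have h3 := abs_le.1 hP1
    have h4 := abs_le.1 hP0
    rw [abs_le]; constructor <;> nlinarith
  have h5 : |(P1 - P0) ^ 2| ≤ (∑ j, |w j|) ^ 2 := by
    rw [abs_pow]; gcongr
  have h6 : |R * ((1 - θ) * P1 + θ * P0)| ≤ (∑ j, |w j|) ^ 2 := by
    rw [abs_mul]
    calc |R| * |(1 - θ) * P1 + θ * P0| ≤ |R| * 1 := by gcongr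
      _ ≤ _ := by rw [mul_one]; exact h2
  linarith

theorem SS_bound {A : ι → ℝ → ℝ} (h : Lip1 A) {x y z : ℝ} (hxy : x ≠ y) (hyz : y ≠ z) (hxz : x ≠ z) :
    (∀ j, 0 ≤ WW (A j) x y z) ∧ |SS A x y z| ≤ 2 * Fintype.card ι * ∑ j, WW (A j) x y z := by
  have P : ∀ {x y z : ℝ}, y < x → z < y →
      (∀ j, 0 ≤ WW (A j) x y z) ∧ |SS A x y z| ≤ 2 * Fintype.card ι * ∑ j, WW (A j) x y z := by
    intro x y z h1 h2
    obtain ⟨h3, h4⟩ := SS_ord h h1 h2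
    exact ⟨fun j => by rw [h3]; positivity, h4⟩
  have c : ∀ x y z : ℝ, ((∀ j, 0 ≤ WW (A j) x y z) ∧ |SS A x y z| ≤ 2 * Fintype.card ι * ∑ j, WW (A j) x y z) →
     ((∀ j, 0 ≤ WW (A j) y z x) ∧ |SS A y z x| ≤ 2 * Fintype.card ι * ∑ j, WW (A j) y z x) := by
    intro x y z h
    unfold WW at *
    simp_rw [← SS_cyc _ x y z]; exact h
  have s : ∀ x y z : ℝ, ((∀ j, 0 ≤ WW (A j) x y z) ∧ |SS A x y z| ≤ 2 * Fintype.card ι * ∑ j, WW (A j) x y z) →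
     ((∀ j, 0 ≤ WW (A j) x z y) ∧ |SS A x z y| ≤ 2 * Fintype.card ι * ∑ j, WW (A j) x z y) := by
    intro x y z h
    unfold WW at *
    simp_rw [SS_swap _ x z y]; exact h
  rcases lt_or_gt_of_ne hxy with h1 | h1 <;> rcases lt_or_gt_of_ne hyz with h2 | h2 <;>
    rcases lt_or_gt_of_ne hxz with h3 | h3
  · exact s x z y (c y x z (c z y x (P h2 h1)))
  · linarith
  · exact c z x y (c y z x (P h2 h3))
  · exact s x z y (c y x z (P h1 h3))
  · exact c z x y (P h3 h1)
  · exact s x z y (P h3 h2)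
  · linarith
  · exact P h1 h2

end CCA

end

section
namespace CCA

theorem lint_tail0 {δ : ℝ} (hδ : 0 < δ) :
    ∫⁻ t in {t : ℝ | δ < |t|}, ENNReal.ofReal (1 / |t| ^ 2) ≤ ENNReal.ofReal (2 / δ) := by
  have hset : {t : ℝ | δ < |t|} = Ioi δ ∪ Neg.neg ⁻¹' (Ioi δ) := by
    ext t; simp only [mem_setOf_eq, mem_union, mem_Ioi, mem_preimage, lt_abs]
  have h1 : ∫⁻ t in Ioi δ, ENNReal.ofReal (1 / |t| ^ 2) = ENNReal.ofReal (1 / δ) := by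
    have e : ∫⁻ t in Ioi δ, ENNReal.ofReal (1 / |t| ^ 2) =
        ∫⁻ t in Ioi δ, ENNReal.ofReal (t ^ (-2 : ℝ)) := by
      apply setLIntegral_congr_fun measurableSet_Ioi
      intro t ht
      have ht0 : 0 < t := hδ.trans ht
      simp only
      rw [abs_of_pos ht0, Real.rpow_neg ht0.le, one_div]
      norm_cast
    rw [e, ← ofReal_integral_eq_lintegral_ofReal (integrableOn_Ioi_rpow_of_lt (by norm_num) hδ),
      integral_Ioi_rpow_of_lt (by norm_num) hδ]
    · congr 1
      norm_num
      rw [Real.rpow_neg hδ.le]; simp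
    · filter_upwards [ae_restrict_mem measurableSet_Ioi] with t ht
      have ht0 : 0 < t := hδ.trans ht
      positivity
  have h2 : ∫⁻ t in Neg.neg ⁻¹' (Ioi δ), ENNReal.ofReal (1 / |t| ^ 2) = ENNReal.ofReal (1 / δ) := by
    have := (Measure.measurePreserving_neg (volume : Measure ℝ)).setLIntegral_comp_preimage
      (s := Ioi δ) measurableSet_Ioi (f := fun t => ENNReal.ofReal (1 / |t| ^ 2)) (by fun_prop)
    rw [← h1, ← this]
    simp only [abs_neg]
  rw [hset]
  refine (lintegral_union_le _ _ _).trans ?_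
  rw [h1, h2, ← ENNReal.ofReal_add (by positivity) (by positivity)]
  apply ENNReal.ofReal_le_ofReal
  apply le_of_eq; ring

noncomputable def qd (δ x y : ℝ) : ℝ := if δ < |x - y| then 1 / |x - y| ^ 2 else 0

theorem qd_nonneg (δ x y : ℝ) : 0 ≤ qd δ x y := by unfold qd; split_ifs <;> positivity

theorem qd_symm (δ x y : ℝ) : qd δ x y = qd δ y x := by unfold qd; rw [abs_sub_comm]

theorem measurable_qd (δ : ℝ) : Measurable fun p : ℝ × ℝ => qd δ p.1 p.2 := by
  unfold qd
  apply Measurable.ite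
  · exact measurableSet_lt measurable_const (by fun_prop)
  · fun_prop
  · fun_prop

theorem lint_qd {δ : ℝ} (hδ : 0 < δ) (y : ℝ) :
    ∫⁻ x, ENNReal.ofReal (qd δ x y) ≤ ENNReal.ofReal (2 / δ) := by
  have h := lintegral_sub_right_eq_self (μ := volume) (fun t => ENNReal.ofReal (qd δ t 0)) y
  have e : ∀ x, qd δ (x - y) 0 = qd δ x y := fun x => by simp [qd]
  simp only [e] at h
  rw [h]
  refine le_trans (le_of_eq ?_) (lint_tail0 hδ)
  rw [← lintegral_indicator (measurableSet_lt measurable_const (by fun_prop))]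
  congr 1
  ext t
  by_cases ht : δ < |t|
  · simp [qd, ht]
  · simp [qd, ht]

variable {ι : Type} [Fintype ι]

theorem measurable_KS {A : ι → ℝ → ℝ} (h : ∀ j, Measurable (A j)) :
    Measurable fun p : ℝ × ℝ => KS A p.1 p.2 := by
  unfold KS
  apply Measurable.div _ (by fun_prop)
  apply Finset.measurable_prod
  intro j _
  have := h j
  fun_prop

theorem measurable_kd {A : ι → ℝ → ℝ} (h : ∀ j, Measurable (A j)) (δ : ℝ) :
    Measurable fun p : ℝ × ℝ => kd A δ p.1 p.2 := by
  unfold kd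
  apply Measurable.ite
  · exact measurableSet_lt measurable_const (by fun_prop)
  · exact measurable_KS h
  · fun_prop

theorem kd_bound {A : ι → ℝ → ℝ} (h : Lip1 A) {δ : ℝ} (hδ : 0 < δ) (x y : ℝ) :
    |kd A δ x y| ≤ 1 / δ := by
  unfold kd
  split_ifs with hd
  · refine (KS_abs_le h x y).trans ?_
    gcongr
  · simp; positivity

theorem kd_bound2 {A : ι → ℝ → ℝ} (h : Lip1 A) {δ : ℝ} (x y z : ℝ) :
    |kd A δ x y * kd A δ x z| ≤ (qd δ x y + qd δ x z) / 2 := by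
  unfold kd qd
  split_ifs with h1 h2 h2
  · rw [abs_mul]
    have e1 := KS_abs_le h x y
    have e2 := KS_abs_le h x z
    rw [← one_div_pow, ← one_div_pow]
    have := abs_nonneg (KS A x y)
    have := abs_nonneg (KS A x z)
    nlinarith [sq_nonneg (1 / |x - y| - 1 / |x - z|), mul_le_mul e1 e2 (by positivity) (by positivity)]
  · simp; positivity
  · simp; positivity
  · simp

noncomputable def Dd (δ : ℝ) (p : ℝ × ℝ × ℝ) : ℝ :=
  if δ < |p.1 - p.2.1| ∧ δ < |p.2.1 - p.2.2| ∧ δ < |p.1 - p.2.2| then 1 else 0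

theorem measurable_Dd (δ : ℝ) : Measurable (Dd δ) := by
  unfold Dd
  apply Measurable.ite
  · have h1 : MeasurableSet {p : ℝ × ℝ × ℝ | δ < |p.1 - p.2.1|} := measurableSet_lt measurable_const (by fun_prop)
    have h2 : MeasurableSet {p : ℝ × ℝ × ℝ | δ < |p.2.1 - p.2.2|} := measurableSet_lt measurable_const (by fun_prop)
    have h3 : MeasurableSet {p : ℝ × ℝ × ℝ | δ < |p.1 - p.2.2|} := measurableSet_lt measurable_const (by fun_prop)
    exact h1.inter (h2.inter h3)
  · fun_prop
  · fun_prop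

theorem int_cyc (ν : Measure ℝ) [IsFiniteMeasure ν] (g : ℝ × ℝ × ℝ → ℝ) :
    ∫ p, g (p.2.1, p.2.2, p.1) ∂(ν.prod (ν.prod ν)) = ∫ p, g p ∂(ν.prod (ν.prod ν)) := by
  have h1 : MeasurePreserving (MeasurableEquiv.prodComm (α := ℝ) (β := ℝ × ℝ)) (ν.prod (ν.prod ν))
    ((ν.prod ν).prod ν) := Measure.measurePreserving_swap
  have h2 := measurePreserving_prodAssoc ν ν ν
  have h3 : MeasurePreserving (MeasurableEquiv.prodComm.trans MeasurableEquiv.prodAssoc :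
    ℝ × ℝ × ℝ ≃ᵐ ℝ × ℝ × ℝ) (ν.prod (ν.prod ν)) (ν.prod (ν.prod ν)) := h2.comp h1
  exact h3.integral_comp' g

theorem E_bound (ν : Measure ℝ) [IsFiniteMeasure ν] (hν : ν ≤ volume) {δ : ℝ} (hδ : 0 < δ) :
    ∫⁻ p, ENNReal.ofReal ((if |p.2.1 - p.2.2| ≤ δ then 1 else 0) * ((qd δ p.1 p.2.1 + qd δ p.1 p.2.2) / 2))
      ∂(ν.prod (ν.prod ν)) ≤ 4 * ν univ := by
  let χ : ℝ → ℝ → ℝ≥0∞ := fun y z => if |y - z| ≤ δ then 1 else 0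
  have hχm : Measurable fun p : ℝ × ℝ => χ p.1 p.2 := by
    apply Measurable.ite
    · exact measurableSet_le (by fun_prop) measurable_const
    · fun_prop
    · fun_prop
  have hχs : ∀ y z, χ y z = χ z y := fun y z => by simp only [χ, abs_sub_comm]
  have hχi : ∀ y, ∫⁻ z, χ y z ∂ν ≤ ENNReal.ofReal (2 * δ) := by
    intro y
    calc ∫⁻ z, χ y z ∂ν ≤ ∫⁻ z, χ y z := lintegral_mono' hν le_rfl
      _ = ∫⁻ z, indicator (Metric.closedBall y δ) 1 z := by
        congr 1; ext z
        simp only [χ, indicator, Metric.mem_closedBall, Real.dist_eq, abs_sub_comm y z]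
        rfl
      _ = ENNReal.ofReal (2 * δ) := by
        rw [lintegral_indicator_one Metric.isClosed_closedBall.measurableSet, Real.volume_closedBall]
  have hq := measurable_qd δ
  have hq2 : Measurable fun p : ℝ × ℝ => ENNReal.ofReal (qd δ p.1 p.2) := by fun_prop
  have hqi : ∫⁻ x, ∫⁻ y, ENNReal.ofReal (qd δ x y) ∂ν ∂ν ≤ ENNReal.ofReal (2 / δ) * ν univ := by
    rw [lintegral_lintegral_swap hq2.aemeasurable]
    calc ∫⁻ y, ∫⁻ x, ENNReal.ofReal (qd δ x y) ∂ν ∂ν ≤ ∫⁻ y, ENNReal.ofReal (2 / δ) ∂ν := by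
          apply lintegral_mono
          intro y
          exact (lintegral_mono' hν le_rfl).trans (lint_qd hδ y)
      _ = _ := by simp
  have m1 : Measurable fun p : ℝ × ℝ × ℝ => χ p.2.1 p.2.2 * ENNReal.ofReal (qd δ p.1 p.2.1) := by
    have a1 : Measurable fun p : ℝ × ℝ × ℝ => χ p.2.1 p.2.2 := hχm.comp measurable_snd
    have a2 : Measurable fun p : ℝ × ℝ × ℝ => ENNReal.ofReal (qd δ p.1 p.2.1) :=
      hq2.comp (by fun_prop : Measurable fun p : ℝ × ℝ × ℝ => (p.1, p.2.1))
    exact a1.mul a2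
  have m2 : Measurable fun p : ℝ × ℝ × ℝ => χ p.2.1 p.2.2 * ENNReal.ofReal (qd δ p.1 p.2.2) := by
    have a1 : Measurable fun p : ℝ × ℝ × ℝ => χ p.2.1 p.2.2 := hχm.comp measurable_snd
    have a2 : Measurable fun p : ℝ × ℝ × ℝ => ENNReal.ofReal (qd δ p.1 p.2.2) :=
      hq2.comp (by fun_prop : Measurable fun p : ℝ × ℝ × ℝ => (p.1, p.2.2))
    exact a1.mul a2
  have b1 : ∫⁻ p, χ p.2.1 p.2.2 * ENNReal.ofReal (qd δ p.1 p.2.1) ∂(ν.prod (ν.prod ν)) ≤ 4 * ν univ := by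
    rw [lintegral_prod _ m1.aemeasurable]
    calc ∫⁻ x, ∫⁻ w, χ w.1 w.2 * ENNReal.ofReal (qd δ x w.1) ∂(ν.prod ν) ∂ν
        = ∫⁻ x, ∫⁻ y, ∫⁻ z, χ y z * ENNReal.ofReal (qd δ x y) ∂ν ∂ν ∂ν := by
          congr 1; ext x
          rw [lintegral_prod]
          exact (m1.comp measurable_prodMk_left).aemeasurable
      _ ≤ ∫⁻ x, ∫⁻ y, ENNReal.ofReal (2 * δ) * ENNReal.ofReal (qd δ x y) ∂ν ∂ν := by
          apply lintegral_mono; intro x; apply lintegral_mono; intro y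
          simp only
          rw [lintegral_mul_const' _ _ ENNReal.ofReal_ne_top]
          gcongr
          exact hχi y
      _ = ENNReal.ofReal (2 * δ) * ∫⁻ x, ∫⁻ y, ENNReal.ofReal (qd δ x y) ∂ν ∂ν := by
          simp_rw [lintegral_const_mul' _ _ ENNReal.ofReal_ne_top]
      _ ≤ ENNReal.ofReal (2 * δ) * (ENNReal.ofReal (2 / δ) * ν univ) := by gcongr
      _ = _ := by
          rw [← mul_assoc, ← ENNReal.ofReal_mul (by positivity)]
          congr 1
          have : 2 * δ * (2 / δ) = 4 := by field_simp; norm_num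
          rw [this]; norm_num
  have b2 : ∫⁻ p, χ p.2.1 p.2.2 * ENNReal.ofReal (qd δ p.1 p.2.2) ∂(ν.prod (ν.prod ν)) ≤ 4 * ν univ := by
    refine le_trans (le_of_eq ?_) b1
    rw [lintegral_prod _ m1.aemeasurable, lintegral_prod _ m2.aemeasurable]
    congr 1; ext x
    rw [lintegral_prod, lintegral_prod_symm]
    · simp only [hχs]
    · exact (m1.comp measurable_prodMk_left).aemeasurable
    · exact (m2.comp measurable_prodMk_left).aemeasurable
  calc ∫⁻ p, ENNReal.ofReal ((if |p.2.1 - p.2.2| ≤ δ then 1 else 0) *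
        ((qd δ p.1 p.2.1 + qd δ p.1 p.2.2) / 2)) ∂(ν.prod (ν.prod ν))
      = ∫⁻ p, ENNReal.ofReal (1 / 2) * (χ p.2.1 p.2.2 * ENNReal.ofReal (qd δ p.1 p.2.1) +
          χ p.2.1 p.2.2 * ENNReal.ofReal (qd δ p.1 p.2.2)) ∂(ν.prod (ν.prod ν)) := by
        congr 1; ext p
        have h1 := qd_nonneg δ p.1 p.2.1
        have h2 := qd_nonneg δ p.1 p.2.2
        simp only [χ]
        split_ifs with hc
        · rw [one_mul, one_mul, one_mul, ← ENNReal.ofReal_add h1 h2, ← ENNReal.ofReal_mul (by norm_num)]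
          congr 1; ring
        · simp
    _ = ENNReal.ofReal (1 / 2) * ((∫⁻ p, χ p.2.1 p.2.2 * ENNReal.ofReal (qd δ p.1 p.2.1) ∂(ν.prod (ν.prod ν))) +
          ∫⁻ p, χ p.2.1 p.2.2 * ENNReal.ofReal (qd δ p.1 p.2.2) ∂(ν.prod (ν.prod ν))) := by
        rw [lintegral_const_mul' _ _ ENNReal.ofReal_ne_top, lintegral_add_left m1]
    _ ≤ ENNReal.ofReal (1 / 2) * (4 * ν univ + 4 * ν univ) := by gcongr
    _ = 4 * ν univ := by
        rw [← two_mul, ← mul_assoc]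
        have : ENNReal.ofReal (1 / 2) * 2 = 1 := by
          have h2 : (2 : ℝ≥0∞) = ENNReal.ofReal 2 := by norm_num
          rw [h2, ← ENNReal.ofReal_mul (by norm_num)]; norm_num
        rw [this, one_mul]

theorem sym_identity {A : ι → ℝ → ℝ} (h : Lip1 A) (ν : Measure ℝ) [IsFiniteMeasure ν]
    (hν : ν ≤ volume) {δ : ℝ} (hδ : 0 < δ) :
    |∫ x, (∫ y, kd A δ x y ∂ν) ^ 2 ∂ν -
      1 / 3 * ∫ p, Dd δ p * SS A p.1 p.2.1 p.2.2 ∂(ν.prod (ν.prod ν))| ≤ 4 * (ν univ).toReal := by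
  have hAm : ∀ j, Measurable (A j) := fun j => (h.cont j).measurable
  have hkm := measurable_kd hAm δ
  have hKm := measurable_KS hAm
  set G : ℝ × ℝ × ℝ → ℝ := fun p => kd A δ p.1 p.2.1 * kd A δ p.1 p.2.2 with hG
  set χ : ℝ × ℝ × ℝ → ℝ := fun p => if |p.2.1 - p.2.2| ≤ δ then 1 else 0 with hχ
  have hχm : Measurable χ := by
    apply Measurable.ite
    · exact measurableSet_le (by fun_prop) measurable_const
    · fun_prop
    · fun_prop
  have k12 : Measurable fun p : ℝ × ℝ × ℝ => kd A δ p.1 p.2.1 :=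
    hkm.comp (by fun_prop : Measurable fun p : ℝ × ℝ × ℝ => (p.1, p.2.1))
  have k13 : Measurable fun p : ℝ × ℝ × ℝ => kd A δ p.1 p.2.2 :=
    hkm.comp (by fun_prop : Measurable fun p : ℝ × ℝ × ℝ => (p.1, p.2.2))
  have hGm : Measurable G := k12.mul k13
  have hGb : ∀ p, |G p| ≤ 1 / δ * (1 / δ) := by
    intro p
    rw [hG]; simp only; rw [abs_mul]
    exact mul_le_mul (kd_bound h hδ _ _) (kd_bound h hδ _ _) (abs_nonneg _) (by positivity)
  have hGi : Integrable G (ν.prod (ν.prod ν)) :=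
    Integrable.of_bound hGm.aestronglyMeasurable _ (ae_of_all _ hGb)
  have hχGi : Integrable (fun p => χ p * G p) (ν.prod (ν.prod ν)) := by
    refine Integrable.of_bound (hχm.mul hGm).aestronglyMeasurable (1 / δ * (1 / δ)) (ae_of_all _ fun p => ?_)
    rw [Real.norm_eq_abs, abs_mul]
    have : |χ p| ≤ 1 := by rw [hχ]; simp only; split_ifs <;> simp
    calc |χ p| * |G p| ≤ 1 * |G p| := by gcongr
      _ ≤ _ := by rw [one_mul]; exact hGb p
  have e1 : ∫ x, (∫ y, kd A δ x y ∂ν) ^ 2 ∂ν = ∫ p, G p ∂(ν.prod (ν.prod ν)) := by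
    rw [integral_prod _ hGi]
    congr 1; ext x
    rw [hG]; simp only
    rw [integral_prod_mul (fun y => kd A δ x y) (fun y => kd A δ x y), sq]
  have hDG : ∀ p, G p - χ p * G p = Dd δ p * (KS A p.1 p.2.1 * KS A p.1 p.2.2) := by
    rintro ⟨x, y, z⟩
    simp only [hG, hχ, Dd, kd]
    by_cases c1 : δ < |x - y| <;> by_cases c2 : |y - z| ≤ δ <;> by_cases c3 : δ < |x - z| <;>
      simp [c1, c2, c3, not_lt.2, not_le.1]
  set F : ℝ × ℝ × ℝ → ℝ := fun p => Dd δ p * (KS A p.1 p.2.1 * KS A p.1 p.2.2) with hF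
  have hFeq : F = fun p => G p - χ p * G p := by ext p; rw [hDG]
  have hFi : Integrable F (ν.prod (ν.prod ν)) := by rw [hFeq]; exact hGi.sub hχGi
  have e2 : ∫ p, G p ∂(ν.prod (ν.prod ν)) = ∫ p, F p ∂(ν.prod (ν.prod ν)) +
      ∫ p, χ p * G p ∂(ν.prod (ν.prod ν)) := by
    rw [hFeq, integral_sub hGi hχGi]; ring
  have c1 : ∫ p, F (p.2.1, p.2.2, p.1) ∂(ν.prod (ν.prod ν)) = ∫ p, F p ∂(ν.prod (ν.prod ν)) := int_cyc ν F
  have c2 : ∫ p, F (p.2.2, p.1, p.2.1) ∂(ν.prod (ν.prod ν)) = ∫ p, F p ∂(ν.prod (ν.prod ν)) := by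
    rw [← c1]
    exact int_cyc ν (fun p => F (p.2.1, p.2.2, p.1))
  have mp : MeasurePreserving (fun p : ℝ × ℝ × ℝ => (p.2.1, p.2.2, p.1)) (ν.prod (ν.prod ν))
      (ν.prod (ν.prod ν)) :=
    (measurePreserving_prodAssoc ν ν ν).comp (Measure.measurePreserving_swap (μ := ν) (ν := ν.prod ν))
  have i1 : Integrable (fun p : ℝ × ℝ × ℝ => F (p.2.1, p.2.2, p.1)) (ν.prod (ν.prod ν)) :=
    mp.integrable_comp_of_integrable hFi
  have i2 : Integrable (fun p : ℝ × ℝ × ℝ => F (p.2.2, p.1, p.2.1)) (ν.prod (ν.prod ν)) :=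
    mp.integrable_comp_of_integrable i1
  have hD1 : ∀ p : ℝ × ℝ × ℝ, Dd δ (p.2.1, p.2.2, p.1) = Dd δ p := by
    rintro ⟨x, y, z⟩
    simp only [Dd]
    rw [abs_sub_comm z x, abs_sub_comm y x]
    congr 1
    simp only [eq_iff_iff]; tauto
  have hD2 : ∀ p : ℝ × ℝ × ℝ, Dd δ (p.2.2, p.1, p.2.1) = Dd δ p := by
    intro p
    rw [← hD1 p, ← hD1 (p.2.1, p.2.2, p.1)]
  have e3 : ∫ p, Dd δ p * SS A p.1 p.2.1 p.2.2 ∂(ν.prod (ν.prod ν)) =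
      3 * ∫ p, F p ∂(ν.prod (ν.prod ν)) := by
    have : ∀ p : ℝ × ℝ × ℝ, Dd δ p * SS A p.1 p.2.1 p.2.2 =
        (F p + F (p.2.1, p.2.2, p.1)) + F (p.2.2, p.1, p.2.1) := by
      intro p
      simp only [hF]
      rw [hD1, hD2]
      unfold SS; ring
    simp_rw [this]
    have i01 : Integrable (fun p : ℝ × ℝ × ℝ => F p + F (p.2.1, p.2.2, p.1)) (ν.prod (ν.prod ν)) := hFi.add i1
    rw [integral_add i01 i2, integral_add hFi i1, c1, c2]; ring
  rw [e1, e2, e3]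
  have e4 : ∀ a b : ℝ, a + b - 1 / 3 * (3 * a) = b := by intro a b; ring
  rw [e4, ← Real.norm_eq_abs]
  refine (norm_integral_le_lintegral_norm _).trans ?_
  have h4 : (4 : ℝ) * (ν univ).toReal = (4 * ν univ).toReal := by simp
  rw [h4]
  apply ENNReal.toReal_mono (by finiteness)
  refine le_trans (lintegral_mono fun p => ENNReal.ofReal_le_ofReal ?_) (E_bound ν hν hδ)
  rw [Real.norm_eq_abs, abs_mul]
  have : |χ p| = (if |p.2.1 - p.2.2| ≤ δ then 1 else 0) := by
    simp only [hχ]; split_ifs <;> simp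
  rw [this]
  exact mul_le_mul_of_nonneg_left (kd_bound2 h _ _ _) (by split_ifs <;> norm_num)

theorem Dd_WW_nonneg {g : ℝ → ℝ} (h : Lip1 (fun _ : Unit => g)) {δ : ℝ} (hδ : 0 < δ) (p : ℝ × ℝ × ℝ) :
    0 ≤ Dd δ p * WW g p.1 p.2.1 p.2.2 := by
  unfold Dd
  split_ifs with hc
  · rw [one_mul]
    have hp : ∀ {a b : ℝ}, δ < |a - b| → a ≠ b := by
      intro a b hab he; rw [he, sub_self, abs_zero] at hab; linarith
    exact (SS_bound h (hp hc.1) (hp hc.2.1) (hp hc.2.2)).1 ()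
  · simp

theorem Dd_SS_bound {A : ι → ℝ → ℝ} (h : Lip1 A) {δ : ℝ} (hδ : 0 < δ) (p : ℝ × ℝ × ℝ) :
    |Dd δ p * SS A p.1 p.2.1 p.2.2| ≤ 3 * (1 / δ * (1 / δ)) := by
  unfold Dd
  split_ifs with hc
  · rw [one_mul]
    have hp : ∀ {a b : ℝ}, δ < |a - b| → |KS A a b| ≤ 1 / δ := by
      intro a b hab
      refine (KS_abs_le h a b).trans ?_
      gcongr
    have h1 := hp hc.1
    have h2 := hp hc.2.1
    have h3 := hp hc.2.2
    unfold SS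
    rw [KS_anti A p.2.1 p.1, KS_anti A p.2.2 p.1, KS_anti A p.2.2 p.2.1]
    have m : ∀ {a b : ℝ}, |a| ≤ 1 / δ → |b| ≤ 1 / δ → |a * b| ≤ 1 / δ * (1 / δ) := by
      intro a b ha hb
      rw [abs_mul]
      exact mul_le_mul ha hb (abs_nonneg _) (by positivity)
    refine (abs_add_le _ _).trans ?_
    have := abs_add_le (KS A p.1 p.2.1 * KS A p.1 p.2.2) (KS A p.2.1 p.2.2 * -KS A p.1 p.2.1)
    have := m h1 h3
    have := m h2 (b := -KS A p.1 p.2.1) (by rwa [abs_neg])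
    have := m (a := -KS A p.1 p.2.2) (b := -KS A p.2.1 p.2.2) (by rwa [abs_neg]) (by rwa [abs_neg])
    linarith
  · simp; positivity

theorem Dd_SS_integrable {A : ι → ℝ → ℝ} (h : Lip1 A) {δ : ℝ} (hδ : 0 < δ) (ν : Measure ℝ)
    [IsFiniteMeasure ν] :
    Integrable (fun p : ℝ × ℝ × ℝ => Dd δ p * SS A p.1 p.2.1 p.2.2) (ν.prod (ν.prod ν)) := by
  have hAm : ∀ j, Measurable (A j) := fun j => (h.cont j).measurable
  have hKm := measurable_KS hAm
  refine Integrable.of_bound ?_ _ (ae_of_all _ (Dd_SS_bound h hδ))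
  apply Measurable.aestronglyMeasurable
  apply (measurable_Dd δ).mul
  unfold SS
  have c : ∀ {u v : ℝ × ℝ × ℝ → ℝ}, Measurable u → Measurable v →
      Measurable fun p => KS A (u p) (v p) := fun hu hv => hKm.comp (hu.prodMk hv)
  have m1 : Measurable fun p : ℝ × ℝ × ℝ => p.1 := by fun_prop
  have m2 : Measurable fun p : ℝ × ℝ × ℝ => p.2.1 := by fun_prop
  have m3 : Measurable fun p : ℝ × ℝ × ℝ => p.2.2 := by fun_prop
  exact (((c m1 m2).mul (c m1 m3)).add ((c m2 m3).mul (c m2 m1))).add ((c m3 m1).mul (c m3 m2))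

theorem test_bound {A : ι → ℝ → ℝ} (h : Lip1 A) (ν : Measure ℝ) [IsFiniteMeasure ν]
    (hν : ν ≤ volume) {δ : ℝ} (hδ : 0 < δ) :
    ∫ x, (∫ y, kd A δ x y ∂ν) ^ 2 ∂ν ≤ 4 * (ν univ).toReal +
      Fintype.card ι * ∑ j, ∫ p, Dd δ p * WW (A j) p.1 p.2.1 p.2.2 ∂(ν.prod (ν.prod ν)) := by
  have h1 := (abs_le.1 (sym_identity h ν hν hδ)).2
  have hL : ∀ j, Lip1 (fun _ : Unit => A j) := fun j _ => h j
  have hi : ∀ j, Integrable (fun p : ℝ × ℝ × ℝ => Dd δ p * WW (A j) p.1 p.2.1 p.2.2)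
      (ν.prod (ν.prod ν)) := fun j => Dd_SS_integrable (hL j) hδ ν
  have h2 : ∫ p, Dd δ p * SS A p.1 p.2.1 p.2.2 ∂(ν.prod (ν.prod ν)) ≤
      2 * Fintype.card ι * ∑ j, ∫ p, Dd δ p * WW (A j) p.1 p.2.1 p.2.2 ∂(ν.prod (ν.prod ν)) := by
    rw [← integral_finsetSum _ (fun j _ => hi j), ← integral_const_mul]
    apply integral_mono (Dd_SS_integrable h hδ ν) ((integrable_finsetSum _ (fun j _ => hi j)).const_mul _)
    intro p
    simp only [Dd]
    split_ifs with hc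
    · have hp : ∀ {a b : ℝ}, δ < |a - b| → a ≠ b := by
        intro a b hab he; rw [he, sub_self, abs_zero] at hab; linarith
      have := (SS_bound h (hp hc.1) (hp hc.2.1) (hp hc.2.2)).2
      simp only [one_mul]
      exact (le_abs_self _).trans this
    · simp
  have h3 : 0 ≤ Fintype.card ι * ∑ j, ∫ p, Dd δ p * WW (A j) p.1 p.2.1 p.2.2 ∂(ν.prod (ν.prod ν)) := by
    apply mul_nonneg (by positivity)
    exact Finset.sum_nonneg fun j _ => integral_nonneg (Dd_WW_nonneg (hL j) hδ)
  nlinarith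

theorem WW_bound {g : ℝ → ℝ} (h : Lip1 (fun _ : Unit => g)) (ν : Measure ℝ) [IsFiniteMeasure ν]
    (hν : ν ≤ volume) {δ : ℝ} (hδ : 0 < δ) :
    ∫ p, Dd δ p * WW g p.1 p.2.1 p.2.2 ∂(ν.prod (ν.prod ν)) ≤
      3 * ∫ x, (∫ y, kd (fun _ : Unit => g) δ x y ∂ν) ^ 2 ∂ν + 12 * (ν univ).toReal := by
  have h1 := (abs_le.1 (sym_identity h ν hν hδ)).1
  unfold WW
  linarith

end CCA

end

section
namespace CCA
variable {ι : Type} [Fintype ι]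

theorem kd_int {A : ι → ℝ → ℝ} (hA : Lip1 A) {δ : ℝ} (hδ : 0 < δ) (x : ℝ) {μ : Measure ℝ} {h : ℝ → ℝ}
    (hh : Integrable h μ) : Integrable (fun y => kd A δ x y * h y) μ := by
  have hm : Measurable fun y => kd A δ x y :=
    (measurable_kd (fun j => (hA.cont j).measurable) δ).comp measurable_prodMk_left
  exact hh.bdd_mul hm.aestronglyMeasurable (ae_of_all _ fun y => kd_bound hA hδ x y)

theorem meas_T {A : ι → ℝ → ℝ} (hA : Lip1 A) {δ : ℝ} {μ : Measure ℝ} [SFinite μ] {h : ℝ → ℝ}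
    (hh : Measurable h) : Measurable fun x => ∫ y, kd A δ x y * h y ∂μ := by
  have hm := measurable_kd (fun j => (hA.cont j).measurable) δ
  have : StronglyMeasurable fun p : ℝ × ℝ => kd A δ p.1 p.2 * h p.2 :=
    (hm.mul (hh.comp measurable_snd)).stronglyMeasurable
  exact (StronglyMeasurable.integral_prod_right this).measurable

theorem T_bdd {A : ι → ℝ → ℝ} (hA : Lip1 A) {δ : ℝ} (hδ : 0 < δ) {μ : Measure ℝ} [IsFiniteMeasure μ]
    {h : ℝ → ℝ} (h1 : ∀ x, |h x| ≤ 1) (x : ℝ) :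
    |∫ y, kd A δ x y * h y ∂μ| ≤ 1 / δ * μ.real univ := by
  rw [← Real.norm_eq_abs]
  refine norm_integral_le_of_norm_le_const (ae_of_all _ fun y => ?_)
  rw [Real.norm_eq_abs, abs_mul]
  calc _ ≤ 1 / δ * 1 := mul_le_mul (kd_bound hA hδ x y) (h1 y) (abs_nonneg _) (by positivity)
    _ = _ := mul_one _

theorem Tsq_int {A : ι → ℝ → ℝ} (hA : Lip1 A) {δ : ℝ} (hδ : 0 < δ) {μ : Measure ℝ} [IsFiniteMeasure μ]
    {h : ℝ → ℝ} (hh : Measurable h) (h1 : ∀ x, |h x| ≤ 1) :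
    Integrable (fun x => (∫ y, kd A δ x y * h y ∂μ) ^ 2) μ := by
  refine Integrable.of_bound ((meas_T hA hh).pow_const 2).aestronglyMeasurable ((1 / δ * μ.real univ) ^ 2)
    (ae_of_all _ fun x => ?_)
  rw [norm_pow, Real.norm_eq_abs]
  gcongr
  exact T_bdd hA hδ h1 x

theorem test_rho {A : ι → ℝ → ℝ} (hA : Lip1 A) {δ : ℝ} (hδ : 0 < δ) {u v C1 : ℝ} (huv : u < v)
    (hW : ∀ j, ∫ p, Dd δ p * WW (A j) p.1 p.2.1 p.2.2 ∂((volume.restrict (Ioc u v)).prod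
      ((volume.restrict (Ioc u v)).prod (volume.restrict (Ioc u v)))) ≤ C1 * (v - u))
    {ρ : ℝ → ℝ} (hρ : Measurable ρ) (h1 : ∀ x, 1 / 2 ≤ ρ x) (h2 : ∀ x, ρ x ≤ 1) :
    ∫ x in Ioc u v, (∫ y in Ioc u v, kd A δ x y * ρ y) ^ 2 ≤
      2 * (4 + Fintype.card ι ^ 2 * C1) * (v - u) := by
  set μ := (volume : Measure ℝ).restrict (Ioc u v) with hμ
  set ν := μ.withDensity (fun x => ((ρ x).toNNReal : ℝ≥0∞)) with hν
  have hρm : Measurable fun x => (ρ x).toNNReal := hρ.real_toNNReal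
  have hνμ : ν ≤ μ := by
    conv_rhs => rw [← withDensity_one (μ := μ)]
    refine withDensity_mono (ae_of_all _ fun x => ?_)
    simpa using h2 x
  haveI : IsFiniteMeasure ν := isFiniteMeasure_of_le μ hνμ
  have hνv : ν ≤ volume := hνμ.trans Measure.restrict_le_self
  have hρ0 : ∀ x, 0 ≤ ρ x := fun x => by linarith [h1 x]
  have key := test_bound hA ν hνv hδ
  have e1 : ∀ x, ∫ y, kd A δ x y ∂ν = ∫ y, kd A δ x y * ρ y ∂μ := by
    intro x
    rw [hν, integral_withDensity_eq_integral_smul hρm]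
    congr 1; ext y
    rw [NNReal.smul_def, smul_eq_mul, Real.coe_toNNReal _ (hρ0 y), mul_comm]
  simp_rw [e1] at key
  have e2 : ∫ x, (∫ y, kd A δ x y * ρ y ∂μ) ^ 2 ∂ν = ∫ x, ρ x * (∫ y, kd A δ x y * ρ y ∂μ) ^ 2 ∂μ := by
    rw [hν, integral_withDensity_eq_integral_smul hρm]
    congr 1; ext y
    rw [NNReal.smul_def, smul_eq_mul, Real.coe_toNNReal _ (hρ0 y)]
  rw [e2] at key
  have hab : ∀ x, |ρ x| ≤ 1 := fun x => by rw [abs_of_nonneg (hρ0 x)]; exact h2 x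
  have hI := Tsq_int hA hδ (μ := μ) hρ hab
  have hI2 : Integrable (fun x => ρ x * (∫ y, kd A δ x y * ρ y ∂μ) ^ 2) μ :=
    hI.bdd_mul hρ.aestronglyMeasurable (ae_of_all _ fun x => hab x)
  have e3 : ∫ x, (∫ y, kd A δ x y * ρ y ∂μ) ^ 2 ∂μ ≤ 2 * ∫ x, ρ x * (∫ y, kd A δ x y * ρ y ∂μ) ^ 2 ∂μ := by
    rw [← integral_const_mul]
    apply integral_mono hI (hI2.const_mul 2)
    intro x
    simp only
    nlinarith [h1 x, sq_nonneg (∫ y, kd A δ x y * ρ y ∂μ)]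
  have e4 : (ν univ).toReal ≤ v - u := by
    have : ν univ ≤ ENNReal.ofReal (v - u) := by
      refine (hνμ univ).trans ?_
      rw [hμ, Measure.restrict_apply_univ, Real.volume_Ioc]
    exact ENNReal.toReal_le_of_le_ofReal (by linarith) this
  have e5 : ∀ j, ∫ p, Dd δ p * WW (A j) p.1 p.2.1 p.2.2 ∂(ν.prod (ν.prod ν)) ≤ C1 * (v - u) := by
    intro j
    refine le_trans ?_ (hW j)
    have hL : Lip1 (fun _ : Unit => A j) := fun _ => hA j
    apply integral_mono_measure
    · exact Measure.prod_mono hνμ (Measure.prod_mono hνμ hνμ)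
    · exact ae_of_all _ (Dd_WW_nonneg hL hδ)
    · exact Dd_SS_integrable hL hδ μ
  have e6 : ∑ j, ∫ p, Dd δ p * WW (A j) p.1 p.2.1 p.2.2 ∂(ν.prod (ν.prod ν)) ≤
      Fintype.card ι * (C1 * (v - u)) := by
    refine (Finset.sum_le_sum fun j _ => e5 j).trans ?_
    simp
  have e7 : (Fintype.card ι : ℝ) * ∑ j, ∫ p, Dd δ p * WW (A j) p.1 p.2.1 p.2.2 ∂(ν.prod (ν.prod ν)) ≤
      Fintype.card ι * (Fintype.card ι * (C1 * (v - u))) := by gcongr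
  nlinarith

theorem test_h {A : ι → ℝ → ℝ} (hA : Lip1 A) {δ : ℝ} (hδ : 0 < δ) {u v C1 : ℝ} (huv : u < v)
    (hW : ∀ j, ∫ p, Dd δ p * WW (A j) p.1 p.2.1 p.2.2 ∂((volume.restrict (Ioc u v)).prod
      ((volume.restrict (Ioc u v)).prod (volume.restrict (Ioc u v)))) ≤ C1 * (v - u))
    {h : ℝ → ℝ} (hh : Measurable h) (h1 : ∀ x, |h x| ≤ 1) :
    ∫ x in Ioc u v, (∫ y in Ioc u v, kd A δ x y * h y) ^ 2 ≤
      128 * (4 + Fintype.card ι ^ 2 * C1) * (v - u) := by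
  set μ := (volume : Measure ℝ).restrict (Ioc u v) with hμ
  have ha : ∀ x, -1 ≤ h x ∧ h x ≤ 1 := fun x => abs_le.1 (h1 x)
  have m1 : Measurable fun x => (3 + h x) / 4 := by fun_prop
  have t1 := test_rho hA hδ huv hW (ρ := fun x => (3 + h x) / 4) m1
    (fun x => by linarith [(ha x).1]) (fun x => by linarith [(ha x).2])
  have t2 := test_rho hA hδ huv hW (ρ := fun _ => 3 / 4) measurable_const
    (fun x => by norm_num) (fun x => by norm_num)
  have b1 : ∀ x, |(3 + h x) / 4| ≤ 1 := fun x => by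
    rw [abs_le]; constructor <;> linarith [(ha x).1, (ha x).2]
  have b2 : ∀ x : ℝ, |(3 / 4 : ℝ)| ≤ 1 := fun x => by norm_num [abs_le]
  have i1 := Tsq_int hA hδ (μ := μ) m1 b1
  have i2 := Tsq_int hA hδ (μ := μ) (h := fun _ => 3 / 4) measurable_const b2
  have iρ1 : Integrable (fun x => (3 + h x) / 4) μ :=
    Integrable.of_bound m1.aestronglyMeasurable 1 (ae_of_all _ b1)
  have iρ2 : Integrable (fun _ : ℝ => (3 / 4 : ℝ)) μ := integrable_const _
  have e : ∀ x, (∫ y, kd A δ x y * h y ∂μ) =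
      4 * (∫ y, kd A δ x y * ((3 + h y) / 4) ∂μ) - 4 * ∫ y, kd A δ x y * (3 / 4) ∂μ := by
    intro x
    rw [← integral_const_mul, ← integral_const_mul,
      ← integral_sub ((kd_int hA hδ x iρ1).const_mul 4) ((kd_int hA hδ x iρ2).const_mul 4)]
    congr 1; ext y; ring
  have : ∫ x, (∫ y, kd A δ x y * h y ∂μ) ^ 2 ∂μ ≤
      ∫ x, (32 * (∫ y, kd A δ x y * ((3 + h y) / 4) ∂μ) ^ 2 + 32 * (∫ y, kd A δ x y * (3 / 4) ∂μ) ^ 2) ∂μ := by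
    apply integral_mono (Tsq_int hA hδ hh h1) ((i1.const_mul 32).add (i2.const_mul 32))
    intro x
    simp only [Pi.add_apply]
    rw [e x]
    nlinarith [sq_nonneg ((∫ y, kd A δ x y * ((3 + h y) / 4) ∂μ) + ∫ y, kd A δ x y * (3 / 4) ∂μ)]
  rw [integral_add (i1.const_mul 32) (i2.const_mul 32), integral_const_mul, integral_const_mul] at this
  linarith

theorem hilb_test {δ : ℝ} (hδ : 0 < δ) {u v : ℝ} (huv : u < v)
    {h : ℝ → ℝ} (hh : Measurable h) (h1 : ∀ x, |h x| ≤ 1) :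
    ∫ x in Ioc u v, (∫ y in Ioc u v, kd (fun j : Empty => (j.elim : ℝ → ℝ)) δ x y * h y) ^ 2 ≤
      512 * (v - u) := by
  have hL : Lip1 (fun j : Empty => (j.elim : ℝ → ℝ)) := fun j => j.elim
  have := test_h hL hδ huv (C1 := 0) (fun j => j.elim) hh h1
  simp at this
  linarith

theorem kd_split {A : ι → ℝ → ℝ} (hA : Lip1 A) {δ : ℝ} (hδ : 0 < δ) {u v x : ℝ} (hx : x ∈ Ioc u v)
    {h : ℝ → ℝ} (hh : Measurable h) (h1 : ∀ x, |h x| ≤ 1) :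
    ∫ y in Ioc u v, kd A δ x y * h y =
      (∫ y in Ioc u (x - δ), KS A x y * h y) + ∫ y in Ioc (x + δ) v, KS A x y * h y := by
  have hi : ∀ a b : ℝ, IntegrableOn h (Ioc a b) := fun a b => 
    Integrable.of_bound hh.aestronglyMeasurable 1 (ae_of_all _ h1)
  have e : ∫ y in Ioc u v, kd A δ x y * h y = ∫ y in Ioc u (x - δ) ∪ Ioc (x + δ) v, kd A δ x y * h y := by
    apply setIntegral_eq_of_subset_of_forall_diff_eq_zero measurableSet_Ioc
    · rintro y (hy | hy)
      · exact ⟨hy.1, by linarith [hy.2, hx.2]⟩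
      · exact ⟨by linarith [hy.1, hx.1], hy.2⟩
    · rintro y ⟨hy, hy'⟩
      simp only [mem_union, mem_Ioc, not_or, not_and_or, not_lt, not_le] at hy'
      have h1 : x - δ < y := by
        rcases hy'.1 with h | h
        · linarith [hy.1]
        · exact h
      have h2 : y ≤ x + δ := by
        rcases hy'.2 with h | h
        · exact h
        · linarith [hy.2]
      have : ¬ δ < |x - y| := by
        rw [not_lt, abs_le]; constructor <;> linarith
      simp [kd, this]
  rw [e, setIntegral_union]
  · congr 1
    · apply setIntegral_congr_ae measurableSet_Ioc
      have : ∀ᵐ y : ℝ, y ≠ x - δ := Measure.ae_ne _ _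
      filter_upwards [this] with y hy hyI
      have : δ < |x - y| := by
        have := lt_of_le_of_ne hyI.2 hy
        rw [lt_abs]; left; linarith
      simp [kd, this]
    · apply setIntegral_congr_fun measurableSet_Ioc
      intro y hyI
      have : δ < |x - y| := by
        rw [lt_abs]; right; linarith [hyI.1]
      simp [kd, this]
  · rw [disjoint_left]
    intro y hy hy'
    linarith [hy.2, hy'.1]
  · exact measurableSet_Ioc
  · exact kd_int hA hδ x (hi _ _)
  · exact kd_int hA hδ x (hi _ _)

theorem byparts {g : ℝ → ℝ} (hg : Lip1 (fun _ : Unit => g)) {p q x : ℝ} (hx : x < p ∨ q < x) :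
    |(∫ y in Ioc p q, (g x - g y) / (x - y) / (x - y)) -
      ∫ y in Ioc p q, 1 / (x - y) * deriv g y| ≤ 2 := by
  rcases le_or_gt q p with hqp | hpq
  · simp [Ioc_eq_empty (not_lt.2 hqp)]
  have hu : uIcc p q = Icc p q := uIcc_of_le hpq.le
  have hne : ∀ y ∈ Icc p q, x - y ≠ 0 := by
    intro y hy h
    rcases hx with h' | h' <;> linarith [hy.1, hy.2]
  have hgL : LipschitzWith 1 g := LipschitzWith.of_dist_le_mul (by
    intro x y; simpa [Real.dist_eq] using hg () x y)
  have a1 : AbsolutelyContinuousOnInterval (fun y => g x - g y) p q := by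
    apply LipschitzOnWith.absolutelyContinuousOnInterval (K := 1)
    apply LipschitzWith.lipschitzOnWith
    apply LipschitzWith.of_dist_le_mul
    intro y z
    have := hgL.dist_le_mul y z
    rwa [dist_sub_left]
  have cd : ContDiffOn ℝ 1 (fun y => (x - y)⁻¹) (uIcc p q) := by
    rw [hu]
    apply ContDiffOn.inv _ hne
    fun_prop
  have a2 : AbsolutelyContinuousOnInterval (fun y => (x - y)⁻¹) p q :=
    ContDiffOn.absolutelyContinuousOnInterval cd
  have key := a1.integral_deriv_mul_eq_sub a2
  have d1 : ∀ y, deriv (fun y => g x - g y) y = - deriv g y := fun y => deriv_const_sub _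
  have d2 : ∀ y ∈ Icc p q, deriv (fun y => (x - y)⁻¹) y = 1 / (x - y) / (x - y) := by
    intro y hy
    have : HasDerivAt (fun y => (x - y)⁻¹) (-(-1) / (x - y) ^ 2) y :=
      ((hasDerivAt_id y).const_sub x).inv (hne y hy)
    rw [this.deriv]
    field_simp [hne y hy]
  have i1 : IntegrableOn (fun y => (g x - g y) / (x - y) / (x - y)) (Ioc p q) := by
    have : ContinuousOn (fun y => (g x - g y) / (x - y) / (x - y)) (Icc p q) := by
      have := hgL.continuous
      apply ContinuousOn.div _ (by fun_prop) hne
      apply ContinuousOn.div (by fun_prop) (by fun_prop) hne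
    exact (this.integrableOn_Icc).mono_set Ioc_subset_Icc_self
  have i2 : IntegrableOn (fun y => 1 / (x - y) * deriv g y) (Ioc p q) := by
    have c : ContinuousOn (fun y => 1 / (x - y)) (Icc p q) := by
      apply ContinuousOn.div (by fun_prop) (by fun_prop) hne
    have c2 : IntegrableOn (fun y => 1 / (x - y)) (Ioc p q) :=
      (c.integrableOn_Icc).mono_set Ioc_subset_Icc_self
    refine Integrable.mul_bdd (c := 1) c2 (measurable_deriv g).aestronglyMeasurable (ae_of_all _ fun y => ?_)
    simpa using norm_deriv_le_of_lipschitz hgL (x₀ := y)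
  rw [← integral_sub i1 i2, ← intervalIntegral.integral_of_le hpq.le]
  have e : ∫ y in p..q, ((g x - g y) / (x - y) / (x - y) - 1 / (x - y) * deriv g y) =
      ∫ y in p..q, deriv (fun y => g x - g y) y * (x - y)⁻¹ + (g x - g y) * deriv (fun y => (x - y)⁻¹) y := by
    apply intervalIntegral.integral_congr
    intro y hy
    rw [hu] at hy
    simp only
    rw [d1, d2 y hy]; ring
  rw [e, key]
  have s : ∀ y, |(g x - g y) * (x - y)⁻¹| ≤ 1 := fun y => by
    have := hg.slope () x y
    rwa [div_eq_mul_inv] at this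
  calc _ ≤ _ := abs_sub _ _
    _ ≤ 1 + 1 := add_le_add (s q) (s p)
    _ = 2 := by norm_num

theorem single_test {g : ℝ → ℝ} (hg : Lip1 (fun _ : Unit => g)) {δ : ℝ} (hδ : 0 < δ) {u v : ℝ} (huv : u < v) :
    ∫ p, Dd δ p * WW g p.1 p.2.1 p.2.2 ∂((volume.restrict (Ioc u v)).prod
      ((volume.restrict (Ioc u v)).prod (volume.restrict (Ioc u v)))) ≤ 3180 * (v - u) := by
  have hb := WW_bound hg (volume.restrict (Ioc u v)) Measure.restrict_le_self hδ
  have hgL : LipschitzWith 1 g := LipschitzWith.of_dist_le_mul (by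
    intro x y; simpa [Real.dist_eq] using hg () x y)
  have hL : Lip1 (fun j : Empty => (j.elim : ℝ → ℝ)) := fun j => j.elim
  have hd : ∀ y, |deriv g y| ≤ 1 := fun y => by simpa using norm_deriv_le_of_lipschitz hgL (x₀ := y)
  have hH := hilb_test hδ huv (measurable_deriv g) hd
  have hv : (volume.restrict (Ioc u v) univ).toReal = v - u := by
    rw [Measure.restrict_apply_univ, Real.volume_Ioc, ENNReal.toReal_ofReal (by linarith)]
  rw [hv] at hb
  have k1 : ∀ x, ∫ y in Ioc u v, kd (fun _ : Unit => g) δ x y = ∫ y in Ioc u v, kd (fun _ : Unit => g) δ x y * (fun _ => (1:ℝ)) y := by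
    intro x; simp
  have I1 := Tsq_int hg hδ (μ := volume.restrict (Ioc u v)) (h := fun _ => 1) measurable_const (by simp)
  have I2 := Tsq_int hL hδ (μ := volume.restrict (Ioc u v)) (measurable_deriv g) hd
  have hF : ∫ x in Ioc u v, (∫ y in Ioc u v, kd (fun _ : Unit => g) δ x y) ^ 2 ≤
      ∫ x in Ioc u v, (2 * (∫ y in Ioc u v, kd (fun j : Empty => (j.elim : ℝ → ℝ)) δ x y * deriv g y) ^ 2 + 32) := by
    simp_rw [k1]
    apply setIntegral_mono_on I1 ((I2.const_mul 2).add (integrable_const _)) measurableSet_Ioc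
    intro x hx
    try simp only [Pi.add_apply]
    rw [kd_split hg hδ hx measurable_const (by simp), kd_split hL hδ hx (measurable_deriv g) hd]
    have b1 := byparts hg (p := u) (q := x - δ) (x := x) (Or.inr (by linarith))
    have b2 := byparts hg (p := x + δ) (q := v) (x := x) (Or.inl (by linarith))
    simp only [KS, Finset.univ_unique, Finset.prod_singleton, Finset.univ_eq_empty, Finset.prod_empty, mul_one]
    rw [abs_le] at b1 b2
    set a1 := ∫ y in Ioc u (x - δ), (g x - g y) / (x - y) / (x - y)
    set a2 := ∫ y in Ioc (x + δ) v, (g x - g y) / (x - y) / (x - y)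
    set c1 := ∫ y in Ioc u (x - δ), 1 / (x - y) * deriv g y
    set c2 := ∫ y in Ioc (x + δ) v, 1 / (x - y) * deriv g y
    have : |(a1 + a2) - (c1 + c2)| ≤ 4 := by rw [abs_le]; constructor <;> linarith
    have := sq_le_sq' (abs_le.1 this).1 (abs_le.1 this).2
    nlinarith [sq_nonneg ((a1 + a2) - 2 * (c1 + c2))]
  rw [integral_add (I2.const_mul 2) (integrable_const _), integral_const_mul] at hF
  simp only [integral_const, smul_eq_mul] at hF
  rw [Measure.real, hv] at hF
  linarith

noncomputable def Ct (ι : Type) [Fintype ι] : ℝ := 128 * (4 + Fintype.card ι ^ 2 * 3180)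

theorem test_main {A : ι → ℝ → ℝ} (hA : Lip1 A) {δ : ℝ} (hδ : 0 < δ) {u v : ℝ} (huv : u < v)
    {h : ℝ → ℝ} (hh : Measurable h) (h1 : ∀ x, |h x| ≤ 1) :
    ∫ x in Ioc u v, (∫ y in Ioc u v, kd A δ x y * h y) ^ 2 ≤ Ct ι * (v - u) := by
  apply test_h hA hδ huv _ hh h1
  intro j
  have hL : Lip1 (fun _ : Unit => A j) := fun _ => hA j
  exact single_test hL hδ huv

end CCA

end

section
namespace CCA
variable {ι : Type} [Fintype ι]

noncomputable def TS (A : ι → ℝ → ℝ) (δ : ℝ) (g : ℝ → ℝ) (x : ℝ) : ℝ := ∫ y, kd A δ x y * g y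

theorem slope_diff {g : ℝ → ℝ} (hg : ∀ x y, |g x - g y| ≤ |x - y|) {x y y' : ℝ} (h1 : x ≠ y) (h2 : x ≠ y') :
    |(g x - g y) / (x - y) - (g x - g y') / (x - y')| ≤ 2 * (|y - y'| / |x - y|) := by
  have n1 : x - y ≠ 0 := sub_ne_zero.2 h1
  have n2 : x - y' ≠ 0 := sub_ne_zero.2 h2
  have e : (g x - g y) / (x - y) - (g x - g y') / (x - y') =
      (g y' - g y) / (x - y) + (g x - g y') / (x - y') * ((y - y') / (x - y)) := by
    field_simp; ring
  rw [e]
  refine (abs_add_le _ _).trans ?_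
  have a1 : |(g y' - g y) / (x - y)| ≤ |y - y'| / |x - y| := by
    rw [abs_div, abs_sub_comm y y']
    exact div_le_div_of_nonneg_right (hg _ _) (abs_nonneg _)
  have a2 : |(g x - g y') / (x - y') * ((y - y') / (x - y))| ≤ |y - y'| / |x - y| := by
    rw [abs_mul, abs_div (y - y')]
    have : |(g x - g y') / (x - y')| ≤ 1 := by
      rw [abs_div]; exact div_le_one_of_le₀ (hg _ _) (abs_nonneg _)
    calc _ ≤ 1 * (|y - y'| / |x - y|) := by gcongr
      _ = _ := one_mul _
  linarith

theorem KS_diff {A : ι → ℝ → ℝ} (hA : Lip1 A) {x y y' : ℝ} (h1 : x ≠ y) (h2 : |x - y| ≤ 2 * |x - y'|) :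
    |KS A x y - KS A x y'| ≤ (2 + 2 * Fintype.card ι) * |y - y'| * (1 / |x - y| ^ 2) := by
  have n1 : x - y ≠ 0 := sub_ne_zero.2 h1
  have p1 : 0 < |x - y| := abs_pos.2 n1
  have p2 : 0 < |x - y'| := by linarith
  have n2 : x - y' ≠ 0 := abs_pos.1 p2
  have h2' : x ≠ y' := sub_ne_zero.1 n2
  unfold KS
  set P := ∏ j, (A j x - A j y) / (x - y)
  set P' := ∏ j, (A j x - A j y') / (x - y')
  have hP : |P - P'| ≤ Fintype.card ι * (2 * (|y - y'| / |x - y|)) := by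
    refine (prod_sub_le (fun j => hA.slope j x y) (fun j => hA.slope j x y')).trans ?_
    refine (Finset.sum_le_sum fun j _ => slope_diff (hA j) h1 h2').trans ?_
    simp
  have hP' : |P'| ≤ 1 := abs_prod_le_one fun j _ => hA.slope j x y'
  have e : P / (x - y) - P' / (x - y') = (P - P') / (x - y) + P' * ((y - y') / ((x - y) * (x - y'))) := by
    field_simp; ring
  rw [e]
  refine (abs_add_le _ _).trans ?_
  have a1 : |(P - P') / (x - y)| ≤ 2 * Fintype.card ι * |y - y'| * (1 / |x - y| ^ 2) := by
    rw [abs_div]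
    calc _ ≤ (Fintype.card ι * (2 * (|y - y'| / |x - y|))) / |x - y| := by gcongr
      _ = _ := by field_simp
  have a2 : |P' * ((y - y') / ((x - y) * (x - y')))| ≤ 2 * |y - y'| * (1 / |x - y| ^ 2) := by
    rw [abs_mul, abs_div, abs_mul]
    calc _ ≤ 1 * (|y - y'| / (|x - y| * |x - y'|)) := by gcongr
      _ ≤ |y - y'| / (|x - y| * (|x - y| / 2)) := by
        rw [one_mul]; gcongr; linarith
      _ = _ := by field_simp
  linarith

theorem TS_int {A : ι → ℝ → ℝ} (hA : Lip1 A) {δ : ℝ} (hδ : 0 < δ) {g : ℝ → ℝ} (hg : Integrable g) (x : ℝ) :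
    Integrable (fun y => kd A δ x y * g y) := kd_int hA hδ x hg

theorem qd_int {δ : ℝ} (hδ : 0 < δ) (x : ℝ) : Integrable (fun y => qd δ x y) ∧ ∫ y, qd δ x y ≤ 2 / δ := by
  have hm : Measurable fun y => qd δ x y := (measurable_qd δ).comp measurable_prodMk_left
  have hb : ∫⁻ y, ENNReal.ofReal (qd δ x y) ≤ ENNReal.ofReal (2 / δ) := by
    simp_rw [qd_symm δ x]; exact lint_qd hδ x
  constructor
  · refine ⟨hm.aestronglyMeasurable, ?_⟩
    rw [hasFiniteIntegral_iff_ofReal (ae_of_all _ fun y => qd_nonneg δ x y)]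
    exact hb.trans_lt ENNReal.ofReal_lt_top
  · rw [integral_eq_lintegral_of_nonneg_ae (ae_of_all _ fun y => qd_nonneg δ x y) hm.aestronglyMeasurable]
    exact ENNReal.toReal_le_of_le_ofReal (by positivity) hb

theorem cot_pt {A : ι → ℝ → ℝ} (hA : Lip1 A) {δ ε : ℝ} (hδ : 0 < δ) (hε : 2 * δ ≤ ε) {g : ℝ → ℝ}
    (hgi : Integrable g) (g1 : ∀ x, |g x| ≤ 1) {x x' : ℝ} (hx : |x - x'| ≤ ε / 2) :
    |TS A ε g x| ≤ (2 + 2 * Fintype.card ι) + |TS A δ g x'| +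
      |∫ y in Ioc (x - ε) (x + ε), kd A δ x' y * g y| := by
  have hε0 : 0 < ε := by linarith
  have i1 := TS_int hA hε0 hgi x
  have i2 := TS_int hA hδ hgi x'
  have i3 : Integrable (fun y => (Icc (x - ε) (x + ε)).indicator (fun y => kd A δ x' y * g y) y) :=
    i2.indicator measurableSet_Icc
  have e3 : ∫ y in Ioc (x - ε) (x + ε), kd A δ x' y * g y =
      ∫ y, (Icc (x - ε) (x + ε)).indicator (fun y => kd A δ x' y * g y) y := by
    rw [integral_indicator measurableSet_Icc, integral_Icc_eq_integral_Ioc]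
  have iq := qd_int hε0 x
  have main : |TS A ε g x - (TS A δ g x' - ∫ y in Ioc (x - ε) (x + ε), kd A δ x' y * g y)| ≤
      2 + 2 * Fintype.card ι := by
    rw [e3]
    unfold TS
    have i23 : Integrable (fun y => kd A δ x' y * g y -
      (Icc (x - ε) (x + ε)).indicator (fun y => kd A δ x' y * g y) y) := i2.sub i3
    rw [← integral_sub i2 i3, ← integral_sub i1 i23]
    calc _ ≤ ∫ y, (2 + 2 * Fintype.card ι) * (ε / 2) * qd ε x y := by
          rw [← Real.norm_eq_abs]
          apply norm_integral_le_of_norm_le (iq.1.const_mul _)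
          refine ae_of_all _ fun y => ?_
          by_cases hy : ε < |x - y|
          · have hn : y ∉ Icc (x - ε) (x + ε) := by
              intro h
              have : |x - y| ≤ ε := by rw [abs_le]; constructor <;> linarith [h.1, h.2]
              linarith
            have h3 : |x - y| ≤ |x - x'| + |x' - y| := abs_sub_le _ _ _
            have h4 : δ < |x' - y| := by linarith
            rw [indicator_of_notMem hn, sub_zero]
            simp only [kd, hy, h4, if_true, qd]
            rw [Real.norm_eq_abs, ← sub_mul, abs_mul]
            have hxy : y ≠ x := by
              rintro rfl; simp at hy; linarith
            have := KS_diff hA (x := y) (y := x) (y' := x') hxy (by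
              rw [abs_sub_comm y x, abs_sub_comm y x']; linarith)
            rw [KS_anti A x y, KS_anti A x' y, neg_sub_neg, abs_sub_comm]
            rw [abs_sub_comm y x] at this
            calc _ ≤ |KS A y x - KS A y x'| * 1 := by gcongr; exact g1 y
              _ ≤ _ := by
                rw [mul_one]
                refine this.trans ?_
                gcongr
          · have hn : y ∈ Icc (x - ε) (x + ε) := by
              rw [not_lt, abs_le] at hy
              constructor <;> linarith [hy.1, hy.2]
            rw [indicator_of_mem hn]
            simp [kd, qd, hy]
      _ = (2 + 2 * Fintype.card ι) * (ε / 2) * ∫ y, qd ε x y := integral_const_mul _ _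
      _ ≤ (2 + 2 * Fintype.card ι) * (ε / 2) * (2 / ε) := by gcongr; exact iq.2
      _ = _ := by field_simp
  set t := TS A ε g x
  set t1 := TS A δ g x'
  set t2 := ∫ y in Ioc (x - ε) (x + ε), kd A δ x' y * g y
  rw [abs_le] at main
  have b1 := neg_abs_le t1
  have b2 := le_abs_self t1
  have b3 := neg_abs_le t2
  have b4 := le_abs_self t2
  rw [abs_le]
  constructor <;> linarith

theorem Ct_pos : 0 < Ct ι := by unfold Ct; positivity

theorem L1_test {A : ι → ℝ → ℝ} (hA : Lip1 A) {δ : ℝ} (hδ : 0 < δ) {u v : ℝ} (huv : u < v)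
    {h : ℝ → ℝ} (hh : Measurable h) (h1 : ∀ x, |h x| ≤ 1) :
    IntegrableOn (fun x => |∫ y in Ioc u v, kd A δ x y * h y|) (Ioc u v) ∧
    ∫ x in Ioc u v, |∫ y in Ioc u v, kd A δ x y * h y| ≤ (1 + Ct ι) / 2 * (v - u) := by
  have I := Tsq_int hA hδ (μ := volume.restrict (Ioc u v)) hh h1
  have hb := fun x => T_bdd hA hδ (μ := volume.restrict (Ioc u v)) h1 x
  have I2 : IntegrableOn (fun x => |∫ y in Ioc u v, kd A δ x y * h y|) (Ioc u v) := by
    refine Integrable.of_bound (meas_T hA hh).abs.aestronglyMeasurable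
      (1 / δ * (volume.restrict (Ioc u v)).real univ) (ae_of_all _ fun x => ?_)
    · rw [Real.norm_eq_abs, abs_abs]; exact hb x
  refine ⟨I2, ?_⟩
  have I3 : Integrable (fun x => 1 / 2 + 1 / 2 * (∫ y in Ioc u v, kd A δ x y * h y) ^ 2)
    (volume.restrict (Ioc u v)) := (integrable_const _).add (I.const_mul _)
  have : ∫ x in Ioc u v, |∫ y in Ioc u v, kd A δ x y * h y| ≤
      ∫ x in Ioc u v, (1 / 2 + 1 / 2 * (∫ y in Ioc u v, kd A δ x y * h y) ^ 2) := by
    apply integral_mono I2 I3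
    intro x
    simp only
    nlinarith [sq_nonneg (|∫ y in Ioc u v, kd A δ x y * h y| - 1), sq_abs (∫ y in Ioc u v, kd A δ x y * h y)]
  rw [integral_add (integrable_const _) (I.const_mul _), integral_const_mul] at this
  simp only [integral_const, smul_eq_mul, Measure.real, Measure.restrict_apply_univ, Real.volume_Ioc] at this
  rw [ENNReal.toReal_ofReal (by linarith)] at this
  have := test_main hA hδ huv hh h1
  linarith

noncomputable def C7 (ι : Type) [Fintype ι] : ℝ := 15 * (1 + Ct ι) + 2 * (2 + 2 * Fintype.card ι)

theorem C7_pos : 0 < C7 ι := by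
  have := Ct_pos (ι := ι)
  unfold C7; positivity

theorem cotlar_delta {A : ι → ℝ → ℝ} (hA : Lip1 A) {p q : ℝ} (hpq : p < q) {g : ℝ → ℝ}
    (hg : Measurable g) (g1 : ∀ x, |g x| ≤ 1) (gs : ∀ y, y ∉ Ioc p q → g y = 0) {s : ℝ} (hs : C7 ι ≤ s)
    {δ : ℝ} (hδ : 0 < δ) :
    volume {x | x ∈ Ioc p q ∧ ∃ ε, 2 * δ ≤ ε ∧ s < |TS A ε g x|} ≤ ENNReal.ofReal (C7 ι / s * (q - p)) := by
  have hCt := Ct_pos (ι := ι)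
  have hs0 : 0 < s := C7_pos.trans_le hs
  have hgi : Integrable g := by
    have : IntegrableOn g (Ioc p q) := 
      Integrable.of_bound hg.aestronglyMeasurable 1 (ae_of_all _ g1)
    rwa [integrableOn_iff_integrable_of_support_subset] at this
    intro y hy
    by_contra h
    exact hy (gs y h)
  set L := q - p with hL
  have hL0 : 0 < L := by linarith
  have hTS : ∀ x, TS A δ g x = ∫ y in Ioc (p - L) (q + L), kd A δ x y * g y := by
    intro x
    unfold TS
    symm
    apply setIntegral_eq_integral_of_forall_compl_eq_zero
    intro y hy
    rw [gs y, mul_zero]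
    intro h
    exact hy ⟨by linarith [h.1], by linarith [h.2]⟩
  obtain ⟨L1, L2⟩ := L1_test hA hδ (show p - L < q + L by linarith) hg g1
  simp_rw [← hTS] at L1 L2
  set ν : Measure ℝ := (volume.restrict (Ioc (p - L) (q + L))).withDensity
    (fun x => ENNReal.ofReal (2 / s * |TS A δ g x|)) with hν
  have hνu : ν univ ≤ ENNReal.ofReal (2 / s * ((1 + Ct ι) / 2 * (3 * L))) := by
    rw [hν, withDensity_apply _ MeasurableSet.univ, Measure.restrict_univ,
      ← ofReal_integral_eq_lintegral_ofReal (L1.const_mul _) (ae_of_all _ fun x => by positivity), integral_const_mul]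
    apply ENNReal.ofReal_le_ofReal
    have : q + L - (p - L) = 3 * L := by rw [hL]; ring
    rw [this] at L2
    gcongr
  have hcov := vitali_cover (ν := ν) (E := {x | x ∈ Ioc p q ∧ ∃ ε, 2 * δ ≤ ε ∧ s < |TS A ε g x|}) (by
    rintro x ⟨hx, ε, hε, hsx⟩
    have hε0 : 0 < ε := by linarith
    have hεL : ε < L := by
      by_contra hc
      rw [not_lt] at hc
      have : TS A ε g x = 0 := by
        unfold TS
        rw [integral_eq_zero_of_ae]
        refine ae_of_all _ fun y => ?_
        simp only [Pi.zero_apply]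
        by_cases hy : y ∈ Ioc p q
        · have : ¬ ε < |x - y| := by
            rw [not_lt, abs_le]; constructor <;> linarith [hx.1, hx.2, hy.1, hy.2]
          simp [kd, this]
        · rw [gs y hy, mul_zero]
      rw [this, abs_zero] at hsx
      linarith
    refine ⟨x - ε / 2, x + ε / 2, by linarith, by linarith, ?_⟩
    have hsub : Ioc (x - ε / 2) (x + ε / 2) ⊆ Ioc (p - L) (q + L) := by
      intro y hy; exact ⟨by linarith [hy.1, hx.1], by linarith [hy.2, hx.2]⟩
    obtain ⟨M1, M2⟩ := L1_test hA hδ (show x - ε < x + ε by linarith) hg g1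
    have hsub2 : Ioc (x - ε / 2) (x + ε / 2) ⊆ Ioc (x - ε) (x + ε) := by
      intro y hy; exact ⟨by linarith [hy.1], by linarith [hy.2]⟩
    have L1' := L1.mono_set hsub
    have M1' := M1.mono_set hsub2
    have M2' : ∫ x' in Ioc (x - ε / 2) (x + ε / 2), |∫ y in Ioc (x - ε) (x + ε), kd A δ x' y * g y| ≤
        (1 + Ct ι) * ε := by
      refine (setIntegral_mono_set M1 (ae_of_all _ fun _ => abs_nonneg _) hsub2.eventuallyLE).trans ?_
      refine M2.trans (le_of_eq ?_)
      ring
    have key : ∫ x' in Ioc (x - ε / 2) (x + ε / 2), |TS A ε g x| ≤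
        ∫ x' in Ioc (x - ε / 2) (x + ε / 2), (((2 + 2 * Fintype.card ι) + |TS A δ g x'|) +
      |∫ y in Ioc (x - ε) (x + ε), kd A δ x' y * g y|) := by
      have J1 : IntegrableOn (fun x' => ((2 + 2 * Fintype.card ι) + |TS A δ g x'|)) (Ioc (x - ε / 2) (x + ε / 2)) :=
        (integrable_const _).add L1'
      apply setIntegral_mono_on (integrable_const _) (J1.add M1') measurableSet_Ioc
      intro x' hx'
      apply cot_pt hA hδ hε hgi g1
      rw [abs_le]; constructor <;> linarith [hx'.1, hx'.2]
    have J1 : IntegrableOn (fun x' => ((2 + 2 * Fintype.card ι) + |TS A δ g x'|)) (Ioc (x - ε / 2) (x + ε / 2)) :=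
        (integrable_const _).add L1'
    have e0 : x + ε / 2 - (x - ε / 2) = ε := by ring
    rw [integral_add J1 M1', integral_add (integrable_const _) L1'] at key
    simp only [integral_const, smul_eq_mul, Measure.real, Measure.restrict_apply_univ, Real.volume_Ioc, e0] at key
    rw [ENNReal.toReal_ofReal hε0.le] at key
    have hν2 : ν (Ioo (x - ε / 2) (x + ε / 2)) = ENNReal.ofReal (2 / s * ∫ x' in Ioc (x - ε / 2) (x + ε / 2), |TS A δ g x'|) := by
      rw [hν, withDensity_apply _ measurableSet_Ioo, Measure.restrict_restrict measurableSet_Ioo,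
        inter_eq_self_of_subset_left (Ioo_subset_Ioc_self.trans hsub), setLIntegral_congr Ioo_ae_eq_Ioc,
        ← ofReal_integral_eq_lintegral_ofReal (L1'.const_mul _) (ae_of_all _ fun x => by positivity), integral_const_mul]
    rw [hν2, e0]
    apply ENNReal.ofReal_le_ofReal
    have hs2 : 2 * ((2 + 2 * Fintype.card ι) + (1 + Ct ι)) ≤ s := by
      refine le_trans ?_ hs
      unfold C7; linarith
    rw [div_mul_eq_mul_div, le_div_iff₀ hs0]
    nlinarith)
  refine hcov.trans ?_
  calc 5 * ν univ ≤ 5 * ENNReal.ofReal (2 / s * ((1 + Ct ι) / 2 * (3 * L))) := by gcongr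
    _ = ENNReal.ofReal (5 * (2 / s * ((1 + Ct ι) / 2 * (3 * L)))) := by
      rw [ENNReal.ofReal_mul (p := 5) (by norm_num)]; norm_num
    _ ≤ _ := by
      apply ENNReal.ofReal_le_ofReal
      have : 5 * (2 / s * ((1 + Ct ι) / 2 * (3 * L))) = 15 * (1 + Ct ι) / s * L := by ring
      rw [this]
      gcongr
      unfold C7
      have : (0:ℝ) ≤ 2 * (2 + 2 * Fintype.card ι) := by positivity
      linarith

theorem cotlar {A : ι → ℝ → ℝ} (hA : Lip1 A) {p q : ℝ} (hpq : p < q) {g : ℝ → ℝ}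
    (hg : Measurable g) (g1 : ∀ x, |g x| ≤ 1) (gs : ∀ y, y ∉ Ioc p q → g y = 0) {s : ℝ} (hs : C7 ι ≤ s) :
    volume {x | x ∈ Ioc p q ∧ ∃ ε, 0 < ε ∧ s < |TS A ε g x|} ≤ ENNReal.ofReal (C7 ι / s * (q - p)) := by
  have : {x | x ∈ Ioc p q ∧ ∃ ε, 0 < ε ∧ s < |TS A ε g x|} =
      ⋃ n : ℕ, {x | x ∈ Ioc p q ∧ ∃ ε, 2 * (1 / ((n : ℝ) + 1)) ≤ ε ∧ s < |TS A ε g x|} := by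
    ext x
    simp only [mem_setOf_eq, mem_iUnion]
    constructor
    · rintro ⟨hx, ε, hε, h⟩
      obtain ⟨n, hn⟩ := exists_nat_one_div_lt (show 0 < ε / 2 by linarith)
      exact ⟨n, hx, ε, by linarith, h⟩
    · rintro ⟨n, hx, ε, hε, h⟩
      have : (0:ℝ) < 2 * (1 / ((n : ℝ) + 1)) := by positivity
      exact ⟨hx, ε, by linarith, h⟩
  rw [this, Monotone.measure_iUnion]
  · apply iSup_le
    intro n
    exact cotlar_delta hA hpq hg g1 gs hs (by positivity)
  · intro n k hnk x hx
    obtain ⟨hx, ε, hε, h⟩ := hx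
    refine ⟨hx, ε, le_trans ?_ hε, h⟩
    gcongr

end CCA

end

section
namespace CCA
variable {ι : Type} [Fintype ι]

theorem kd_diff {A : ι → ℝ → ℝ} (hA : Lip1 A) {ε x y y' : ℝ} (hε : 0 < ε) (h1 : x ≠ y) (h2 : |x - y| ≤ 2 * |x - y'|) :
    |kd A ε x y - kd A ε x y'| ≤ (2 + 2 * Fintype.card ι) * |y - y'| * (1 / |x - y| ^ 2) +
      (if |x - y| ≤ 2 * ε then 1 / ε else 0) := by
  have p0 : 0 ≤ (2 + 2 * Fintype.card ι) * |y - y'| * (1 / |x - y| ^ 2) := by positivity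
  have p1 : 0 ≤ (if |x - y| ≤ 2 * ε then 1 / ε else 0) := by split_ifs <;> positivity
  unfold kd
  by_cases c1 : ε < |x - y| <;> by_cases c2 : ε < |x - y'|
  · rw [if_pos c1, if_pos c2]
    linarith [KS_diff hA h1 h2]
  · rw [if_pos c1, if_neg c2, sub_zero, if_pos (by linarith)]
    have := KS_abs_le hA x y
    have : 1 / |x - y| ≤ 1 / ε := by gcongr
    linarith
  · rw [if_neg c1, if_pos c2, zero_sub, abs_neg, if_pos (by linarith)]
    have := KS_abs_le hA x y'
    have : 1 / |x - y'| ≤ 1 / ε := by gcongr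
    linarith
  · rw [if_neg c1, if_neg c2, sub_zero, abs_zero]
    linarith

noncomputable def Gf (P Q : ℕ → ℝ) (b : ℝ → ℝ) (x : ℝ) : ℝ≥0∞ :=
  ∑' n, ∫⁻ y in Ioo (P n) (Q n), ENNReal.ofReal ((Q n - P n) * qd ((Q n - P n) / 2) x y) * ENNReal.ofReal |b y|

theorem Gf_meas_aux (l : ℝ) {b : ℝ → ℝ} (hb : Measurable b) :
    Measurable fun p : ℝ × ℝ => ENNReal.ofReal (l * qd (l / 2) p.1 p.2) * ENNReal.ofReal |b p.2| := by
  have := measurable_qd (l / 2)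
  have h2 : Measurable fun p : ℝ × ℝ => b p.2 := hb.comp measurable_snd
  fun_prop

theorem Gf_meas (P Q : ℕ → ℝ) {b : ℝ → ℝ} (hb : Measurable b) : Measurable (Gf P Q b) := by
  unfold Gf
  apply Measurable.ennreal_tsum
  intro n
  exact (Gf_meas_aux _ hb).lintegral_prod_right'

theorem Gf_int {P Q : ℕ → ℝ} (hd : Pairwise (Function.onFun Disjoint fun n => Ioo (P n) (Q n)))
    {b : ℝ → ℝ} (hb : Measurable b) : ∫⁻ x, Gf P Q b x ≤ 4 * dm b univ := by
  unfold Gf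
  rw [lintegral_tsum (fun n => ((Gf_meas_aux _ hb).lintegral_prod_right').aemeasurable)]
  calc _ ≤ ∑' n, 4 * dm b (Ioo (P n) (Q n)) := by
        apply ENNReal.tsum_le_tsum
        intro n
        rw [lintegral_lintegral_swap (Gf_meas_aux _ hb).aemeasurable, dm_apply b measurableSet_Ioo,
          ← lintegral_const_mul' _ _ (by norm_num)]
        apply setLIntegral_mono' measurableSet_Ioo
        intro y hy
        have hl : 0 < Q n - P n := by linarith [hy.1, hy.2]
        dsimp only
        rw [lintegral_mul_const' _ _ ENNReal.ofReal_ne_top]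
        gcongr
        simp_rw [ENNReal.ofReal_mul hl.le]
        rw [lintegral_const_mul' _ _ ENNReal.ofReal_ne_top]
        calc _ ≤ ENNReal.ofReal (Q n - P n) * ENNReal.ofReal (2 / ((Q n - P n) / 2)) := by
              gcongr; exact lint_qd (by linarith) y
          _ = 4 := by
              rw [← ENNReal.ofReal_mul hl.le]
              have : (Q n - P n) * (2 / ((Q n - P n) / 2)) = 4 := by field_simp; norm_num
              rw [this]; norm_num
    _ = 4 * dm b (⋃ n, Ioo (P n) (Q n)) := by
        rw [ENNReal.tsum_mul_left, measure_iUnion hd (fun n => measurableSet_Ioo)]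
    _ ≤ _ := by gcongr; exact subset_univ _

theorem bad_pt {A : ι → ℝ → ℝ} (hA : Lip1 A) {ε x : ℝ} (hε : 0 < ε) {P Q : ℕ → ℝ}
    (hd : Pairwise (Function.onFun Disjoint fun n => Ioo (P n) (Q n))) {b : ℝ → ℝ} (hb : Measurable b)
    (hbi : Integrable b) (hb0 : ∀ᵐ y, y ∉ ⋃ n, Ioo (P n) (Q n) → b y = 0)
    (hbm : ∀ n, ∫ y in Ioo (P n) (Q n), b y = 0) {κ : ℝ} (hκ : 0 ≤ κ) (hx1 : x ∉ Mset (dm b) κ)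
    (hx2 : ∀ n, x ∉ Ioo (P n - (Q n - P n)) (Q n + (Q n - P n))) :
    ENNReal.ofReal |TS A ε b x| ≤ ENNReal.ofReal (2 + 2 * Fintype.card ι) * Gf P Q b x + ENNReal.ofReal (6 * κ) := by
  have hi := TS_int hA hε hbi x
  set χ : ℝ → ℝ≥0∞ := fun y => ENNReal.ofReal (if |x - y| ≤ 2 * ε then 1 / ε else 0) with hχ
  have hχm : Measurable χ := by
    apply Measurable.ennreal_ofReal
    apply Measurable.ite
    · exact measurableSet_le (by fun_prop) measurable_const
    · fun_prop
    · fun_prop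
  have hUm : MeasurableSet (⋃ n, Ioo (P n) (Q n)) := MeasurableSet.iUnion fun n => measurableSet_Ioo
  have e1 : TS A ε b x = ∑' n, ∫ y in Ioo (P n) (Q n), kd A ε x y * b y := by
    rw [(hasSum_integral_iUnion (fun n => measurableSet_Ioo) hd hi.integrableOn).tsum_eq]
    unfold TS
    symm
    apply setIntegral_eq_integral_of_ae_compl_eq_zero
    filter_upwards [hb0] with y hy hy'
    rw [hy hy', mul_zero]
  have e2 : ∀ n, ENNReal.ofReal |∫ y in Ioo (P n) (Q n), kd A ε x y * b y| ≤
      ENNReal.ofReal (2 + 2 * Fintype.card ι) * (∫⁻ y in Ioo (P n) (Q n),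
        ENNReal.ofReal ((Q n - P n) * qd ((Q n - P n) / 2) x y) * ENNReal.ofReal |b y|) +
      ∫⁻ y in Ioo (P n) (Q n), χ y * ENNReal.ofReal |b y| := by
    intro n
    rcases le_or_gt (Q n) (P n) with hn | hn
    · simp [Ioo_eq_empty (not_lt.2 hn)]
    set l := Q n - P n with hl
    have hl0 : 0 < l := by linarith
    set c := (P n + Q n) / 2 with hc
    have e3 : ∫ y in Ioo (P n) (Q n), kd A ε x y * b y =
        ∫ y in Ioo (P n) (Q n), (kd A ε x y - kd A ε x c) * b y := by
      simp_rw [sub_mul]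
      rw [integral_sub hi.integrableOn (hbi.integrableOn.const_mul _), integral_const_mul, hbm n, mul_zero, sub_zero]
    rw [e3, ← Real.norm_eq_abs, ofReal_norm_eq_enorm]
    refine (enorm_integral_le_lintegral_enorm _).trans ?_
    rw [← lintegral_const_mul' _ _ ENNReal.ofReal_ne_top, ← lintegral_add_right _ (by fun_prop)]
    apply setLIntegral_mono' measurableSet_Ioo
    intro y hy
    have hx3 := hx2 n
    rw [mem_Ioo, not_and_or, not_lt, not_lt] at hx3
    have hxy : l ≤ |x - y| := by
      rw [le_abs]
      rcases hx3 with h | h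
      · right; linarith [hy.1]
      · left; linarith [hy.2]
    have hyc : |y - c| ≤ l / 2 := by
      rw [abs_le]; constructor <;> linarith [hy.1, hy.2]
    have hne : x ≠ y := by
      rintro rfl; simp at hxy; linarith
    have htri : |x - y| ≤ |x - c| + |y - c| := by
      have := abs_sub_le x c y
      rwa [abs_sub_comm c y] at this
    have := kd_diff hA hε hne (y' := c) (by linarith)
    rw [← ofReal_norm_eq_enorm, Real.norm_eq_abs, abs_mul, ← mul_assoc, ← add_mul,
      ENNReal.ofReal_mul (abs_nonneg _)]
    gcongr
    rw [hχ]; simp only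
    rw [← ENNReal.ofReal_mul (by positivity), ← ENNReal.ofReal_add (mul_nonneg (by positivity)
      (mul_nonneg hl0.le (qd_nonneg _ _ _))) (by split_ifs <;> positivity)]
    apply ENNReal.ofReal_le_ofReal
    refine this.trans ?_
    have hq : qd (l / 2) x y = 1 / |x - y| ^ 2 := by
      unfold qd; rw [if_pos (by linarith)]
    rw [hq, ← mul_assoc]
    gcongr
    linarith
  rw [e1, ← Real.norm_eq_abs, ofReal_norm_eq_enorm]
  refine enorm_tsum_le_tsum_enorm.trans ?_
  have e2' : ∀ n, ‖∫ y in Ioo (P n) (Q n), kd A ε x y * b y‖ₑ ≤ ENNReal.ofReal (2 + 2 * Fintype.card ι) * (∫⁻ y in Ioo (P n) (Q n),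
        ENNReal.ofReal ((Q n - P n) * qd ((Q n - P n) / 2) x y) * ENNReal.ofReal |b y|) +
      ∫⁻ y in Ioo (P n) (Q n), χ y * ENNReal.ofReal |b y| := fun n => by
    rw [← ofReal_norm_eq_enorm, Real.norm_eq_abs]; exact e2 n
  refine (ENNReal.tsum_le_tsum e2').trans ?_
  rw [ENNReal.tsum_add, ENNReal.tsum_mul_left]
  unfold Gf
  gcongr
  rw [← lintegral_iUnion (fun n => measurableSet_Ioo) hd]
  refine (setLIntegral_le_lintegral _ _).trans ?_
  calc ∫⁻ y, χ y * ENNReal.ofReal |b y| ≤ ∫⁻ y in Ioo (x - 3 * ε) (x + 3 * ε), ENNReal.ofReal (1 / ε) * ENNReal.ofReal |b y| := by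
        rw [← lintegral_indicator measurableSet_Ioo]
        apply lintegral_mono
        intro y
        simp only [hχ, indicator]
        split_ifs with h1 h2 h2
        · exact le_rfl
        · exfalso
          apply h2
          rw [abs_le] at h1
          exact ⟨by linarith [h1.2], by linarith [h1.1]⟩
        · simp
        · simp
    _ = ENNReal.ofReal (1 / ε) * dm b (Ioo (x - 3 * ε) (x + 3 * ε)) := by
        rw [lintegral_const_mul' _ _ ENNReal.ofReal_ne_top, dm_apply _ measurableSet_Ioo]
    _ ≤ ENNReal.ofReal (1 / ε) * ENNReal.ofReal (κ * (x + 3 * ε - (x - 3 * ε))) := by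
        gcongr
        exact Mset_le_of_notMem hx1 (by linarith) (by linarith)
    _ = _ := by
        rw [← ENNReal.ofReal_mul (by positivity)]
        congr 1
        field_simp; ring

theorem cz {f : ℝ → ℝ} (hf : Measurable f) (hfi : Integrable f) {p q : ℝ} (hpq : p < q)
    (fs : ∀ y, y ∉ Ioc p q → f y = 0) {τ γ : ℝ} (hτ : 0 < τ) (hγ : 0 < γ)
    (hfγ : dm f univ ≤ ENNReal.ofReal (γ * (q - p))) (hγτ : 5 * γ / τ ≤ 1) :
    ∃ (P Q : ℕ → ℝ) (g b : ℝ → ℝ), Pairwise (Function.onFun Disjoint fun n => Ioo (P n) (Q n)) ∧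
      volume (⋃ n, Ioo (P n) (Q n)) ≤ ENNReal.ofReal (5 * γ / τ * (q - p)) ∧
      Measurable g ∧ (∀ x, |g x| ≤ τ) ∧ (∀ y, y ∉ Ioc (p - (q - p)) (q + (q - p)) → g y = 0) ∧
      Measurable b ∧ Integrable b ∧ (∀ y, f y = g y + b y) ∧
      (∀ᵐ y, y ∉ ⋃ n, Ioo (P n) (Q n) → b y = 0) ∧ (∀ n, ∫ y in Ioo (P n) (Q n), b y = 0) ∧
      dm b univ ≤ 2 * dm f univ := by
  set L := q - p with hL
  have hL0 : 0 < L := by linarith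
  have hvol : volume (Mset (dm f) τ) ≤ ENNReal.ofReal (5 * γ / τ * L) := by
    refine (vol_Mset_le (dm f) hτ).trans ?_
    calc _ ≤ ENNReal.ofReal (5 / τ) * ENNReal.ofReal (γ * L) := by gcongr
      _ = _ := by
        rw [← ENNReal.ofReal_mul (by positivity)]; congr 1; ring
  obtain ⟨P, Q, hd, hU, hend⟩ := components (isOpen_Mset (dm f) τ) (hvol.trans_lt ENNReal.ofReal_lt_top)
  have hlen : ∀ n, Q n - P n ≤ L := by
    intro n
    have h1 : volume (Ioo (P n) (Q n)) ≤ ENNReal.ofReal (5 * γ / τ * L) := by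
      refine le_trans (measure_mono ?_) hvol
      rw [hU]; exact subset_iUnion (fun n => Ioo (P n) (Q n)) n
    rw [Real.volume_Ioo] at h1
    have h2 := (ENNReal.ofReal_le_ofReal_iff (by positivity)).1 h1
    refine h2.trans ?_
    nlinarith
  have hIf : ∀ n, P n < Q n → ∫ y in Ioo (P n) (Q n), |f y| ≤ τ * (Q n - P n) := by
    intro n hn
    have h1 := Mset_le_of_notMem (hend n hn).1 le_rfl hn.le
    rw [dm_eq_ofReal measurableSet_Ioo hfi.integrableOn] at h1
    exact (ENNReal.ofReal_le_ofReal_iff (by nlinarith)).1 h1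
  set c : ℕ → ℝ := fun n => (Q n - P n)⁻¹ * ∫ y in Ioo (P n) (Q n), f y with hc
  have hcl : ∀ n, P n < Q n → |c n| * (Q n - P n) ≤ ∫ y in Ioo (P n) (Q n), |f y| := by
    intro n hn
    have hn' : 0 < Q n - P n := by linarith
    rw [hc]; simp only
    rw [abs_mul, abs_inv, abs_of_pos hn']
    have := abs_integral_le_integral_abs (f := f) (μ := volume.restrict (Ioo (P n) (Q n)))
    calc _ = |∫ y in Ioo (P n) (Q n), f y| := by field_simp
      _ ≤ _ := this
  have hcτ : ∀ n, P n < Q n → |c n| ≤ τ := by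
    intro n hn
    have hn' : 0 < Q n - P n := by linarith
    have := (hcl n hn).trans (hIf n hn)
    exact le_of_mul_le_mul_right this hn'
  obtain ⟨g, hg, hge⟩ := exists_measurable_piecewise
    (fun o : Option ℕ => o.elim (⋃ n, Ioo (P n) (Q n))ᶜ (fun n => Ioo (P n) (Q n)))
    (by
      rintro (_ | n)
      · exact (MeasurableSet.iUnion fun n => measurableSet_Ioo).compl
      · exact measurableSet_Ioo)
    (fun o : Option ℕ => o.elim (fun y => max (-τ) (min τ (f y))) (fun n _ => c n))
    (by
      rintro (_ | n)
      · exact measurable_const.max (measurable_const.min hf)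
      · exact measurable_const)
    (by
      rintro (_ | n) (_ | k) hnk
      · exact absurd rfl hnk
      · intro y hy
        exact absurd (mem_iUnion.2 ⟨k, hy.2⟩) hy.1
      · intro y hy
        exact absurd (mem_iUnion.2 ⟨n, hy.1⟩) hy.2
      · intro y hy
        have : n ≠ k := by rintro rfl; exact hnk rfl
        exact absurd hy.2 (disjoint_left.1 (hd this) hy.1))
  have g1 : ∀ y, y ∉ ⋃ n, Ioo (P n) (Q n) → g y = max (-τ) (min τ (f y)) := fun y hy => hge none hy
  have g2 : ∀ n, ∀ y ∈ Ioo (P n) (Q n), g y = c n := fun n y hy => hge (some n) hy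
  have gb : ∀ x, |g x| ≤ τ := by
    intro x
    by_cases hx : x ∈ ⋃ n, Ioo (P n) (Q n)
    · obtain ⟨n, hn⟩ := mem_iUnion.1 hx
      rw [g2 n x hn]
      exact hcτ n (hn.1.trans hn.2)
    · rw [g1 x hx, abs_le]
      exact ⟨le_max_left _ _, max_le (by linarith) (min_le_left _ _)⟩
  have gs : ∀ y, y ∉ Ioc (p - L) (q + L) → g y = 0 := by
    intro y hy
    by_cases hx : y ∈ ⋃ n, Ioo (P n) (Q n)
    · obtain ⟨n, hn⟩ := mem_iUnion.1 hx
      rw [g2 n y hn, hc]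
      simp only
      rw [setIntegral_eq_zero_of_forall_eq_zero, mul_zero]
      intro z hz
      apply fs
      intro hz'
      apply hy
      have := hlen n
      exact ⟨by linarith [hz.2, hn.1, hz'.1, hz.1, hn.2], by linarith [hz.2, hn.1, hz'.2, hz.1, hn.2]⟩
    · rw [g1 y hx, fs y]
      · rw [min_eq_right hτ.le, max_eq_right (by linarith)]
      · intro h; apply hy
        exact ⟨by linarith [h.1], by linarith [h.2]⟩
  have gi : Integrable g := by
    have : IntegrableOn g (Ioc (p - L) (q + L)) := 
      Integrable.of_bound hg.aestronglyMeasurable τ (ae_of_all _ gb)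
    rwa [integrableOn_iff_integrable_of_support_subset] at this
    intro y hy
    by_contra h
    exact hy (gs y h)
  have hb0 : ∀ᵐ y, y ∉ ⋃ n, Ioo (P n) (Q n) → f y - g y = 0 := by
    filter_upwards [ae_le_of_notMem_Mset hfi.locallyIntegrable hτ.le] with y hy hyn
    rw [hU] at hy
    have := abs_le.1 (hy hyn)
    rw [g1 y hyn, min_eq_right this.2, max_eq_right this.1, sub_self]
  refine ⟨P, Q, g, fun y => f y - g y, hd, hU ▸ hvol, hg, gb, gs, hf.sub hg, hfi.sub gi, fun y => by ring,
    hb0, ?_, ?_⟩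
  · intro n
    rw [integral_sub hfi.integrableOn gi.integrableOn, setIntegral_congr_fun measurableSet_Ioo (g2 n)]
    rcases le_or_gt (Q n) (P n) with hn | hn
    · simp [Ioo_eq_empty (not_lt.2 hn)]
    · simp only [integral_const, smul_eq_mul, Measure.real, Measure.restrict_apply_univ, Real.volume_Ioo]
      rw [ENNReal.toReal_ofReal (by linarith), hc]
      have : Q n - P n ≠ 0 := by linarith
      field_simp
      ring
  · have hUm : MeasurableSet (⋃ n, Ioo (P n) (Q n)) := MeasurableSet.iUnion fun n => measurableSet_Ioo
    have h1 : dm (fun y => f y - g y) univ = dm (fun y => f y - g y) (⋃ n, Ioo (P n) (Q n)) := by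
      rw [← measure_add_measure_compl hUm]
      have : dm (fun y => f y - g y) (⋃ n, Ioo (P n) (Q n))ᶜ = 0 := by
        rw [dm_apply _ hUm.compl, setLIntegral_congr_fun_ae hUm.compl (g := fun _ => 0)]
        · simp
        · filter_upwards [hb0] with y hy hy'
          rw [hy hy']; simp
      rw [this, add_zero]
    rw [h1, measure_iUnion hd (fun n => measurableSet_Ioo)]
    calc _ ≤ ∑' n, 2 * dm f (Ioo (P n) (Q n)) := by
          apply ENNReal.tsum_le_tsum
          intro n
          rcases le_or_gt (Q n) (P n) with hn | hn
          · simp [Ioo_eq_empty (not_lt.2 hn)]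
          have hI : IntegrableOn (fun y => |f y| + |c n|) (Ioo (P n) (Q n)) :=
            hfi.integrableOn.abs.add (integrableOn_const (by simp))
          have hfg : IntegrableOn (fun y => f y - g y) (Ioo (P n) (Q n)) := (hfi.sub gi).integrableOn
          rw [dm_eq_ofReal measurableSet_Ioo hfg, dm_eq_ofReal measurableSet_Ioo hfi.integrableOn]
          have : (2 : ℝ≥0∞) = ENNReal.ofReal 2 := by norm_num
          rw [this, ← ENNReal.ofReal_mul (by norm_num)]
          apply ENNReal.ofReal_le_ofReal
          calc _ ≤ ∫ y in Ioo (P n) (Q n), (|f y| + |c n|) := by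
                apply setIntegral_mono_on hfg.abs hI measurableSet_Ioo
                intro y hy
                rw [g2 n y hy]
                exact abs_sub _ _
            _ = (∫ y in Ioo (P n) (Q n), |f y|) + |c n| * (Q n - P n) := by
                rw [integral_add hfi.integrableOn.abs (integrableOn_const (by simp))]
                simp only [integral_const, smul_eq_mul, Measure.real, Measure.restrict_apply_univ, Real.volume_Ioo]
                rw [ENNReal.toReal_ofReal (by linarith), mul_comm]
            _ ≤ _ := by linarith [hcl n hn]
      _ = 2 * dm f (⋃ n, Ioo (P n) (Q n)) := by
          rw [ENNReal.tsum_mul_left, measure_iUnion hd (fun n => measurableSet_Ioo)]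
      _ ≤ _ := by gcongr; exact subset_univ _

end CCA

end

section
namespace CCA
variable {ι : Type} [Fintype ι]

theorem weak_core (ι : Type) [Fintype ι] {η : ℝ} (hη : 0 < η) (hη1 : η ≤ 1) : ∃ γ : ℝ, 0 < γ ∧
    ∀ A : ι → ℝ → ℝ, Lip1 A → ∀ p q : ℝ, p < q → ∀ f : ℝ → ℝ, Measurable f → Integrable f →
    (∀ y, y ∉ Ioc p q → f y = 0) → dm f univ ≤ ENNReal.ofReal (γ * (q - p)) →
    volume {x | x ∈ Ioc p q ∧ ∃ ε, 0 < ε ∧ 1 < |TS A ε f x|} ≤ ENNReal.ofReal (η * (q - p)) := by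
  have hC := C7_pos (ι := ι)
  set τ := η / (12 * C7 ι) with hτ
  have hτ0 : 0 < τ := by positivity
  set N : ℝ := (Fintype.card ι : ℝ) with hN
  have hN0 : 0 ≤ N := by positivity
  set D := 15 / τ + 240 + 64 * (1 + N) with hD
  have hD0 : 0 < D := by positivity
  set γ := (η / 2) / D with hγ
  have hγ0 : 0 < γ := by positivity
  have hγD : γ * D = η / 2 := by rw [hγ]; field_simp
  have hγτ : 5 * γ / τ ≤ 1 := by
    have h1 : γ * (15 / τ) ≤ γ * D := by gcongr; rw [hD]; linarith
    have h2 : γ * (15 / τ) = 3 * (5 * γ / τ) := by ring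
    linarith
  refine ⟨γ, hγ0, ?_⟩
  intro A hA p q hpq f hf hfi fs hfγ
  set L := q - p with hL
  have hL0 : 0 < L := by linarith
  obtain ⟨P, Q, g, b, hd, hvol, hg, gb, gs, hb, hbi, hfgb, hb0, hbm, hdb⟩ := cz hf hfi hpq fs hτ0 hγ0 hfγ hγτ
  have hdb' : dm b univ ≤ ENNReal.ofReal (2 * γ * L) := by
    refine hdb.trans ?_
    calc _ ≤ 2 * ENNReal.ofReal (γ * L) := by gcongr
      _ = _ := by
        rw [mul_assoc, ENNReal.ofReal_mul (p := 2) (by norm_num)]; norm_num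
  have gi : Integrable g := by
    have : IntegrableOn g (Ioc (p - L) (q + L)) := 
      Integrable.of_bound hg.aestronglyMeasurable τ (ae_of_all _ gb)
    rwa [integrableOn_iff_integrable_of_support_subset] at this
    intro y hy
    by_contra h
    exact hy (gs y h)
  set S1 := ⋃ n, Ioo (P n - (Q n - P n)) (Q n + (Q n - P n)) with hS1
  set S2 := Mset (dm b) (1 / 24) with hS2
  set S3 := {x | (1 / 4 : ℝ≥0∞) ≤ ENNReal.ofReal (2 + 2 * N) * Gf P Q b x} with hS3
  set S4 := {x | x ∈ Ioc (p - L) (q + L) ∧ ∃ ε, 0 < ε ∧ 1 / (2 * τ) < |TS A ε (fun y => g y / τ) x|} with hS4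
  have v1 : volume S1 ≤ ENNReal.ofReal (15 * γ / τ * L) := by
    calc volume S1 ≤ ∑' n, volume (Ioo (P n - (Q n - P n)) (Q n + (Q n - P n))) := measure_iUnion_le _
      _ = ∑' n, 3 * volume (Ioo (P n) (Q n)) := by
        congr 1; ext n
        rw [Real.volume_Ioo, Real.volume_Ioo, ← ENNReal.ofReal_ofNat 3, ← ENNReal.ofReal_mul (by norm_num)]
        congr 1; norm_num; ring
      _ = 3 * volume (⋃ n, Ioo (P n) (Q n)) := by
        rw [ENNReal.tsum_mul_left, measure_iUnion hd (fun n => measurableSet_Ioo)]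
      _ ≤ ENNReal.ofReal 3 * ENNReal.ofReal (5 * γ / τ * L) := by
        rw [ENNReal.ofReal_ofNat 3]; gcongr
      _ = _ := by
        rw [← ENNReal.ofReal_mul (by norm_num)]; congr 1; ring
  have v2 : volume S2 ≤ ENNReal.ofReal (240 * γ * L) := by
    refine (vol_Mset_le (dm b) (by norm_num)).trans ?_
    calc _ ≤ ENNReal.ofReal (5 / (1 / 24)) * ENNReal.ofReal (2 * γ * L) := by gcongr
      _ = _ := by
        rw [← ENNReal.ofReal_mul (by norm_num)]; congr 1; ring
  have v3 : volume S3 ≤ ENNReal.ofReal (64 * (1 + N) * γ * L) := by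
    have hm : Measurable fun x => ENNReal.ofReal (2 + 2 * N) * Gf P Q b x := (Gf_meas P Q hb).const_mul _
    have h1 := mul_meas_ge_le_lintegral (μ := volume) hm (1 / 4)
    have h2 : ∫⁻ x, ENNReal.ofReal (2 + 2 * N) * Gf P Q b x ≤
        ENNReal.ofReal (2 + 2 * N) * (ENNReal.ofReal 4 * ENNReal.ofReal (2 * γ * L)) := by
      rw [lintegral_const_mul' _ _ ENNReal.ofReal_ne_top, ENNReal.ofReal_ofNat 4]
      gcongr
      refine (Gf_int hd hb).trans ?_
      gcongr
    calc volume S3 = ENNReal.ofReal 4 * (1 / 4 * volume S3) := by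
          rw [← mul_assoc, ENNReal.ofReal_ofNat 4, one_div, ENNReal.mul_inv_cancel (by norm_num) (by norm_num), one_mul]
      _ ≤ ENNReal.ofReal 4 * (ENNReal.ofReal (2 + 2 * N) * (ENNReal.ofReal 4 * ENNReal.ofReal (2 * γ * L))) := by
          exact mul_le_mul_right (h1.trans h2) _
      _ = _ := by
          rw [← ENNReal.ofReal_mul (by norm_num), ← ENNReal.ofReal_mul (by positivity), ← ENNReal.ofReal_mul (by norm_num)]
          congr 1; ring
  have v4 : volume S4 ≤ ENNReal.ofReal (η / 2 * L) := by
    have hs : C7 ι ≤ 1 / (2 * τ) := by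
      rw [hτ]; field_simp; nlinarith
    have := cotlar hA (p := p - L) (q := q + L) (g := fun y => g y / τ) (by linarith) (hg.div_const _)
      (fun y => by rw [abs_div, abs_of_pos hτ0, div_le_one hτ0]; exact gb y)
      (fun y hy => by rw [gs y hy, zero_div]) hs
    refine this.trans (ENNReal.ofReal_le_ofReal (le_of_eq ?_))
    rw [hτ, hL]; field_simp; ring
  have hsub : {x | x ∈ Ioc p q ∧ ∃ ε, 0 < ε ∧ 1 < |TS A ε f x|} ⊆ (S1 ∪ S2) ∪ (S3 ∪ S4) := by
    rintro x ⟨hx, ε, hε, hx1⟩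
    by_contra hcon
    simp only [mem_union, not_or] at hcon
    obtain ⟨⟨n1, n2⟩, n3, n4⟩ := hcon
    have hTb := bad_pt hA hε hd hb hbi hb0 hbm (by norm_num : (0 : ℝ) ≤ 1 / 24) n2
      (fun n hn => n1 (mem_iUnion.2 ⟨n, hn⟩))
    have n3' : ENNReal.ofReal (2 + 2 * N) * Gf P Q b x < 1 / 4 := by simpa [hS3] using n3
    have hTb2 : |TS A ε b x| < 1 / 2 := by
      have : ENNReal.ofReal |TS A ε b x| < ENNReal.ofReal (1 / 2) := by
        refine hTb.trans_lt ?_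
        calc _ < 1 / 4 + ENNReal.ofReal (6 * (1 / 24)) := ENNReal.add_lt_add_right ENNReal.ofReal_ne_top n3'
          _ = _ := by
            have : (1 / 4 : ℝ≥0∞) = ENNReal.ofReal (1 / 4) := by
              rw [ENNReal.ofReal_div_of_pos (by norm_num)]; norm_num
            rw [this, ← ENNReal.ofReal_add (by norm_num) (by norm_num)]; norm_num
      exact (ENNReal.ofReal_lt_ofReal_iff (by norm_num)).1 this
    have hTf : TS A ε f x = TS A ε g x + TS A ε b x := by
      unfold TS
      rw [← integral_add (TS_int hA hε gi x) (TS_int hA hε hbi x)]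
      congr 1; ext y; rw [hfgb y]; ring
    have hTg : |TS A ε g x| ≤ 1 / 2 := by
      by_contra hc
      push Not at hc
      apply n4
      refine ⟨⟨by linarith [hx.1], by linarith [hx.2]⟩, ε, hε, ?_⟩
      have : TS A ε (fun y => g y / τ) x = TS A ε g x / τ := by
        unfold TS
        rw [← integral_div]
        congr 1; ext y; ring
      rw [this, abs_div, abs_of_pos hτ0, lt_div_iff₀ hτ0]
      calc _ = 1 / 2 := by field_simp
        _ < _ := hc
    have := abs_add_le (TS A ε g x) (TS A ε b x)
    rw [← hTf] at this
    linarith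
  refine (measure_mono hsub).trans ((measure_union_le _ _).trans ?_)
  refine (add_le_add (measure_union_le _ _) (measure_union_le _ _)).trans ?_
  refine (add_le_add (add_le_add v1 v2) (add_le_add v3 v4)).trans ?_
  rw [← ENNReal.ofReal_add (by positivity) (by positivity), ← ENNReal.ofReal_add (by positivity) (by positivity),
    ← ENNReal.ofReal_add (by positivity) (by positivity)]
  apply ENNReal.ofReal_le_ofReal
  have : γ * D * L = η / 2 * L := by rw [hγD]
  rw [hD] at this
  apply le_of_eq
  linear_combination this

theorem weak_local (ι : Type) [Fintype ι] {η : ℝ} (hη : 0 < η) (hη1 : η ≤ 1) : ∃ γ : ℝ, 0 < γ ∧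
    ∀ A : ι → ℝ → ℝ, Lip1 A → ∀ p q : ℝ, p < q → ∀ f : ℝ → ℝ, Measurable f → Integrable f →
    (∀ y, y ∉ Ioc p q → f y = 0) → ∀ s : ℝ, 0 < s → dm f univ ≤ ENNReal.ofReal (γ * s * (q - p)) →
    volume {x | x ∈ Ioc p q ∧ ∃ ε, 0 < ε ∧ s < |TS A ε f x|} ≤ ENNReal.ofReal (η * (q - p)) := by
  obtain ⟨γ, hγ, H⟩ := weak_core ι hη hη1
  refine ⟨γ, hγ, ?_⟩
  intro A hA p q hpq f hf hfi fs s hs hfγ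
  have := H A hA p q hpq (fun y => f y / s) (hf.div_const s) (hfi.div_const s)
    (fun y hy => by rw [fs y hy, zero_div]) (by
      rw [dm_apply _ MeasurableSet.univ] at hfγ ⊢
      simp only [abs_div, abs_of_pos hs]
      simp_rw [div_eq_inv_mul, ENNReal.ofReal_mul (inv_nonneg.2 hs.le)]
      rw [lintegral_const_mul' _ _ ENNReal.ofReal_ne_top]
      calc _ ≤ ENNReal.ofReal s⁻¹ * ENNReal.ofReal (γ * s * (q - p)) := by gcongr
        _ = _ := by
          rw [← ENNReal.ofReal_mul (by positivity)]; congr 1; field_simp)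
  refine le_trans (measure_mono ?_) this
  rintro x ⟨hx, ε, hε, h⟩
  refine ⟨hx, ε, hε, ?_⟩
  have e : TS A ε (fun y => f y / s) x = TS A ε f x / s := by
    unfold TS
    rw [← integral_div]
    congr 1; ext y; ring
  rw [e, abs_div, abs_of_pos hs, lt_div_iff₀ hs, one_mul]
  exact h

end CCA

end

section
namespace CCA
variable {ι : Type} [Fintype ι]

noncomputable def AD (g : ℝ → ℝ) (x y : ℝ) : ℝ := ∫ t in y..x, g t

noncomputable def KK (a : ι → ℝ → ℝ) (b : ℝ → ℝ) (x y : ℝ) : ℝ :=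
  (AD b x y / (x - y) - b y) * (∏ j, (AD (a j) x y / (x - y))) / (x - y)

noncomputable def kk (a : ι → ℝ → ℝ) (b : ℝ → ℝ) (ε x y : ℝ) : ℝ := if ε < |x - y| then KK a b x y else 0

noncomputable def TK (a : ι → ℝ → ℝ) (b : ℝ → ℝ) (ε : ℝ) (f : ℝ → ℝ) (x : ℝ) : ℝ := ∫ y, kk a b ε x y * f y

theorem li_ii {g : ℝ → ℝ} (hg : LocallyIntegrable g volume) (x y : ℝ) : IntervalIntegrable g volume x y := by
  rw [intervalIntegrable_iff']
  exact hg.integrableOn_isCompact isCompact_uIcc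

theorem li_Ioo {g : ℝ → ℝ} (hg : LocallyIntegrable g volume) (x y : ℝ) : IntegrableOn g (Ioo x y) :=
  (hg.integrableOn_isCompact isCompact_Icc).mono_set Ioo_subset_Icc_self

theorem li_Ioc {g : ℝ → ℝ} (hg : LocallyIntegrable g volume) (x y : ℝ) : IntegrableOn g (Ioc x y) :=
  (hg.integrableOn_isCompact isCompact_Icc).mono_set Ioc_subset_Icc_self

theorem AD_add {g : ℝ → ℝ} (hg : LocallyIntegrable g volume) (x y z : ℝ) : AD g x y = AD g x z + AD g z y := by
  unfold AD
  rw [add_comm]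
  exact (intervalIntegral.integral_add_adjacent_intervals (li_ii hg _ _) (li_ii hg _ _)).symm

theorem AD_self (g : ℝ → ℝ) (x : ℝ) : AD g x x = 0 := by simp [AD]

theorem AD_symm (g : ℝ → ℝ) (x y : ℝ) : AD g x y = - AD g y x := by
  unfold AD; exact intervalIntegral.integral_symm _ _

/-- size bound on an interval containing both points -/
theorem AD_le_Ioo {g : ℝ → ℝ} (hg : LocallyIntegrable g volume) {x y u v : ℝ} (hx : x ∈ Icc u v) (hy : y ∈ Icc u v) :
    |AD g x y| ≤ ∫ t in Ioo u v, |g t| := by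
  have h1 : |AD g x y| ≤ ∫ t in Set.uIoc y x, |g t| := intervalIntegral.norm_integral_le_integral_norm_uIoc (f := g) (a := y) (b := x) (μ := volume)
  refine h1.trans ?_
  rw [← integral_Ioc_eq_integral_Ioo]
  apply setIntegral_mono_set (li_Ioc hg u v).abs (ae_of_all _ fun _ => abs_nonneg _)
  apply HasSubset.Subset.eventuallyLE
  intro t ht
  rw [mem_uIoc] at ht
  rcases ht with h | h
  · exact ⟨hy.1.trans_lt h.1, h.2.trans hx.2⟩
  · exact ⟨hx.1.trans_lt h.1, h.2.trans hy.2⟩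

theorem AD_lip {g : ℝ → ℝ} (hg : LocallyIntegrable g volume) {Λ : ℝ} (hΛ : 0 ≤ Λ) {x : ℝ} (hx : x ∉ Mset (dm g) Λ)
    (y : ℝ) : |AD g x y| ≤ Λ * |x - y| := by
  have h1 := AD_le_Ioo hg (x := x) (y := y) (u := min x y) (v := max x y) ⟨min_le_left _ _, le_max_left _ _⟩
    ⟨min_le_right _ _, le_max_right _ _⟩
  refine h1.trans ?_
  have h2 := Mset_le_of_notMem hx (min_le_left x y) (le_max_left x y)
  rw [dm_eq_ofReal measurableSet_Ioo (li_Ioo hg _ _), max_sub_min_eq_abs' ] at h2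
  exact (ENNReal.ofReal_le_ofReal_iff (by positivity)).1 h2

theorem lip_ext {E : Set ℝ} {G : ℝ → ℝ} {Λ : ℝ} (hΛ : 0 < Λ) (hG : ∀ x ∈ E, ∀ y, |G x - G y| ≤ Λ * |x - y|) :
    ∃ H : ℝ → ℝ, (∀ x y, |H x - H y| ≤ |x - y|) ∧
      ∀ x ∈ E, ∀ y, |(G x - G y) / Λ - (H x - H y)| ≤ 2 * Metric.infDist y E := by
  have hl : LipschitzOnWith 1 (fun x => G x / Λ) E := by
    apply LipschitzOnWith.of_dist_le_mul
    intro x hx y hy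
    simp only [Real.dist_eq, NNReal.coe_one, one_mul]
    rw [← sub_div, abs_div, abs_of_pos hΛ, div_le_iff₀ hΛ, mul_comm]
    exact hG x hx y
  obtain ⟨H, hH, he⟩ := hl.extend_real
  have hH1 : ∀ x y, |H x - H y| ≤ |x - y| := by
    intro x y
    have := hH.dist_le_mul x y
    simpa [Real.dist_eq] using this
  refine ⟨H, hH1, ?_⟩
  intro x hx y
  have h0 : |(G x - G y) / Λ - (H x - H y)| / 2 ≤ Metric.infDist y E := by
    rw [Metric.le_infDist ⟨x, hx⟩]
    intro e hes
    rw [Real.dist_eq]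
    have e1 : G x / Λ = H x := he hx
    have e2 : G e / Λ = H e := he hes
    have e3 : (G x - G y) / Λ - (H x - H y) = (G e - G y) / Λ + (H y - H e) := by
      rw [sub_div, sub_div, e1, e2]; ring
    have e4 : |(G e - G y) / Λ| ≤ |y - e| := by
      rw [abs_div, abs_of_pos hΛ, div_le_iff₀ hΛ, mul_comm, abs_sub_comm y e]
      exact hG e hes y
    rw [e3]
    have := abs_add_le ((G e - G y) / Λ) (H y - H e)
    linarith [hH1 y e]
  linarith

theorem err_alg {Λ : ℝ} (hΛ : 1 ≤ Λ) {u0 v0 δ t β : ℝ} {u v : ι → ℝ} (hu0 : |u0| ≤ 1) (hv0 : |v0| ≤ 1)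
    (hu : ∀ j, |u j| ≤ 1) (hv : ∀ j, |v j| ≤ 1) (h0 : |u0 - v0| ≤ δ) (h : ∀ j, |u j - v j| ≤ δ) (hδ : 0 ≤ δ) :
    |(Λ * u0 - β) * (∏ j, (Λ * u j)) / t - (Λ ^ (Fintype.card ι + 1) * ((v0 * ∏ j, v j) / t) -
      Λ ^ (Fintype.card ι) * (((∏ j, v j) / t) * β))| ≤
      (1 + Fintype.card ι) * Λ ^ (Fintype.card ι + 1) * (1 + |β|) * (δ / |t|) := by
  set n := Fintype.card ι with hn
  have hp : ∏ j, (Λ * u j) = Λ ^ n * ∏ j, u j := by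
    rw [Finset.prod_mul_distrib]; simp [hn]
  have hd := prod_sub_le hu hv
  have hd2 : |∏ j, u j - ∏ j, v j| ≤ n * δ := by
    refine hd.trans ((Finset.sum_le_sum (fun j _ => h j)).trans (le_of_eq ?_))
    simp [hn]
  have hpu : |∏ j, u j| ≤ 1 := abs_prod_le_one (fun j _ => hu j)
  have e : (Λ * u0 - β) * (∏ j, (Λ * u j)) / t - (Λ ^ (n + 1) * ((v0 * ∏ j, v j) / t) -
      Λ ^ n * (((∏ j, v j) / t) * β)) = (Λ ^ (n + 1) * ((u0 - v0) * ∏ j, u j + v0 * (∏ j, u j - ∏ j, v j)) -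
        Λ ^ n * (β * (∏ j, u j - ∏ j, v j))) / t := by
    rw [hp]; ring
  rw [e, abs_div]
  have b1 : |(u0 - v0) * ∏ j, u j + v0 * (∏ j, u j - ∏ j, v j)| ≤ (1 + n) * δ := by
    refine (abs_add_le _ _).trans ?_
    rw [abs_mul, abs_mul]
    have : |u0 - v0| * |∏ j, u j| ≤ δ * 1 := by gcongr
    have : |v0| * |∏ j, u j - ∏ j, v j| ≤ 1 * (n * δ) := by gcongr
    linarith
  have b2 : |β * (∏ j, u j - ∏ j, v j)| ≤ |β| * ((1 + n) * δ) := by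
    rw [abs_mul]; gcongr; linarith
  have hΛn : Λ ^ n ≤ Λ ^ (n + 1) := pow_le_pow_right₀ hΛ (by omega)
  have b3 : |Λ ^ (n + 1) * ((u0 - v0) * ∏ j, u j + v0 * (∏ j, u j - ∏ j, v j)) -
        Λ ^ n * (β * (∏ j, u j - ∏ j, v j))| ≤ (1 + n) * Λ ^ (n + 1) * (1 + |β|) * δ := by
    refine (abs_sub _ _).trans ?_
    rw [abs_mul, abs_mul, abs_of_nonneg (by positivity : (0:ℝ) ≤ Λ ^ (n + 1)), abs_of_nonneg (by positivity : (0:ℝ) ≤ Λ ^ n)]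
    have c1 : Λ ^ (n + 1) * |(u0 - v0) * ∏ j, u j + v0 * (∏ j, u j - ∏ j, v j)| ≤ Λ ^ (n + 1) * ((1 + n) * δ) := by gcongr
    have c2 : Λ ^ n * |β * (∏ j, u j - ∏ j, v j)| ≤ Λ ^ (n + 1) * (|β| * ((1 + n) * δ)) := by gcongr
    nlinarith
  rw [← mul_div_assoc]
  exact div_le_div_of_nonneg_right b3 (abs_nonneg _)

end CCA

end

section
namespace CCA
variable {ι : Type} [Fintype ι]

noncomputable def Hf (E : Set ℝ) (w : ℝ → ℝ) (x : ℝ) : ℝ≥0∞ :=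
  ∫⁻ y, ENNReal.ofReal (Metric.infDist y E * qd (Metric.infDist y E / 2) x y) * ENNReal.ofReal (w y)

theorem Hf_meas_aux (E : Set ℝ) {w : ℝ → ℝ} (hw : Measurable w) : Measurable fun p : ℝ × ℝ =>
    ENNReal.ofReal (Metric.infDist p.2 E * qd (Metric.infDist p.2 E / 2) p.1 p.2) * ENNReal.ofReal (w p.2) := by
  have h1 : Measurable fun p : ℝ × ℝ => Metric.infDist p.2 E :=
    (Metric.continuous_infDist_pt E).measurable.comp measurable_snd
  have h2 : Measurable fun p : ℝ × ℝ => w p.2 := hw.comp measurable_snd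
  have h3 : Measurable fun p : ℝ × ℝ => qd (Metric.infDist p.2 E / 2) p.1 p.2 := by
    unfold qd
    apply Measurable.ite
    · exact measurableSet_lt (by fun_prop) (by fun_prop)
    · fun_prop
    · fun_prop
  fun_prop

theorem Hf_meas (E : Set ℝ) {w : ℝ → ℝ} (hw : Measurable w) : Measurable (Hf E w) :=
  (Hf_meas_aux E hw).lintegral_prod_right'

theorem Hf_int (E : Set ℝ) {w : ℝ → ℝ} (hw : Measurable w) : ∫⁻ x, Hf E w x ≤ 4 * ∫⁻ y, ENNReal.ofReal (w y) := by
  unfold Hf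
  rw [lintegral_lintegral_swap (Hf_meas_aux E hw).aemeasurable, ← lintegral_const_mul' _ _ (by norm_num)]
  apply lintegral_mono
  intro y
  dsimp only
  rw [lintegral_mul_const' _ _ ENNReal.ofReal_ne_top]
  gcongr
  set d := Metric.infDist y E
  have hd : 0 ≤ d := Metric.infDist_nonneg
  rcases hd.eq_or_lt with h | h
  · rw [← h]; simp
  simp_rw [ENNReal.ofReal_mul hd]
  rw [lintegral_const_mul' _ _ ENNReal.ofReal_ne_top]
  calc _ ≤ ENNReal.ofReal d * ENNReal.ofReal (2 / (d / 2)) := by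
        gcongr; exact lint_qd (by linarith) y
    _ = 4 := by
        rw [← ENNReal.ofReal_mul hd]
        have : d * (2 / (d / 2)) = 4 := by field_simp; norm_num
        rw [this]; norm_num

theorem near (ι : Type) [Fintype ι] {η : ℝ} (hη : 0 < η) (hη1 : η ≤ 1) : ∃ Γ : ℝ, 0 < Γ ∧
    ∀ b : ℝ → ℝ, IsB b → ∀ a : ι → ℝ → ℝ, (∀ j, LocallyIntegrable (a j) volume) →
    ∀ p q : ℝ, p < q → ∀ f : ℝ → ℝ, Measurable f → (∀ y, y ∉ Ioo p q → f y = 0) →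
    (∀ j, dm (a j) (Ioo p q) ≤ ENNReal.ofReal (q - p)) →
    (∫⁻ y, ENNReal.ofReal (|f y| * (1 + |b y - avg b p q|)) ≤ ENNReal.ofReal (q - p)) →
    volume {x | x ∈ Ioo p q ∧ ∃ ε, 0 < ε ∧ Γ < |TK a b ε f x|} ≤ ENNReal.ofReal (η * (q - p)) := by
  obtain ⟨γ1, hγ1, H1⟩ := weak_local (Option ι) (η := η / 4) (by positivity) (by linarith)
  obtain ⟨γ2, hγ2, H2⟩ := weak_local ι (η := η / 4) (by positivity) (by linarith)
  set n := Fintype.card ι with hn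
  set Λ : ℝ := 20 * (n + 1) / η with hΛ
  have hΛ1 : 1 ≤ Λ := by
    rw [hΛ, le_div_iff₀ hη]
    have : (0 : ℝ) ≤ n := by positivity
    linarith
  have hΛ0 : 0 < Λ := by linarith
  set ce : ℝ := 2 * ((1 + n) * Λ ^ (n + 1)) with hce
  have hce0 : 0 < ce := by positivity
  set Γ := 4 * (Λ ^ (n + 1) / γ1) + 4 * (Λ ^ n / γ2) + 64 * ce / η with hΓ
  have q1 : 0 < Λ ^ (n + 1) / γ1 := by positivity
  have q2 : 0 < Λ ^ n / γ2 := by positivity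
  have q3 : 0 < 64 * ce / η := by positivity
  have hΓ0 : 0 < Γ := by positivity
  refine ⟨Γ, hΓ0, ?_⟩
  intro b hb a ha p q hpq f hf fs hda hdf
  set L := q - p with hL
  have hL0 : 0 < L := by linarith
  set g : Option ι → ℝ → ℝ := fun o => (Ioo p q).indicator (o.elim (fun y => b y - avg b p q) a) with hg
  have hgi : ∀ o, Integrable (g o) := by
    rintro (_ | j)
    · exact (li_Ioo (hb.locsub _) p q).integrable_indicator measurableSet_Ioo
    · exact (li_Ioo (ha j) p q).integrable_indicator measurableSet_Ioo
  have hgl : ∀ o, LocallyIntegrable (g o) volume := fun o => (hgi o).locallyIntegrable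
  have hdind : ∀ h : ℝ → ℝ, dm ((Ioo p q).indicator h) univ = dm h (Ioo p q) := by
    intro h
    rw [dm_apply _ MeasurableSet.univ, dm_apply _ measurableSet_Ioo, ← lintegral_indicator measurableSet_Ioo,
      Measure.restrict_univ]
    congr 1; ext y
    by_cases hy : y ∈ Ioo p q <;> simp [hy]
  have hgd : ∀ o, dm (g o) univ ≤ ENNReal.ofReal L := by
    rintro (_ | j)
    · simp only [hg]
      rw [hdind]
      simp only [Option.elim]
      rw [dm_eq_ofReal measurableSet_Ioo (li_Ioo (hb.locsub _) p q), ← integral_Ioc_eq_integral_Ioo]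
      exact ENNReal.ofReal_le_ofReal (hb.osc p q hpq)
    · simp only [hg]
      rw [hdind]
      exact hda j
  set b0 := g none with hb0
  have hb0m : Measurable b0 := (hb.meas.sub_const _).indicator measurableSet_Ioo
  set w : ℝ → ℝ := fun y => (1 + |b0 y|) * |f y| with hw
  have hwm : Measurable w := by
    have := hb0m.abs; have := hf.abs; fun_prop
  have hwi : ∫⁻ y, ENNReal.ofReal (w y) ≤ ENNReal.ofReal L := by
    refine le_trans (lintegral_mono ?_) hdf
    intro y
    apply ENNReal.ofReal_le_ofReal
    by_cases hy : y ∈ Ioo p q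
    · simp only [hw, hb0, hg, indicator_of_mem hy, Option.elim]
      rw [mul_comm]
    · simp [hw, fs y hy]
  have hfd : dm f univ ≤ ENNReal.ofReal L := by
    rw [dm_apply _ MeasurableSet.univ, Measure.restrict_univ]
    refine le_trans (lintegral_mono ?_) hwi
    intro y
    apply ENNReal.ofReal_le_ofReal
    simp only [hw]
    nlinarith [abs_nonneg (b0 y), abs_nonneg (f y)]
  have hbfd : dm (fun y => b0 y * f y) univ ≤ ENNReal.ofReal L := by
    rw [dm_apply _ MeasurableSet.univ, Measure.restrict_univ]
    refine le_trans (lintegral_mono ?_) hwi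
    intro y
    apply ENNReal.ofReal_le_ofReal
    simp only [hw]
    rw [abs_mul]
    nlinarith [abs_nonneg (b0 y), abs_nonneg (f y)]
  have hintg : ∀ h : ℝ → ℝ, Measurable h → dm h univ ≤ ENNReal.ofReal L → Integrable h := by
    intro h hm hd
    refine ⟨hm.aestronglyMeasurable, ?_⟩
    rw [hasFiniteIntegral_iff_norm]
    rw [dm_apply _ MeasurableSet.univ, Measure.restrict_univ] at hd
    exact hd.trans_lt ENNReal.ofReal_lt_top
  have hfi := hintg f hf hfd
  have hbfi : Integrable (fun y => b0 y * f y) := hintg _ (hb0m.mul hf) hbfd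
  set E := {x | x ∈ Ioo p q ∧ ∀ o, x ∉ Mset (dm (g o)) Λ} with hE
  have hGE : ∀ o, ∀ x ∈ E, ∀ y, |AD (g o) x p - AD (g o) y p| ≤ Λ * |x - y| := by
    intro o x hx y
    have : AD (g o) x p - AD (g o) y p = AD (g o) x y := by
      rw [AD_add (hgl o) x p y]; ring
    rw [this]
    exact AD_lip (hgl o) hΛ0.le (hx.2 o) y
  choose H hH1 hH2 using fun o => lip_ext hΛ0 (hGE o)
  set S0 := ⋃ o, Mset (dm (g o)) Λ with hS0
  set S1 := {x | x ∈ Ioc p q ∧ ∃ ε, 0 < ε ∧ 1 / γ1 < |TS H ε f x|} with hS1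
  set S2 := {x | x ∈ Ioc p q ∧ ∃ ε, 0 < ε ∧ 1 / γ2 < |TS (fun j => H (some j)) ε (fun y => b0 y * f y) x|} with hS2
  set S3 := {x | ENNReal.ofReal (Γ / 4) ≤ ENNReal.ofReal ce * Hf E w x} with hS3
  have v0 : volume S0 ≤ ENNReal.ofReal (η / 4 * L) := by
    refine (measure_iUnion_le _).trans ?_
    rw [tsum_fintype]
    calc _ ≤ ∑ o : Option ι, ENNReal.ofReal (5 / Λ) * ENNReal.ofReal L := by
          apply Finset.sum_le_sum
          intro o _
          refine (vol_Mset_le _ hΛ0).trans ?_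
          gcongr
          exact hgd o
      _ = ENNReal.ofReal (η / 4 * L) := by
          rw [Finset.sum_const, Finset.card_univ, Fintype.card_option, nsmul_eq_mul, ← hn,
            ← ENNReal.ofReal_mul (by positivity), ← ENNReal.ofReal_natCast, ← ENNReal.ofReal_mul (by positivity)]
          congr 1
          rw [hΛ]; push_cast; field_simp; norm_num
  have v1 : volume S1 ≤ ENNReal.ofReal (η / 4 * L) := by
    apply H1 H hH1 p q hpq f hf hfi (fun y hy => fs y (fun h => hy ⟨h.1, h.2.le⟩)) _ (by positivity)
    refine hfd.trans (le_of_eq ?_)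
    congr 1; field_simp; rw [hL]
  have v2 : volume S2 ≤ ENNReal.ofReal (η / 4 * L) := by
    apply H2 _ (fun j => hH1 (some j)) p q hpq _ (hb0m.mul hf) hbfi _ _ (by positivity)
    · refine hbfd.trans (le_of_eq ?_)
      congr 1; field_simp; rw [hL]
    · intro y hy
      show b0 y * f y = 0
      rw [fs y (fun h => hy ⟨h.1, h.2.le⟩), mul_zero]
  have v3 : volume S3 ≤ ENNReal.ofReal (η / 4 * L) := by
    have hm : Measurable fun x => ENNReal.ofReal ce * Hf E w x := (Hf_meas E hwm).const_mul _
    have h1 := mul_meas_ge_le_lintegral (μ := volume) hm (ENNReal.ofReal (Γ / 4))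
    have h2 : ∫⁻ x, ENNReal.ofReal ce * Hf E w x ≤ ENNReal.ofReal ce * (ENNReal.ofReal 4 * ENNReal.ofReal L) := by
      rw [lintegral_const_mul' _ _ ENNReal.ofReal_ne_top, ENNReal.ofReal_ofNat 4]
      gcongr
      refine (Hf_int E hwm).trans ?_
      gcongr
    calc volume S3 = ENNReal.ofReal (4 / Γ) * (ENNReal.ofReal (Γ / 4) * volume S3) := by
          rw [← mul_assoc, ← ENNReal.ofReal_mul (by positivity)]
          have : 4 / Γ * (Γ / 4) = 1 := by field_simp
          rw [this]; simp
      _ ≤ ENNReal.ofReal (4 / Γ) * (ENNReal.ofReal ce * (ENNReal.ofReal 4 * ENNReal.ofReal L)) :=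
          mul_le_mul_right (h1.trans h2) _
      _ = ENNReal.ofReal (16 * ce / Γ * L) := by
          rw [← ENNReal.ofReal_mul (by norm_num), ← ENNReal.ofReal_mul (by positivity), ← ENNReal.ofReal_mul (by positivity)]
          congr 1; ring
      _ ≤ _ := by
          apply ENNReal.ofReal_le_ofReal
          refine mul_le_mul_of_nonneg_right ?_ hL0.le
          rw [div_le_iff₀ hΓ0]
          have : 64 * ce / η ≤ Γ := by linarith
          calc 16 * ce = η / 4 * (64 * ce / η) := by field_simp; norm_num
            _ ≤ _ := by gcongr
  have hsub : {x | x ∈ Ioo p q ∧ ∃ ε, 0 < ε ∧ Γ < |TK a b ε f x|} ⊆ (S0 ∪ S1) ∪ (S2 ∪ S3) := by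
    rintro x ⟨hx, ε, hε, hxΓ⟩
    by_contra hcon
    simp only [mem_union, not_or] at hcon
    obtain ⟨⟨n0, n1⟩, n2, n3⟩ := hcon
    have hxE : x ∈ E := ⟨hx, fun o ho => n0 (mem_iUnion.2 ⟨o, ho⟩)⟩
    have t1 : |TS H ε f x| ≤ 1 / γ1 := by
      by_contra h; push Not at h
      exact n1 ⟨⟨hx.1, hx.2.le⟩, ε, hε, h⟩
    have t2 : |TS (fun j => H (some j)) ε (fun y => b0 y * f y) x| ≤ 1 / γ2 := by
      by_contra h; push Not at h
      exact n2 ⟨⟨hx.1, hx.2.le⟩, ε, hε, h⟩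
    have t3 : ENNReal.ofReal ce * Hf E w x < ENNReal.ofReal (Γ / 4) := by simpa [hS3] using n3
    by_cases hI : Integrable (fun y => kk a b ε x y * f y)
    swap
    · unfold TK at hxΓ
      rw [integral_undef hI, abs_zero] at hxΓ
      linarith
    have i1 := (TS_int hH1 hε hfi x).const_mul (Λ ^ (n + 1))
    have i2 := (TS_int (A := fun j => H (some j)) (fun j => hH1 (some j)) hε hbfi x).const_mul (Λ ^ n)
    set R : ℝ → ℝ := fun y => kk a b ε x y * f y - (Λ ^ (n + 1) * (kd H ε x y * f y) -
      Λ ^ n * (kd (fun j => H (some j)) ε x y * (b0 y * f y))) with hR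
    have i12 : Integrable (fun y => Λ ^ (n + 1) * (kd H ε x y * f y) -
      Λ ^ n * (kd (fun j => H (some j)) ε x y * (b0 y * f y))) := i1.sub i2
    have hTR : TK a b ε f x = Λ ^ (n + 1) * TS H ε f x - Λ ^ n * TS (fun j => H (some j)) ε (fun y => b0 y * f y) x
        + ∫ y, R y := by
      rw [hR, integral_sub hI i12, integral_sub i1 i2, integral_const_mul, integral_const_mul]
      unfold TK TS; ring
    have hRp : ∀ y, |R y| ≤ ce * (Metric.infDist y E * qd (Metric.infDist y E / 2) x y * w y) := by
      intro y
      set d := Metric.infDist y E with hd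
      have hd0 : 0 ≤ d := Metric.infDist_nonneg
      have hrhs : 0 ≤ ce * (d * qd (d / 2) x y * w y) := by
        have := qd_nonneg (d / 2) x y
        have : 0 ≤ w y := by simp only [hw]; positivity
        positivity
      by_cases hy : y ∈ Ioo p q
      swap
      · simp only [hR, fs y hy]; simpa using hrhs
      by_cases hxy : ε < |x - y|
      swap
      · simp only [hR, kk, kd, if_neg hxy]; simpa using hrhs
      have hxy0 : 0 < |x - y| := hε.trans hxy
      have hne : x - y ≠ 0 := abs_pos.1 hxy0
      have hdxy : d ≤ |x - y| := by
        have := Metric.infDist_le_dist_of_mem (x := y) hxE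
        rwa [Real.dist_eq, abs_sub_comm] at this
      have hdq : d * qd (d / 2) x y = d * (1 / |x - y| ^ 2) := by
        rcases hd0.eq_or_lt with h | h
        · rw [← h]; simp
        · unfold qd; rw [if_pos (by linarith)]
      have huIcc : ∀ t ∈ uIcc y x, t ∈ Ioo p q := by
        intro t ht
        exact (convex_Ioo p q).ordConnected.uIcc_subset hy hx ht
      have ga : ∀ j, AD (a j) x y = AD (g (some j)) x y := by
        intro j
        unfold AD
        apply intervalIntegral.integral_congr
        intro t ht
        simp only [hg, indicator_of_mem (huIcc t ht), Option.elim]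
      have gb : AD b x y / (x - y) - b y = AD (g none) x y / (x - y) - b0 y := by
        have : AD (g none) x y = AD b x y - avg b p q * (x - y) := by
          have e1 : AD (g none) x y = ∫ t in y..x, (b t - avg b p q) := by
            unfold AD
            apply intervalIntegral.integral_congr
            intro t ht
            simp only [hg, indicator_of_mem (huIcc t ht), Option.elim]
          rw [e1, intervalIntegral.integral_sub (li_ii hb.loc _ _) (by simp)]
          simp [AD, mul_comm]
        rw [this, hb0]
        simp only [hg, indicator_of_mem hy, Option.elim]
        field_simp; ring
      have hs1 : ∀ o, |AD (g o) x y / (x - y) / Λ| ≤ 1 := by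
        intro o
        rw [abs_div, abs_div, abs_of_pos hΛ0, div_le_one hΛ0, div_le_iff₀ hxy0]
        exact AD_lip (hgl o) hΛ0.le (hxE.2 o) y
      have hs2 : ∀ o, |(H o x - H o y) / (x - y)| ≤ 1 := by
        intro o
        rw [abs_div, div_le_one hxy0]
        exact hH1 o x y
      have hs3 : ∀ o, |AD (g o) x y / (x - y) / Λ - (H o x - H o y) / (x - y)| ≤ 2 * d / |x - y| := by
        intro o
        have h := hH2 o x hxE y
        have e1 : AD (g o) x p - AD (g o) y p = AD (g o) x y := by
          rw [AD_add (hgl o) x p y]; ring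
        rw [e1] at h
        have e2 : AD (g o) x y / (x - y) / Λ - (H o x - H o y) / (x - y) =
            (AD (g o) x y / Λ - (H o x - H o y)) / (x - y) := by
          rw [div_right_comm]; ring
        rw [e2, abs_div]
        exact div_le_div_of_nonneg_right h (abs_nonneg _)
      have key := err_alg (ι := ι) hΛ1 (t := x - y) (β := b0 y) (hs1 none) (hs2 none) (fun j => hs1 (some j))
        (fun j => hs2 (some j)) (hs3 none) (fun j => hs3 (some j)) (by positivity)
      have hRe : R y = ((Λ * (AD (g none) x y / (x - y) / Λ) - b0 y) *
          (∏ j, (Λ * (AD (g (some j)) x y / (x - y) / Λ))) / (x - y) - (Λ ^ (n + 1) *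
          (((H none x - H none y) / (x - y) * ∏ j, ((H (some j) x - H (some j) y) / (x - y))) / (x - y)) -
          Λ ^ n * (((∏ j, ((H (some j) x - H (some j) y) / (x - y))) / (x - y)) * b0 y))) * f y := by
        simp only [hR, kk, kd, if_pos hxy, KK, KS, gb, ga, Fintype.prod_option]
        have : ∀ o, Λ * (AD (g o) x y / (x - y) / Λ) = AD (g o) x y / (x - y) := fun o => by field_simp
        simp only [this]
        ring
      rw [hRe, abs_mul, hdq]
      calc _ ≤ ((1 + n) * Λ ^ (n + 1) * (1 + |b0 y|) * (2 * d / |x - y| / |x - y|)) * |f y| := by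
            gcongr
        _ = _ := by
            simp only [hce, hw]; field_simp
    have hRI : |∫ y, R y| ≤ Γ / 4 := by
      have : ENNReal.ofReal |∫ y, R y| ≤ ENNReal.ofReal ce * Hf E w x := by
        rw [← Real.norm_eq_abs, ofReal_norm_eq_enorm]
        refine (enorm_integral_le_lintegral_enorm _).trans ?_
        unfold Hf
        rw [← lintegral_const_mul' _ _ ENNReal.ofReal_ne_top]
        apply lintegral_mono
        intro y
        dsimp only
        have hq := qd_nonneg (Metric.infDist y E / 2) x y
        have hd0 : 0 ≤ Metric.infDist y E := Metric.infDist_nonneg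
        rw [← ENNReal.ofReal_mul (by positivity), ← ENNReal.ofReal_mul hce0.le, ← ofReal_norm_eq_enorm, Real.norm_eq_abs]
        exact ENNReal.ofReal_le_ofReal (hRp y)
      have h2 := this.trans t3.le
      exact (ENNReal.ofReal_le_ofReal_iff (by positivity)).1 h2
    have a1 := abs_add_le (Λ ^ (n + 1) * TS H ε f x - Λ ^ n * TS (fun j => H (some j)) ε (fun y => b0 y * f y) x) (∫ y, R y)
    have a2 := abs_sub (Λ ^ (n + 1) * TS H ε f x) (Λ ^ n * TS (fun j => H (some j)) ε (fun y => b0 y * f y) x)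
    rw [← hTR] at a1
    rw [abs_mul, abs_mul, abs_of_pos (by positivity : 0 < Λ ^ (n + 1)), abs_of_pos (by positivity : 0 < Λ ^ n)] at a2
    have a3 : Λ ^ (n + 1) * |TS H ε f x| ≤ Λ ^ (n + 1) * (1 / γ1) := by gcongr
    have a4 : Λ ^ n * |TS (fun j => H (some j)) ε (fun y => b0 y * f y) x| ≤ Λ ^ n * (1 / γ2) := by gcongr
    rw [mul_one_div] at a3 a4
    linarith
  refine (measure_mono hsub).trans ((measure_union_le _ _).trans ?_)
  refine (add_le_add (measure_union_le _ _) (measure_union_le _ _)).trans ?_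
  refine (add_le_add (add_le_add v0 v1) (add_le_add v2 v3)).trans ?_
  rw [← ENNReal.ofReal_add (by positivity) (by positivity), ← ENNReal.ofReal_add (by positivity) (by positivity)]
  apply ENNReal.ofReal_le_ofReal
  linarith

end CCA

end

section
namespace CCA
variable {ι : Type} [Fintype ι]

structure Nice (b f : ℝ → ℝ) : Prop where
  meas : Measurable f
  int : Integrable f
  bint : Integrable (fun y => b y * f y)
  supp : ∃ R : ℝ, 0 < R ∧ ∀ y, R < |y| → f y = 0

theorem AD_cont {g : ℝ → ℝ} (hg : LocallyIntegrable g volume) : Continuous fun p : ℝ × ℝ => AD g p.1 p.2 := by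
  have h1 : Continuous fun x => AD g x 0 := by
    unfold AD
    exact intervalIntegral.continuous_primitive (fun a b => li_ii hg a b) 0
  have e : (fun p : ℝ × ℝ => AD g p.1 p.2) = fun p => AD g p.1 0 - AD g p.2 0 := by
    ext p
    rw [AD_add hg p.1 0 p.2]; ring
  rw [e]
  fun_prop

theorem KK_meas {a : ι → ℝ → ℝ} {b : ℝ → ℝ} (hb : IsB b) (ha : ∀ j, LocallyIntegrable (a j) volume) :
    Measurable fun p : ℝ × ℝ => KK a b p.1 p.2 := by
  have h1 := (AD_cont hb.loc).measurable
  have h2 := fun j => (AD_cont (ha j)).measurable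
  have h3 : Measurable fun p : ℝ × ℝ => b p.2 := hb.meas.comp measurable_snd
  unfold KK
  have h4 : Measurable fun p : ℝ × ℝ => ∏ j, (AD (a j) p.1 p.2 / (p.1 - p.2)) :=
    Finset.measurable_fun_prod _ fun j _ => (h2 j).div (by fun_prop)
  have h5 : Measurable fun p : ℝ × ℝ => p.1 - p.2 := by fun_prop
  exact (((h1.div h5).sub h3).mul h4).div h5

theorem kk_meas {a : ι → ℝ → ℝ} {b : ℝ → ℝ} (hb : IsB b) (ha : ∀ j, LocallyIntegrable (a j) volume) (ε : ℝ) :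
    Measurable fun p : ℝ × ℝ => kk a b ε p.1 p.2 := by
  unfold kk
  exact Measurable.ite (measurableSet_lt measurable_const (by fun_prop)) (KK_meas hb ha) measurable_const

theorem kk_meas1 {a : ι → ℝ → ℝ} {b : ℝ → ℝ} (hb : IsB b) (ha : ∀ j, LocallyIntegrable (a j) volume) (ε x : ℝ) :
    Measurable fun y => kk a b ε x y := (kk_meas hb ha ε).comp measurable_prodMk_left

theorem kk_dom {a : ι → ℝ → ℝ} {b : ℝ → ℝ} (hb : IsB b) (ha : ∀ j, LocallyIntegrable (a j) volume)
    (X R : ℝ) {ε : ℝ} (hε : 0 < ε) : ∃ D : ℝ, 0 ≤ D ∧ ∀ x y, |x| ≤ X → |y| ≤ R → ∀ ε', ε ≤ ε' →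
      |kk a b ε' x y| ≤ D * (1 + |b y|) := by
  set W := max X R with hW
  set M := 1 + (∫ t in Ioo (-W) W, |b t|) / ε + ∑ j, (∫ t in Ioo (-W) W, |a j t|) / ε with hM
  have hb0 : 0 ≤ (∫ t in Ioo (-W) W, |b t|) / ε := div_nonneg (integral_nonneg fun _ => abs_nonneg _) hε.le
  have ha0 : ∀ j, 0 ≤ (∫ t in Ioo (-W) W, |a j t|) / ε := fun j =>
    div_nonneg (integral_nonneg fun _ => abs_nonneg _) hε.le
  have hs0 : 0 ≤ ∑ j, (∫ t in Ioo (-W) W, |a j t|) / ε := Finset.sum_nonneg fun j _ => ha0 j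
  have hM1 : 1 ≤ M := by linarith
  refine ⟨M * M ^ Fintype.card ι / ε, by positivity, ?_⟩
  intro x y hx hy ε' hε'
  have hx' : x ∈ Icc (-W) W := by
    have := abs_le.1 (hx.trans (le_max_left X R)); exact this
  have hy' : y ∈ Icc (-W) W := by
    have := abs_le.1 (hy.trans (le_max_right X R)); exact this
  unfold kk
  split_ifs with h
  swap
  · rw [abs_zero]; positivity
  have hxy : ε ≤ |x - y| := by linarith
  have hsl : ∀ g : ℝ → ℝ, LocallyIntegrable g volume → |AD g x y / (x - y)| ≤ (∫ t in Ioo (-W) W, |g t|) / ε := by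
    intro g hg
    rw [abs_div]
    have := AD_le_Ioo hg hx' hy'
    have h0 : 0 ≤ ∫ t in Ioo (-W) W, |g t| := integral_nonneg fun _ => abs_nonneg _
    gcongr
  have h1 : |AD b x y / (x - y) - b y| ≤ M * (1 + |b y|) := by
    have := abs_sub (AD b x y / (x - y)) (b y)
    have := hsl b hb.loc
    nlinarith [abs_nonneg (b y)]
  have h2 : |∏ j, (AD (a j) x y / (x - y))| ≤ M ^ Fintype.card ι := by
    rw [Finset.abs_prod, ← Finset.card_univ, ← Finset.prod_const]
    apply Finset.prod_le_prod (fun _ _ => abs_nonneg _)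
    intro j _
    have h3 := hsl _ (ha j)
    have := Finset.single_le_sum (fun j _ => ha0 j) (Finset.mem_univ j)
    linarith
  unfold KK
  rw [abs_div, abs_mul]
  calc _ ≤ (M * (1 + |b y|)) * M ^ Fintype.card ι / ε := by gcongr
    _ = _ := by ring

theorem kk_int {a : ι → ℝ → ℝ} {b f : ℝ → ℝ} (hb : IsB b) (ha : ∀ j, LocallyIntegrable (a j) volume)
    (hf : Nice b f) {ε : ℝ} (hε : 0 < ε) (x : ℝ) : Integrable (fun y => kk a b ε x y * f y) := by
  obtain ⟨R, hR, hs⟩ := hf.supp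
  obtain ⟨D, hD, h⟩ := kk_dom hb ha |x| R hε
  have hi : Integrable (fun y => D * (|f y| + |b y * f y|)) := (hf.int.abs.add hf.bint.abs).const_mul D
  refine hi.mono' ((kk_meas1 hb ha ε x).mul hf.meas).aestronglyMeasurable (ae_of_all _ ?_)
  intro y
  rw [Real.norm_eq_abs, abs_mul, abs_mul]
  by_cases hy : R < |y|
  · rw [hs y hy]; simp
  · have := h x y le_rfl (not_lt.1 hy) ε le_rfl
    calc _ ≤ D * (1 + |b y|) * |f y| := by gcongr
      _ = _ := by ring

theorem Nice.indicator {b f : ℝ → ℝ} (hf : Nice b f) {S : Set ℝ} (hS : MeasurableSet S) : Nice b (S.indicator f) := by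
  obtain ⟨R, hR, hs⟩ := hf.supp
  refine ⟨hf.meas.indicator hS, hf.int.indicator hS, ?_, R, hR, ?_⟩
  · have : (fun y => b y * S.indicator f y) = S.indicator (fun y => b y * f y) := by
      ext y; by_cases hy : y ∈ S <;> simp [hy]
    rw [this]; exact hf.bint.indicator hS
  · intro y hy
    by_cases h : y ∈ S <;> simp [h, hs y hy]

theorem Nice.const_mul {b f : ℝ → ℝ} (hf : Nice b f) (c : ℝ) : Nice b (fun y => c * f y) := by
  obtain ⟨R, hR, hs⟩ := hf.supp
  refine ⟨hf.meas.const_mul c, hf.int.const_mul c, ?_, R, hR, fun y hy => by simp [hs y hy]⟩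
  have : (fun y => b y * (c * f y)) = (fun y => c * (b y * f y)) := by ext y; ring
  rw [this]; exact hf.bint.const_mul c

theorem Nice.add {b f g : ℝ → ℝ} (hf : Nice b f) (hg : Nice b g) : Nice b (fun y => f y + g y) := by
  obtain ⟨R, hR, hs⟩ := hf.supp
  obtain ⟨R', hR', hs'⟩ := hg.supp
  refine ⟨hf.meas.add hg.meas, hf.int.add hg.int, ?_, max R R', lt_max_of_lt_left hR, fun y hy => ?_⟩
  · have : (fun y => b y * (f y + g y)) = (fun y => b y * f y + b y * g y) := by ext y; ring
    rw [this]; exact hf.bint.add hg.bint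
  · simp [hs y ((le_max_left _ _).trans_lt hy), hs' y ((le_max_right _ _).trans_lt hy)]

theorem TK_add {a : ι → ℝ → ℝ} {b f g : ℝ → ℝ} (hb : IsB b) (ha : ∀ j, LocallyIntegrable (a j) volume)
    (hf : Nice b f) (hg : Nice b g) {ε : ℝ} (hε : 0 < ε) (x : ℝ) :
    TK a b ε (fun y => f y + g y) x = TK a b ε f x + TK a b ε g x := by
  unfold TK
  rw [← integral_add (kk_int hb ha hf hε x) (kk_int hb ha hg hε x)]
  congr 1; ext y; ring

/-- continuity of the truncated operator -/
theorem TK_cont {a : ι → ℝ → ℝ} {b f : ℝ → ℝ} (hb : IsB b) (ha : ∀ j, LocallyIntegrable (a j) volume)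
    (hf : Nice b f) {ε : ℝ} (hε : 0 < ε) : Continuous (TK a b ε f) := by
  rw [continuous_iff_continuousAt]
  intro x0
  obtain ⟨R, hR, hs⟩ := hf.supp
  obtain ⟨D, hD, h⟩ := kk_dom hb ha (|x0| + 1) R hε
  have hi : Integrable (fun y => D * (|f y| + |b y * f y|)) := (hf.int.abs.add hf.bint.abs).const_mul D
  unfold TK
  apply continuousAt_of_dominated (bound := fun y => D * (|f y| + |b y * f y|))
  · exact Eventually.of_forall fun x => ((kk_meas1 hb ha ε x).mul hf.meas).aestronglyMeasurable
  · filter_upwards [Metric.ball_mem_nhds x0 one_pos] with x hx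
    apply ae_of_all
    intro y
    rw [Real.norm_eq_abs, abs_mul, abs_mul]
    by_cases hy : R < |y|
    · rw [hs y hy]; simp
    · have hx' : |x| ≤ |x0| + 1 := by
        rw [Metric.mem_ball, Real.dist_eq] at hx
        have := abs_sub_abs_le_abs_sub x x0
        linarith
      have := h x y hx' (not_lt.1 hy) ε le_rfl
      calc _ ≤ D * (1 + |b y|) * |f y| := by gcongr
        _ = _ := by ring
  · exact hi
  · have hn : ∀ᵐ y : ℝ, y ≠ x0 - ε ∧ y ≠ x0 + ε := by
      filter_upwards [(measure_eq_zero_iff_ae_notMem.1 (Real.volume_singleton (a := x0 - ε))),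
        (measure_eq_zero_iff_ae_notMem.1 (Real.volume_singleton (a := x0 + ε)))] with y h1 h2
      exact ⟨h1, h2⟩
    filter_upwards [hn] with y hy
    apply ContinuousAt.mul _ continuousAt_const
    have hne : ε ≠ |x0 - y| := by
      intro he
      rcases abs_cases (x0 - y) with ⟨h1, _⟩ | ⟨h1, _⟩
      · exact hy.1 (by linarith)
      · exact hy.2 (by linarith)
    have hca : ContinuousAt (fun x => |x - y|) x0 := by fun_prop
    rcases lt_or_gt_of_ne hne with hlt | hgt
    · have hev : (fun x => kk a b ε x y) =ᶠ[nhds x0] fun x => KK a b x y := by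
        filter_upwards [hca.eventually (lt_mem_nhds hlt)] with x hx
        unfold kk; rw [if_pos hx]
      refine ContinuousAt.congr ?_ hev.symm
      have hne' : x0 - y ≠ 0 := abs_pos.1 (hε.trans hlt)
      have c1 : ∀ g, LocallyIntegrable g volume → ContinuousAt (fun x => AD g x y / (x - y)) x0 := by
        intro g hg
        have : Continuous fun x => AD g x y := (AD_cont hg).comp (by fun_prop : Continuous fun x : ℝ => (x, y))
        exact this.continuousAt.div (by fun_prop) hne'
      unfold KK
      have c2 : ContinuousAt (fun x => ∏ j, (AD (a j) x y / (x - y))) x0 :=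
        tendsto_finsetProd _ fun j _ => c1 _ (ha j)
      exact (((c1 b hb.loc).sub continuousAt_const).mul c2).div (by fun_prop) hne'
    · have hev : (fun x => kk a b ε x y) =ᶠ[nhds x0] fun x => 0 := by
        filter_upwards [hca.eventually (gt_mem_nhds hgt)] with x hx
        unfold kk; rw [if_neg (not_lt.2 hx.le)]
      exact ContinuousAt.congr continuousAt_const hev.symm

end CCA

end

section
namespace CCA
variable {ι : Type} [Fintype ι]

theorem AD_sub_const {g : ℝ → ℝ} (hg : LocallyIntegrable g volume) (c x y : ℝ) :
    AD (fun t => g t - c) x y = AD g x y - c * (x - y) := by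
  unfold AD
  rw [intervalIntegral.integral_sub (li_ii hg _ _) (by simp)]
  simp [mul_comm]

theorem ADb_osc {b : ℝ → ℝ} (hb : IsB b) {u v w y : ℝ} (huv : u < v) (hw : w ∈ Icc u v) (hy : y ∈ Icc u v) :
    |AD b w y - avg b u v * (w - y)| ≤ v - u := by
  rw [← AD_sub_const hb.loc]
  refine (AD_le_Ioo (hb.locsub _) hw hy).trans ?_
  rw [← integral_Ioc_eq_integral_Ioo]
  exact hb.osc u v huv

theorem ADa_le {g : ℝ → ℝ} (hg : LocallyIntegrable g volume) {u v w y : ℝ} (huv : u < v)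
    (h : dm g (Ioo u v) ≤ ENNReal.ofReal (v - u)) (hw : w ∈ Icc u v) (hy : y ∈ Icc u v) :
    |AD g w y| ≤ v - u := by
  refine (AD_le_Ioo hg hw hy).trans ?_
  rw [dm_eq_ofReal measurableSet_Ioo (li_Ioo hg _ _)] at h
  exact (ENNReal.ofReal_le_ofReal_iff (by linarith)).1 h

theorem abs_prod_le_pow {u : ι → ℝ} {Λ : ℝ} (h : ∀ j, |u j| ≤ Λ) : |∏ j, u j| ≤ Λ ^ Fintype.card ι := by
  rw [Finset.abs_prod, ← Finset.card_univ, ← Finset.prod_const]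
  exact Finset.prod_le_prod (fun _ _ => abs_nonneg _) fun j _ => h j

theorem prod_diff_le {u v : ι → ℝ} {Λ δ : ℝ} (hΛ : 1 ≤ Λ) (hu : ∀ j, |u j| ≤ Λ) (hv : ∀ j, |v j| ≤ Λ)
    (h : ∀ j, |u j - v j| ≤ δ) : |∏ j, u j - ∏ j, v j| ≤ Fintype.card ι * Λ ^ Fintype.card ι * δ := by
  have hΛ0 : 0 < Λ := by linarith
  have e : ∀ w : ι → ℝ, ∏ j, w j = Λ ^ Fintype.card ι * ∏ j, (w j / Λ) := by
    intro w
    rw [Finset.prod_div_distrib, Finset.prod_const, Finset.card_univ]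
    field_simp
  have hd := prod_sub_le (u := fun j => u j / Λ) (v := fun j => v j / Λ)
    (fun j => by rw [abs_div, abs_of_pos hΛ0, div_le_one hΛ0]; exact hu j)
    (fun j => by rw [abs_div, abs_of_pos hΛ0, div_le_one hΛ0]; exact hv j)
  have hd2 : ∑ j, |u j / Λ - v j / Λ| ≤ ∑ _j : ι, δ := by
    apply Finset.sum_le_sum
    intro j _
    rw [← sub_div, abs_div, abs_of_pos hΛ0]
    exact (div_le_self (abs_nonneg _) hΛ).trans (h j)
  rw [Finset.sum_const, Finset.card_univ, nsmul_eq_mul] at hd2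
  rw [e u, e v, ← mul_sub, abs_mul, abs_of_pos (by positivity : 0 < Λ ^ Fintype.card ι)]
  calc _ ≤ Λ ^ Fintype.card ι * (Fintype.card ι * δ) := by gcongr; exact hd.trans hd2
    _ = _ := by ring

theorem KK_size {a : ι → ℝ → ℝ} {b : ℝ → ℝ} (hb : IsB b) (ha : ∀ j, LocallyIntegrable (a j) volume)
    {u v w y : ℝ} (huv : u < v) (hw : w ∈ Icc u v) (hy : y ∈ Icc u v)
    (hda : ∀ j, dm (a j) (Ioo u v) ≤ ENNReal.ofReal (v - u)) (h : v - u ≤ 24 * |w - y|) :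
    |KK a b w y| ≤ 24 * 24 ^ Fintype.card ι * (1 + |b y - avg b u v|) / |w - y| := by
  have ht : 0 < |w - y| := by linarith
  have ht' : w - y ≠ 0 := abs_pos.1 ht
  have h1 : |∏ j, (AD (a j) w y / (w - y))| ≤ 24 ^ Fintype.card ι := by
    apply abs_prod_le_pow
    intro j
    rw [abs_div, div_le_iff₀ ht]
    exact (ADa_le (ha j) huv (hda j) hw hy).trans h
  have h2 : |AD b w y / (w - y) - b y| ≤ 24 * (1 + |b y - avg b u v|) := by
    have e : AD b w y / (w - y) - b y = (AD b w y - avg b u v * (w - y)) / (w - y) - (b y - avg b u v) := by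
      field_simp; ring
    rw [e]
    refine (abs_sub _ _).trans ?_
    have : |(AD b w y - avg b u v * (w - y)) / (w - y)| ≤ 24 := by
      rw [abs_div, div_le_iff₀ ht]
      exact (ADb_osc hb huv hw hy).trans h
    linarith [abs_nonneg (b y - avg b u v)]
  unfold KK
  rw [abs_div, abs_mul]
  apply div_le_div_of_nonneg_right _ ht.le
  calc _ ≤ (24 * (1 + |b y - avg b u v|)) * 24 ^ Fintype.card ι := by gcongr
    _ = _ := by ring

theorem diff_alg {u v : ι → ℝ} {B1 B2 β t1 t2 ρ δ δ' τ : ℝ} (hρ : 0 < ρ) (hu : ∀ j, |u j| ≤ 24) (hv : ∀ j, |v j| ≤ 24)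
    (h : ∀ j, |u j - v j| ≤ δ) (hδ : 0 ≤ δ) (hB2 : |B2| ≤ 24) (hB : |B1 - B2| ≤ δ') (ht1 : |t1⁻¹| ≤ 2 / ρ)
    (ht : |t1⁻¹ - t2⁻¹| ≤ τ) :
    |(B1 - β) * (∏ j, u j) / t1 - (B2 - β) * (∏ j, v j) / t2| ≤
      24 ^ Fintype.card ι * (δ' * (2 / ρ) + 24 * (1 + |β|) * (Fintype.card ι * δ * (2 / ρ) + τ)) := by
  have h1 := abs_prod_le_pow hu
  have h2 := abs_prod_le_pow hv
  have h3 := prod_diff_le (by norm_num) hu hv h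
  have h4 : |B2 - β| ≤ 24 * (1 + |β|) := by
    refine (abs_sub _ _).trans ?_
    linarith [abs_nonneg β]
  have hδ' : 0 ≤ δ' := (abs_nonneg _).trans hB
  have e : (B1 - β) * (∏ j, u j) / t1 - (B2 - β) * (∏ j, v j) / t2 =
      (B1 - B2) * (∏ j, u j) * t1⁻¹ + (B2 - β) * (∏ j, u j - ∏ j, v j) * t1⁻¹ +
      (B2 - β) * (∏ j, v j) * (t1⁻¹ - t2⁻¹) := by
    rw [div_eq_mul_inv, div_eq_mul_inv]; ring
  rw [e]
  refine (abs_add_three _ _ _).trans ?_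
  simp only [abs_mul]
  calc _ ≤ δ' * 24 ^ Fintype.card ι * (2 / ρ) + (24 * (1 + |β|)) * (Fintype.card ι * 24 ^ Fintype.card ι * δ) * (2 / ρ)
        + (24 * (1 + |β|)) * 24 ^ Fintype.card ι * τ := by gcongr
    _ = _ := by ring

theorem avg_tele {b : ℝ → ℝ} (hb : IsB b) {c ρ : ℝ} (hρ : 0 < ρ) (k : ℕ) :
    |avg b (c - ρ) (c + ρ) - avg b (c - ρ * 2 ^ k) (c + ρ * 2 ^ k)| ≤ 2 * k := by
  induction k with
  | zero => simp
  | succ k ih =>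
    have h : |avg b (c - ρ * 2 ^ k) (c + ρ * 2 ^ k) - avg b (c - ρ * 2 ^ (k + 1)) (c + ρ * 2 ^ (k + 1))| ≤ 2 := by
      have hp : 0 < ρ * 2 ^ k := by positivity
      have hp1 : ρ * 2 ^ (k + 1) = 2 * (ρ * 2 ^ k) := by ring
      apply avg_sub_le hb.loc (by linarith)
      have := hb.osc (c - ρ * 2 ^ (k + 1)) (c + ρ * 2 ^ (k + 1)) (by rw [hp1]; linarith)
      refine (setIntegral_mono_set (li_Ioc (hb.locsub _) _ _).abs (ae_of_all _ fun _ => abs_nonneg _)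
        (HasSubset.Subset.eventuallyLE (Ioc_subset_Ioc ?_ ?_))).trans (this.trans (le_of_eq ?_))
      · rw [hp1]; linarith
      · rw [hp1]; linarith
      · rw [hp1]; ring
    push_cast
    have := abs_sub_le (avg b (c - ρ) (c + ρ)) (avg b (c - ρ * 2 ^ k) (c + ρ * 2 ^ k)) (avg b (c - ρ * 2 ^ (k + 1)) (c + ρ * 2 ^ (k + 1)))
    linarith

noncomputable def C1 (n : ℕ) : ℝ := 24 ^ n * (144 + 2304 * n)

/-- pointwise kernel difference on the k-th ring -/
theorem ring_pt {a : ι → ℝ → ℝ} {b : ℝ → ℝ} (hb : IsB b) (ha : ∀ j, LocallyIntegrable (a j) volume)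
    {c L x z : ℝ} (hL : 0 < L) (hx : x ∈ Ioo c (c + L)) (hz : z ∈ Ioo c (c + L))
    (hza : ∀ j, z ∉ Mset (dm (a j)) 1) (k : ℕ) {ρ : ℝ} (hρ : ρ = 2 * L * 2 ^ k) {y : ℝ} (hy1 : ρ ≤ |y - c|)
    (hy2 : |y - c| ≤ 2 * ρ) :
    |KK a b x y - KK a b c y| ≤ C1 (Fintype.card ι) * (1 + k) * (L / ρ ^ 2) *
      (1 + |b y - avg b (c - 4 * ρ) (c + 4 * ρ)|) := by
  have hk1 : (1:ℝ) ≤ 2 ^ k := one_le_pow₀ (by norm_num)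
  have hρL : 2 * L ≤ ρ := by rw [hρ]; nlinarith
  have hρ0 : 0 < ρ := by linarith
  obtain ⟨hx1, hx2⟩ := hx
  obtain ⟨hz1, hz2⟩ := hz
  have hxc : |x - c| ≤ L := by rw [abs_of_pos (by linarith)]; linarith
  have hcy : ρ ≤ |c - y| := by rwa [abs_sub_comm]
  have hxy : ρ / 2 ≤ |x - y| := by
    have := abs_sub_abs_le_abs_sub (c - y) (c - x)
    have e : c - y - (c - x) = x - y := by ring
    rw [e, abs_sub_comm c x] at this
    linarith
  have hxy0 : 0 < |x - y| := by linarith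
  have hcy0 : 0 < |c - y| := by linarith
  have nx : x - y ≠ 0 := abs_pos.1 hxy0
  have nc : c - y ≠ 0 := abs_pos.1 hcy0
  have hyc := abs_le.1 hy2
  set u := c - 4 * ρ with hu
  set v := c + 4 * ρ with hv
  have huv : u < v := by linarith
  have mx : x ∈ Icc u v := ⟨by linarith, by linarith⟩
  have mc : c ∈ Icc u v := ⟨by linarith, by linarith⟩
  have my : y ∈ Icc u v := ⟨by linarith [hyc.1], by linarith [hyc.2]⟩
  have huv8 : v - u = 8 * ρ := by linarith
  have hda : ∀ j, dm (a j) (Ioo u v) ≤ ENNReal.ofReal (v - u) := by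
    intro j
    have := Mset_le_of_notMem (hza j) (u := u) (v := v) (by linarith) (by linarith)
    rwa [one_mul] at this
  have hda0 : ∀ j, dm (a j) (Ioo (c - 8 * L) (c + 8 * L)) ≤ ENNReal.ofReal (c + 8 * L - (c - 8 * L)) := by
    intro j
    have := Mset_le_of_notMem (hza j) (u := c - 8 * L) (v := c + 8 * L) (by linarith) (by linarith)
    rwa [one_mul] at this
  have i1 : |(x - y)⁻¹| ≤ 2 / ρ := by
    rw [abs_inv, inv_le_comm₀ hxy0 (by positivity), inv_div]; exact hxy
  have i2 : |(c - y)⁻¹| ≤ 1 / ρ := by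
    rw [abs_inv, inv_le_comm₀ hcy0 (by positivity), inv_div, div_one]; exact hcy
  have i3 : |(x - y)⁻¹ - (c - y)⁻¹| ≤ 2 * L / ρ ^ 2 := by
    have e : (x - y)⁻¹ - (c - y)⁻¹ = -((x - c) * (x - y)⁻¹ * (c - y)⁻¹) := by field_simp; ring
    rw [e, abs_neg, abs_mul, abs_mul]
    calc _ ≤ L * (2 / ρ) * (1 / ρ) := by gcongr
      _ = _ := by field_simp
  -- generic slope difference
  have slope : ∀ (P Q R M : ℝ), P = R + Q → |Q| ≤ 8 * ρ → |R| ≤ M → |P / (x - y) - Q / (c - y)| ≤ M * (2 / ρ) + 16 * (L / ρ) := by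
    intro P Q R M hP hQ hR
    have e : P / (x - y) - Q / (c - y) = R * (x - y)⁻¹ + Q * ((x - y)⁻¹ - (c - y)⁻¹) := by
      rw [hP, div_eq_mul_inv, div_eq_mul_inv]; ring
    rw [e]
    refine (abs_add_le _ _).trans ?_
    rw [abs_mul, abs_mul]
    have hM : 0 ≤ M := (abs_nonneg _).trans hR
    calc _ ≤ M * (2 / ρ) + 8 * ρ * (2 * L / ρ ^ 2) := by gcongr
      _ = _ := by field_simp; ring
  have s1 : ∀ g w, |g| ≤ 8 * ρ → ρ / 2 ≤ |w - y| → |g / (w - y)| ≤ 24 := by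
    intro g w hg hw
    rw [abs_div, div_le_iff₀ (by linarith)]
    linarith
  have hk0 : (0:ℝ) ≤ k := by positivity
  have hLρ : 0 ≤ L / ρ := by positivity
  set m := avg b u v with hm
  have hB := diff_alg (ι := ι) (u := fun j => AD (a j) x y / (x - y)) (v := fun j => AD (a j) c y / (c - y))
    (B1 := (AD b x y - m * (x - y)) / (x - y)) (B2 := (AD b c y - m * (c - y)) / (c - y)) (β := b y - m)
    (t1 := x - y) (t2 := c - y) (δ := 48 * (L / ρ)) (δ' := 48 * (1 + k) * (L / ρ)) (τ := 2 * L / ρ ^ 2) hρ0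
    (fun j => s1 _ _ (by rw [← huv8]; exact ADa_le (ha j) huv (hda j) mx my) hxy)
    (fun j => s1 _ _ (by rw [← huv8]; exact ADa_le (ha j) huv (hda j) mc my) (by linarith))
    (by
      intro j
      have := slope (AD (a j) x y) (AD (a j) c y) (AD (a j) x c) (16 * L) (AD_add (ha j) _ _ _)
        (by rw [← huv8]; exact ADa_le (ha j) huv (hda j) mc my)
        (by
          have := ADa_le (ha j) (by linarith) (hda0 j) (w := x) (y := c) ⟨by linarith, by linarith⟩ ⟨by linarith, by linarith⟩
          linarith)
      refine this.trans (le_of_eq ?_)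
      ring)
    (by positivity)
    (s1 _ _ (by rw [← huv8]; exact ADb_osc hb huv mc my) (by linarith))
    (by
      have := slope (AD b x y - m * (x - y)) (AD b c y - m * (c - y)) (AD b x c - m * (x - c)) (16 * L + 2 * k * L)
        (by rw [AD_add hb.loc x y c]; ring)
        (by rw [← huv8]; exact ADb_osc hb huv mc my)
        (by
          have h1 := ADb_osc hb (u := c - 8 * L) (v := c + 8 * L) (w := x) (y := c) (by linarith) ⟨by linarith, by linarith⟩ ⟨by linarith, by linarith⟩
          have h2 := avg_tele hb (c := c) (ρ := 8 * L) (by linarith) k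
          have e8 : 8 * L * 2 ^ k = 4 * ρ := by rw [hρ]; ring
          rw [e8] at h2
          set m0 := avg b (c - 8 * L) (c + 8 * L) with hm0
          have e : AD b x c - m * (x - c) = (AD b x c - m0 * (x - c)) + (m0 - m) * (x - c) := by ring
          rw [e]
          refine (abs_add_le _ _).trans ?_
          rw [abs_mul]
          have : |m0 - m| * |x - c| ≤ 2 * k * L := by gcongr
          linarith)
      refine this.trans ?_
      have : (16 * L + 2 * k * L) * (2 / ρ) + 16 * (L / ρ) = (48 + 4 * k) * (L / ρ) := by ring
      rw [this]
      gcongr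
      linarith)
    i1 i3
  have e1 : (AD b x y - m * (x - y)) / (x - y) - (b y - m) = AD b x y / (x - y) - b y := by field_simp; ring
  have e2 : (AD b c y - m * (c - y)) / (c - y) - (b y - m) = AD b c y / (c - y) - b y := by field_simp; ring
  rw [e1, e2] at hB
  unfold KK
  refine hB.trans ?_
  unfold C1
  set n := Fintype.card ι
  set β := |b y - m|
  have hβ : 0 ≤ β := abs_nonneg _
  have hn : (0:ℝ) ≤ n := by positivity
  have e3 : 48 * (1 + (k:ℝ)) * (L / ρ) * (2 / ρ) + 24 * (1 + β) * (n * (48 * (L / ρ)) * (2 / ρ) + 2 * L / ρ ^ 2)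
    = (96 * (1 + k) + (1 + β) * (2304 * n + 48)) * (L / ρ ^ 2) := by field_simp; ring
  rw [e3]
  have h5 : 96 * (1 + (k:ℝ)) + (1 + β) * (2304 * n + 48) ≤ (144 + 2304 * n) * (1 + k) * (1 + β) := by
    have : 0 ≤ (k:ℝ) * β := by positivity
    have : 0 ≤ (n:ℝ) * k := by positivity
    have : 0 ≤ (n:ℝ) * k * β := by positivity
    nlinarith
  calc _ ≤ 24 ^ n * ((144 + 2304 * n) * (1 + k) * (1 + β) * (L / ρ ^ 2)) := by gcongr
    _ = _ := by ring

end CCA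

end

section
namespace CCA
variable {ι : Type} [Fintype ι]

theorem C1_nonneg (n : ℕ) : 0 ≤ C1 n := by unfold C1; positivity

theorem geo_k (k : ℕ) : (1 + (k:ℝ)) / 2 ^ k ≤ 2 * (3 / 4) ^ k := by
  have h := one_add_mul_le_pow (a := (1/2 : ℝ)) (by norm_num) k
  have h2 : (1 + (1/2:ℝ)) ^ k = (3 / 4) ^ k * 2 ^ k := by rw [← mul_pow]; norm_num
  rw [div_le_iff₀ (by positivity)]
  rw [h2] at h
  have : (0:ℝ) ≤ (3 / 4) ^ k * 2 ^ k := by positivity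
  linarith

theorem far_diff {a : ι → ℝ → ℝ} {b f : ℝ → ℝ} (hb : IsB b) (ha : ∀ j, LocallyIntegrable (a j) volume)
    {c L x z : ℝ} (hL : 0 < L) (hx : x ∈ Ioo c (c + L)) (hz : z ∈ Ioo c (c + L))
    (hza : ∀ j, z ∉ Mset (dm (a j)) 1) (hzf : z ∉ Nset b f 1) :
    ∫⁻ y in {y | 2 * L < |y - c|}, ENNReal.ofReal (|KK a b x y - KK a b c y| * |f y|) ≤
      ENNReal.ofReal (32 * C1 (Fintype.card ι)) := by
  set n := Fintype.card ι with hn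
  have hC := C1_nonneg n
  set S : ℕ → Set ℝ := fun k => {y | 2 * L * 2 ^ k ≤ |y - c| ∧ |y - c| ≤ 2 * (2 * L * 2 ^ k)} with hS
  have hSm : ∀ k, MeasurableSet (S k) := fun k =>
    MeasurableSet.inter (measurableSet_le (f := fun _ => 2 * L * 2 ^ k) (g := fun y : ℝ => |y - c|) (by fun_prop) (by fun_prop))
      (measurableSet_le (f := fun y : ℝ => |y - c|) (g := fun _ => 2 * (2 * L * 2 ^ k)) (by fun_prop) (by fun_prop))
  have hcov : {y | 2 * L < |y - c|} ⊆ ⋃ k, S k := by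
    intro y hy
    have hy' : 1 < |y - c| / (2 * L) := by rw [lt_div_iff₀ (by positivity)]; simpa using hy
    obtain ⟨k, hk1, hk2⟩ := exists_nat_pow_near hy'.le (by norm_num : (1:ℝ) < 2)
    rw [mem_iUnion]
    refine ⟨k, ?_, ?_⟩
    · rw [le_div_iff₀ (by positivity)] at hk1; linarith
    · rw [div_lt_iff₀ (by positivity), pow_succ] at hk2; linarith
  refine (lintegral_mono_set hcov).trans ((lintegral_iUnion_le _ _).trans ?_)
  have hk : ∀ k, ∫⁻ y in S k, ENNReal.ofReal (|KK a b x y - KK a b c y| * |f y|) ≤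
      ENNReal.ofReal (8 * C1 n * (3 / 4) ^ k) := by
    intro k
    set ρ := 2 * L * 2 ^ k with hρ
    have hk1 : (1:ℝ) ≤ 2 ^ k := one_le_pow₀ (by norm_num)
    have hρ0 : 0 < ρ := by positivity
    have hρL : 2 * L ≤ ρ := by rw [hρ]; nlinarith
    set D := C1 n * (1 + k) * (L / ρ ^ 2) with hD
    have hD0 : 0 ≤ D := by positivity
    calc _ ≤ ∫⁻ y in S k, ENNReal.ofReal D * ENNReal.ofReal (|f y| * (1 + |b y - avg b (c - 4 * ρ) (c + 4 * ρ)|)) := by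
          apply setLIntegral_mono' (hSm k)
          intro y hy
          rw [← ENNReal.ofReal_mul hD0]
          apply ENNReal.ofReal_le_ofReal
          have := ring_pt hb ha hL hx hz hza k hρ hy.1 hy.2
          calc _ ≤ (D * (1 + |b y - avg b (c - 4 * ρ) (c + 4 * ρ)|)) * |f y| := by gcongr
            _ = _ := by ring
      _ = ENNReal.ofReal D * ∫⁻ y in S k, ENNReal.ofReal (|f y| * (1 + |b y - avg b (c - 4 * ρ) (c + 4 * ρ)|)) :=
          lintegral_const_mul' _ _ ENNReal.ofReal_ne_top
      _ ≤ ENNReal.ofReal D * ENNReal.ofReal (8 * ρ) := by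
          apply mul_le_mul_right
          have h1 := Nset_le_of_notMem hzf (u := c - 4 * ρ) (v := c + 4 * ρ) (by linarith [hz.1]) (by linarith [hz.2])
          refine (lintegral_mono_set ?_).trans (h1.trans (ENNReal.ofReal_le_ofReal (by linarith)))
          intro y hy
          have := abs_le.1 hy.2
          exact ⟨by linarith [this.1], by linarith [this.2]⟩
      _ ≤ _ := by
          rw [← ENNReal.ofReal_mul hD0]
          apply ENNReal.ofReal_le_ofReal
          have e : D * (8 * ρ) = 4 * C1 n * ((1 + k) / 2 ^ k) := by
            rw [hD, hρ]; field_simp; ring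
          rw [e]
          have := geo_k k
          calc _ ≤ 4 * C1 n * (2 * (3 / 4) ^ k) := by gcongr
            _ = _ := by ring
  refine (ENNReal.tsum_le_tsum hk).trans ?_
  have hsum : Summable fun k : ℕ => 8 * C1 n * (3 / 4 : ℝ) ^ k :=
    (summable_geometric_of_lt_one (by norm_num) (by norm_num)).mul_left _
  rw [← ENNReal.ofReal_tsum_of_nonneg (fun k => by positivity) hsum, tsum_mul_left,
    tsum_geometric_of_lt_one (by norm_num) (by norm_num)]
  apply ENNReal.ofReal_le_ofReal
  linarith

theorem KK_meas1 {a : ι → ℝ → ℝ} {b : ℝ → ℝ} (hb : IsB b) (ha : ∀ j, LocallyIntegrable (a j) volume) (x : ℝ) :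
    Measurable fun y => KK a b x y :=
  Measurable.comp (g := fun p : ℝ × ℝ => KK a b p.1 p.2) (f := fun y => (x, y)) (KK_meas hb ha) (by fun_prop)

theorem far_meas {a : ι → ℝ → ℝ} {b f : ℝ → ℝ} (hb : IsB b) (ha : ∀ j, LocallyIntegrable (a j) volume) (hf : Measurable f)
    (x c : ℝ) : Measurable fun y => ENNReal.ofReal (|KK a b x y - KK a b c y| * |f y|) := by
  have k1 := KK_meas1 hb ha x
  have k2 := KK_meas1 hb ha c
  have k3 : Measurable fun y => |KK a b x y - KK a b c y| := (k1.sub k2).abs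
  exact (k3.mul hf.abs).ennreal_ofReal

set_option maxHeartbeats 1000000 in
theorem far (ι : Type) [Fintype ι] : ∃ C : ℝ, 0 < C ∧ ∀ (b : ℝ → ℝ), IsB b → ∀ a : ι → ℝ → ℝ,
    (∀ j, LocallyIntegrable (a j) volume) → ∀ f, Nice b f → ∀ c L x z : ℝ, 0 < L → x ∈ Ioo c (c + L) → z ∈ Ioo c (c + L) →
    (∀ j, z ∉ Mset (dm (a j)) 1) → z ∉ Nset b f 1 → ∀ ε, 0 < ε →
    |TK a b ε ({y | 2 * L < |y - c|}.indicator f) x| ≤ |TK a b (max ε (2 * L)) f c| + C := by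
  set n := Fintype.card ι with hn
  have hC := C1_nonneg n
  refine ⟨32 * C1 n + 576 * 24 ^ n, by positivity, ?_⟩
  intro b hb a ha f hf c L x z hL hx hz hza hzf ε hε
  set F := {y | 2 * L < |y - c|} with hF
  have hFm : MeasurableSet F := measurableSet_lt measurable_const (by fun_prop)
  suffices h : |TK a b ε (F.indicator f) x - TK a b (max ε (2 * L)) f c| ≤ 32 * C1 n + 576 * 24 ^ n by
    have := abs_sub_abs_le_abs_sub (TK a b ε (F.indicator f) x) (TK a b (max ε (2 * L)) f c)
    linarith
  unfold TK
  rw [← integral_sub (kk_int hb ha (hf.indicator hFm) hε x) (kk_int hb ha hf (lt_max_of_lt_left hε) c)]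
  have key : ∫⁻ y, ‖kk a b ε x y * F.indicator f y - kk a b (max ε (2 * L)) c y * f y‖ₑ ≤
      ENNReal.ofReal (32 * C1 n + 576 * 24 ^ n) := by
    set Q := Ioo (c - 4 * ε) (c + 4 * ε) with hQ
    set W : ℝ → ℝ≥0∞ := fun y => ENNReal.ofReal (72 * 24 ^ n / ε) * ENNReal.ofReal (|f y| * (1 + |b y - avg b (c - 4 * ε) (c + 4 * ε)|)) with hW
    set Bd := {y | y ∈ F ∧ 2 * ε / 3 ≤ |y - c| ∧ |y - c| ≤ 2 * ε} with hBd
    have hBdm : MeasurableSet Bd := by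
      apply hFm.inter
      exact MeasurableSet.inter (measurableSet_le (f := fun _ => 2 * ε / 3) (g := fun y : ℝ => |y - c|) (by fun_prop) (by fun_prop))
        (measurableSet_le (f := fun y : ℝ => |y - c|) (g := fun _ => 2 * ε) (by fun_prop) (by fun_prop))
    have pt : ∀ y, ‖kk a b ε x y * F.indicator f y - kk a b (max ε (2 * L)) c y * f y‖ₑ ≤
        F.indicator (fun y => ENNReal.ofReal (|KK a b x y - KK a b c y| * |f y|)) y + Bd.indicator W y := by
      intro y
      by_cases hy : y ∈ F
      swap
      · have : ¬ (max ε (2 * L) < |c - y|) := by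
          rw [abs_sub_comm c y]
          intro h
          exact hy ((le_max_right _ _).trans_lt h)
        unfold kk
        rw [if_neg this, Set.indicator_of_notMem hy]
        simp
      rw [Set.indicator_of_mem hy, Set.indicator_of_mem hy]
      have hy' : 2 * L < |y - c| := hy
      have hkc : kk a b (max ε (2 * L)) c y = if ε < |y - c| then KK a b c y else 0 := by
        unfold kk
        rw [abs_sub_comm c y]
        by_cases h : ε < |y - c|
        · rw [if_pos h, if_pos (max_lt h hy')]
        · rw [if_neg h, if_neg (fun h' => h ((le_max_left _ _).trans_lt h'))]
      rw [hkc]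
      unfold kk
      have hxc : |x - c| ≤ L := by rw [abs_of_pos (by linarith [hx.1])]; linarith [hx.2]
      have q1 : |y - c| / 2 ≤ |x - y| := by
        have := abs_sub_abs_le_abs_sub (y - c) (x - c)
        have e : y - c - (x - c) = - (x - y) := by ring
        rw [e, abs_neg] at this
        linarith
      have q2 : |x - y| ≤ 3 * |y - c| / 2 := by
        have := abs_sub (x - c) (y - c)
        have e : x - c - (y - c) = x - y := by ring
        rw [e] at this
        linarith
      -- size on the boundary region
      have size : ∀ w, (w = x ∨ w = c) → y ∈ Bd → ENNReal.ofReal (|KK a b w y| * |f y|) ≤ Bd.indicator W y := by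
        intro w hw hyB
        rw [Set.indicator_of_mem hyB, hW]
        dsimp only
        rw [← ENNReal.ofReal_mul (by positivity)]
        apply ENNReal.ofReal_le_ofReal
        have hLe : L < ε := by linarith [hyB.2.2]
        have b1 := hyB.2.1
        have b2 := abs_le.1 hyB.2.2
        have hwy : ε / 3 ≤ |w - y| := by
          rcases hw with rfl | rfl
          · linarith
          · rw [abs_sub_comm]; linarith
        have hwm : w ∈ Icc (c - 4 * ε) (c + 4 * ε) := by
          rcases hw with rfl | rfl
          · exact ⟨by linarith [hx.1], by linarith [hx.2]⟩
          · exact ⟨by linarith, by linarith⟩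
        have := KK_size hb ha (u := c - 4 * ε) (v := c + 4 * ε) (w := w) (y := y) (by linarith) hwm
          ⟨by linarith [b2.1], by linarith [b2.2]⟩ (by
            intro j
            have := Mset_le_of_notMem (hza j) (u := c - 4 * ε) (v := c + 4 * ε) (by linarith [hz.1]) (by linarith [hz.2])
            rwa [one_mul] at this) (by linarith)
        set β := |b y - avg b (c - 4 * ε) (c + 4 * ε)|
        have hβ : 0 ≤ β := abs_nonneg _
        have h2 : 24 * 24 ^ n * (1 + β) / |w - y| ≤ 24 * 24 ^ n * (1 + β) / (ε / 3) :=
          div_le_div_of_nonneg_left (by positivity) (by positivity) hwy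
        calc _ ≤ (24 * 24 ^ n * (1 + β) / (ε / 3)) * |f y| := by gcongr; exact this.trans h2
          _ = _ := by field_simp; ring
      have en : ∀ t : ℝ, ‖t * f y‖ₑ = ENNReal.ofReal (|t| * |f y|) := by
        intro t
        rw [← abs_mul, ← Real.norm_eq_abs, ofReal_norm_eq_enorm]
      rw [← sub_mul, en]
      by_cases h1 : ε < |x - y| <;> by_cases h2 : ε < |y - c|
      · rw [if_pos h1, if_pos h2]
        exact le_self_add
      · rw [if_pos h1, if_neg h2, sub_zero]
        push Not at h2
        exact (size x (Or.inl rfl) ⟨hy, by linarith, by linarith⟩).trans le_add_self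
      · rw [if_neg h1, if_pos h2, zero_sub, abs_neg]
        push Not at h1
        exact (size c (Or.inr rfl) ⟨hy, by linarith, by linarith⟩).trans le_add_self
      · rw [if_neg h1, if_neg h2]; simp
    refine (lintegral_mono pt).trans ?_
    have hm1 : Measurable (F.indicator (fun y => ENNReal.ofReal (|KK a b x y - KK a b c y| * |f y|))) := by
      exact (far_meas hb ha hf.meas x c).indicator hFm
    rw [lintegral_add_left hm1, lintegral_indicator hFm, lintegral_indicator hBdm,
      ENNReal.ofReal_add (by positivity) (by positivity)]
    refine add_le_add (far_diff hb ha hL hx hz hza hzf) ?_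
    rw [hW, lintegral_const_mul' _ _ ENNReal.ofReal_ne_top]
    by_cases hne : Bd = ∅
    · rw [hne]; simp
    obtain ⟨y0, hy0⟩ := Set.nonempty_iff_ne_empty.2 hne
    have hLe : L < ε := by
      have : 2 * L < |y0 - c| := hy0.1
      linarith [hy0.2.2]
    have h1 := Nset_le_of_notMem hzf (u := c - 4 * ε) (v := c + 4 * ε) (by linarith [hz.1]) (by linarith [hz.2])
    have hsub : Bd ⊆ Ioo (c - 4 * ε) (c + 4 * ε) := by
      intro y hy
      have b2 := abs_le.1 hy.2.2
      exact ⟨by linarith [b2.1], by linarith [b2.2]⟩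
    refine (mul_le_mul_right ((lintegral_mono_set hsub).trans h1) _).trans ?_
    rw [← ENNReal.ofReal_mul (by positivity)]
    apply ENNReal.ofReal_le_ofReal
    apply le_of_eq
    field_simp; ring
  have h2 := (enorm_integral_le_lintegral_enorm (fun y => kk a b ε x y * F.indicator f y - kk a b (max ε (2 * L)) c y * f y)).trans key
  rw [← ofReal_norm_eq_enorm, Real.norm_eq_abs] at h2
  exact (ENNReal.ofReal_le_ofReal_iff (by positivity)).1 h2

end CCA

end

section
namespace CCA
variable {ι : Type} [Fintype ι]

def ES (a : ι → ℝ → ℝ) (b f : ℝ → ℝ) (lam : ℝ) : Set ℝ := {x | ∃ ε, 0 < ε ∧ lam < |TK a b ε f x|}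

def Bad (a : ι → ℝ → ℝ) (b f : ℝ → ℝ) (s : ℝ) : Set ℝ := Nset b f s ∪ ⋃ j, Mset (dm (a j)) s

theorem isOpen_ES {a : ι → ℝ → ℝ} {b f : ℝ → ℝ} (hb : IsB b) (ha : ∀ j, LocallyIntegrable (a j) volume)
    (hf : Nice b f) (lam : ℝ) : IsOpen (ES a b f lam) := by
  have : ES a b f lam = ⋃ ε : ℝ, ⋃ _ : 0 < ε, {x | lam < |TK a b ε f x|} := by
    ext x; simp [ES]
  rw [this]
  refine isOpen_iUnion fun ε => isOpen_iUnion fun hε => ?_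
  exact isOpen_lt continuous_const (TK_cont hb ha hf hε).abs

/-- one component -/
theorem comp_est (ι : Type) [Fintype ι] {η : ℝ} (hη : 0 < η) (hη1 : η ≤ 1) : ∃ l0 : ℝ, 0 < l0 ∧
    ∀ b : ℝ → ℝ, IsB b → ∀ a : ι → ℝ → ℝ, (∀ j, LocallyIntegrable (a j) volume) → ∀ f, Nice b f →
    ∀ lam, l0 ≤ lam → ∀ p q : ℝ, p < q → p ∉ ES a b f lam →
    volume ((Ioo p q ∩ ES a b f (2 * lam)) \ Bad a b f 1) ≤ ENNReal.ofReal (η * (q - p)) := by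
  obtain ⟨Γ, hΓ, hN⟩ := near ι (η := η / 6) (by positivity) (by linarith)
  obtain ⟨C, hC, hFar⟩ := far ι
  refine ⟨Γ + C, by positivity, ?_⟩
  intro b hb a ha f hf lam hlam p q hpq hp
  by_cases hne : ((Ioo p q ∩ ES a b f (2 * lam)) \ Bad a b f 1) = ∅
  · rw [hne]; simp
  obtain ⟨z, ⟨hz, _⟩, hzB⟩ := Set.nonempty_iff_ne_empty.2 hne
  set L := q - p with hL
  have hL0 : 0 < L := by linarith
  have hq : q = p + L := by linarith
  rw [hq] at hz
  simp only [Bad, mem_union, mem_iUnion, not_or, not_exists] at hzB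
  obtain ⟨hzf, hza⟩ := hzB
  set F := {y | 2 * L < |y - p|} with hF
  have hFm : MeasurableSet F := measurableSet_lt measurable_const (by fun_prop)
  have hn := hN b hb a ha (p - 3 * L) (p + 3 * L) (by linarith) (Fᶜ.indicator f) (hf.meas.indicator hFm.compl)
    (by
      intro y hy
      apply Set.indicator_of_notMem
      intro h
      apply hy
      have : |y - p| ≤ 2 * L := not_lt.1 h
      have := abs_le.1 this
      exact ⟨by linarith [this.1], by linarith [this.2]⟩)
    (by
      intro j
      have := Mset_le_of_notMem (hza j) (u := p - 3 * L) (v := p + 3 * L) (by linarith [hz.1]) (by linarith [hz.2])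
      rwa [one_mul] at this)
    (by
      have h1 := Nset_le_of_notMem hzf (u := p - 3 * L) (v := p + 3 * L) (by linarith [hz.1]) (by linarith [hz.2])
      rw [one_mul] at h1
      refine le_trans ?_ h1
      rw [← lintegral_indicator measurableSet_Ioo]
      apply lintegral_mono
      intro y
      by_cases h : y ∈ F
      · have : Fᶜ.indicator f y = 0 := Set.indicator_of_notMem (by simpa using h) _
        simp [this]
      · have hy : y ∈ Ioo (p - 3 * L) (p + 3 * L) := by
          have : |y - p| ≤ 2 * L := not_lt.1 h
          have := abs_le.1 this
          exact ⟨by linarith [this.1], by linarith [this.2]⟩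
        have h2 : Fᶜ.indicator f y = f y := Set.indicator_of_mem (by simpa using h) _
        simp only [Set.indicator_of_mem hy, h2, le_refl])
  refine (measure_mono ?_).trans (hn.trans (le_of_eq (by congr 1; ring)))
  rintro x ⟨⟨hx, ε, hε, hxε⟩, _⟩
  rw [hq] at hx
  refine ⟨⟨by linarith [hx.1], by linarith [hx.2]⟩, ε, hε, ?_⟩
  have h1 := hFar b hb a ha f hf p L x z hL0 hx hz hza hzf ε hε
  have h2 : |TK a b (max ε (2 * L)) f p| ≤ lam := by
    by_contra hcon
    push Not at hcon
    exact hp ⟨_, lt_max_of_lt_left hε, hcon⟩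
  have h3 := TK_add hb ha (hf.indicator hFm.compl) (hf.indicator hFm) hε x
  have e : (fun y => Fᶜ.indicator f y + F.indicator f y) = f := by
    ext y
    have := congrFun (Set.indicator_compl_add_self F f) y
    simpa using this
  rw [e] at h3
  have h4 := abs_add_le (TK a b ε (Fᶜ.indicator f) x) (TK a b ε (F.indicator f) x)
  rw [← h3] at h4
  linarith

theorem good_lam (ι : Type) [Fintype ι] {η : ℝ} (hη : 0 < η) (hη1 : η ≤ 1) : ∃ l0 : ℝ, 0 < l0 ∧
    ∀ b : ℝ → ℝ, IsB b → ∀ a : ι → ℝ → ℝ, (∀ j, LocallyIntegrable (a j) volume) → ∀ f, Nice b f →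
    ∀ lam, l0 ≤ lam → volume (ES a b f lam) < ∞ →
    volume (ES a b f (2 * lam)) ≤ volume (Bad a b f 1) + ENNReal.ofReal η * volume (ES a b f lam) := by
  obtain ⟨l0, hl0, H⟩ := comp_est ι hη hη1
  refine ⟨l0, hl0, ?_⟩
  intro b hb a ha f hf lam hlam hfin
  obtain ⟨p, q, hd, hU, hpq⟩ := components (isOpen_ES hb ha hf lam) hfin
  have hsub : ES a b f (2 * lam) ⊆ ES a b f lam := by
    rintro x ⟨ε, hε, h⟩
    exact ⟨ε, hε, by linarith⟩
  have hcov : ES a b f (2 * lam) ⊆ Bad a b f 1 ∪ ⋃ n, ((Ioo (p n) (q n) ∩ ES a b f (2 * lam)) \ Bad a b f 1) := by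
    intro x hx
    by_cases hB : x ∈ Bad a b f 1
    · exact Or.inl hB
    · right
      have := hsub hx
      rw [hU, mem_iUnion] at this
      obtain ⟨n, hn⟩ := this
      exact mem_iUnion.2 ⟨n, ⟨hn, hx⟩, hB⟩
  refine (measure_mono hcov).trans ((measure_union_le _ _).trans ?_)
  gcongr
  refine (measure_iUnion_le _).trans ?_
  have e : volume (ES a b f lam) = ∑' n, volume (Ioo (p n) (q n)) := by
    conv_lhs => rw [hU]
    exact measure_iUnion hd fun n => measurableSet_Ioo
  rw [e, ← ENNReal.tsum_mul_left]
  apply ENNReal.tsum_le_tsum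
  intro n
  by_cases h : p n < q n
  · have := H b hb a ha f hf lam hlam (p n) (q n) h (hpq n h).1
    rwa [ENNReal.ofReal_mul hη.le, ← Real.volume_Ioo] at this
  · rw [Ioo_eq_empty h]; simp

/-- a priori bound outside of the support -/
theorem apriori {a : ι → ℝ → ℝ} {b f : ℝ → ℝ} (hb : IsB b) (ha : ∀ j, LocallyIntegrable (a j) volume)
    {R : ℝ} (hR : 0 < R) (hs : ∀ y, R < |y| → f y = 0) {lam : ℝ}
    (hlam : 8 * (24 * 24 ^ Fintype.card ι) ≤ lam) : ES a b f lam ⊆ Icc (-(2 * R)) (2 * R) ∪ Bad a b f 1 := by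
  set n := Fintype.card ι with hn
  rintro x ⟨ε, hε, hx⟩
  by_contra hcon
  simp only [Bad, mem_union, mem_iUnion, not_or, not_exists] at hcon
  obtain ⟨hxR, hxf, hxa⟩ := hcon
  have hxR : 2 * R < |x| := by
    by_contra h
    push Not at h
    exact hxR (abs_le.1 h)
  have hx0 : 0 < |x| := by linarith
  have hxx := abs_le.1 (le_refl |x|)
  set u := -(2 * |x|) with hu
  set v := 2 * |x| with hv
  have h1 := Nset_le_of_notMem hxf (u := u) (v := v) (by linarith [hxx.1]) (by linarith [hxx.2])
  have key : ∫⁻ y, ‖kk a b ε x y * f y‖ₑ ≤ ENNReal.ofReal (8 * (24 * 24 ^ n)) := by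
    calc _ ≤ ∫⁻ y in Ioo u v, ENNReal.ofReal (24 * 24 ^ n / (|x| / 2)) * ENNReal.ofReal (|f y| * (1 + |b y - avg b u v|)) := by
          rw [← lintegral_indicator measurableSet_Ioo]
          apply lintegral_mono
          intro y
          by_cases hy : R < |y|
          · simp [hs y hy]
          push Not at hy
          have hyy := abs_le.1 hy
          have hym : y ∈ Ioo u v := ⟨by linarith [hyy.1], by linarith [hyy.2]⟩
          dsimp only
          rw [Set.indicator_of_mem hym, ← ENNReal.ofReal_mul (by positivity), ← ofReal_norm_eq_enorm, Real.norm_eq_abs, abs_mul]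
          apply ENNReal.ofReal_le_ofReal
          have hxy : |x| / 2 ≤ |x - y| := by
            have := abs_sub_abs_le_abs_sub x y
            linarith
          have hK := KK_size hb ha (u := u) (v := v) (w := x) (y := y) (by linarith) ⟨by linarith [hxx.1], by linarith [hxx.2]⟩
            ⟨hym.1.le, hym.2.le⟩ (by
              intro j
              have := Mset_le_of_notMem (hxa j) (u := u) (v := v) (by linarith [hxx.1]) (by linarith [hxx.2])
              rwa [one_mul] at this) (by linarith)
          set β := |b y - avg b u v|
          have hβ : 0 ≤ β := abs_nonneg _
          have hkk : |kk a b ε x y| ≤ 24 * 24 ^ n * (1 + β) / (|x| / 2) := by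
            unfold kk
            split_ifs
            · exact hK.trans (div_le_div_of_nonneg_left (by positivity) (by positivity) hxy)
            · rw [abs_zero]; positivity
          calc _ ≤ (24 * 24 ^ n * (1 + β) / (|x| / 2)) * |f y| := by gcongr
            _ = _ := by ring
      _ = ENNReal.ofReal (24 * 24 ^ n / (|x| / 2)) * ∫⁻ y in Ioo u v, ENNReal.ofReal (|f y| * (1 + |b y - avg b u v|)) :=
          lintegral_const_mul' _ _ ENNReal.ofReal_ne_top
      _ ≤ ENNReal.ofReal (24 * 24 ^ n / (|x| / 2)) * ENNReal.ofReal (1 * (v - u)) := mul_le_mul_right h1 _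
      _ = _ := by
          rw [← ENNReal.ofReal_mul (by positivity)]
          congr 1
          rw [hu, hv]; field_simp; ring
  have h2 := (enorm_integral_le_lintegral_enorm (fun y => kk a b ε x y * f y)).trans key
  rw [← ofReal_norm_eq_enorm, Real.norm_eq_abs] at h2
  have h3 := (ENNReal.ofReal_le_ofReal_iff (by positivity)).1 h2
  unfold TK at hx
  linarith

end CCA

end

section
namespace CCA
variable {ι : Type} [Fintype ι]

theorem AD_mul (s : ℝ) (g : ℝ → ℝ) (x y : ℝ) : AD (fun t => s * g t) x y = s * AD g x y := by
  unfold AD; exact intervalIntegral.integral_const_mul s g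

theorem kk_mul (a : ι → ℝ → ℝ) (b : ℝ → ℝ) (s ε x y : ℝ) :
    kk (fun j t => s * a j t) b ε x y = s ^ Fintype.card ι * kk a b ε x y := by
  unfold kk KK
  split_ifs
  · simp only [AD_mul, mul_div_assoc]
    rw [Finset.prod_mul_distrib, Finset.prod_const, Finset.card_univ]
    ring
  · simp

theorem TK_mul (a : ι → ℝ → ℝ) (b f : ℝ → ℝ) (s t ε x : ℝ) :
    TK (fun j y => s * a j y) b ε (fun y => t * f y) x = s ^ Fintype.card ι * t * TK a b ε f x := by
  unfold TK
  rw [← integral_const_mul]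
  congr 1; ext y
  rw [kk_mul]; ring

noncomputable def XX (a : ι → ℝ → ℝ) (f : ℝ → ℝ) : ℝ≥0∞ := (∑ j, dm (a j) univ) + Phi f

theorem dm_mul (s : ℝ) (g : ℝ → ℝ) : dm (fun y => s * g y) univ = ENNReal.ofReal |s| * dm g univ := by
  rw [dm_apply _ MeasurableSet.univ, dm_apply _ MeasurableSet.univ, ← lintegral_const_mul' _ _ ENNReal.ofReal_ne_top]
  congr 1; ext y
  rw [abs_mul, ENNReal.ofReal_mul (abs_nonneg _)]

theorem XX_mul (a : ι → ℝ → ℝ) (f : ℝ → ℝ) {s : ℝ} (hs : 1 ≤ s) :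
    XX (fun j y => s * a j y) (fun y => s * f y) ≤ ENNReal.ofReal (s ^ 2) * XX a f := by
  unfold XX
  rw [mul_add, Finset.mul_sum]
  refine add_le_add (Finset.sum_le_sum fun j _ => ?_) (Phi_mul_le hs f)
  rw [dm_mul]
  gcongr
  rw [abs_of_nonneg (by linarith)]
  nlinarith

theorem vol_Bad_le {b : ℝ → ℝ} (hb : IsB b) (a : ι → ℝ → ℝ) (f : ℝ → ℝ) :
    volume (Bad a b f 1) ≤ ENNReal.ofReal 7010 * XX a f := by
  unfold Bad XX
  refine (measure_union_le _ _).trans ?_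
  rw [mul_add, add_comm]
  refine add_le_add ?_ ?_
  · refine (measure_iUnion_le _).trans ?_
    rw [tsum_fintype, Finset.mul_sum]
    refine Finset.sum_le_sum fun j _ => ?_
    refine (vol_Mset_le _ one_pos).trans ?_
    gcongr
    norm_num
  · have := vol_Nset_le hb f one_pos le_rfl
    simpa using this

theorem iter_real {d : ℕ → ℝ} {M R : ℝ} (hM : 0 ≤ M) (h1 : ∀ k, d k ≤ 4 * 4 ^ k * M + d (k + 1) / 16)
    (h2 : ∀ k, d k ≤ R + 4 ^ k * M) : d 0 ≤ 8 * M := by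
  have key : ∀ j k : ℕ, d k ≤ 8 * 4 ^ k * M + (1 / 16) ^ j * (R + 4 ^ (k + j) * M) := by
    intro j
    induction j with
    | zero =>
      intro k
      have := h2 k
      have : 0 ≤ 8 * 4 ^ k * M := by positivity
      simp; linarith [h2 k]
    | succ j ih =>
      intro k
      have := ih (k + 1)
      have h3 := h1 k
      have e : (1 / 16 : ℝ) ^ (j + 1) * (R + 4 ^ (k + (j + 1)) * M) = ((1 / 16) ^ j * (R + 4 ^ (k + 1 + j) * M)) / 16 := by
        rw [show k + 1 + j = k + (j + 1) by ring]; ring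
      rw [e]
      have e2 : (4:ℝ) ^ (k + 1) = 4 * 4 ^ k := by ring
      rw [e2] at this
      have : 0 ≤ 4 ^ k * M := by positivity
      linarith
  have hl : Tendsto (fun j : ℕ => 8 * M + ((1 / 16 : ℝ) ^ j * R + (1 / 4) ^ j * M)) atTop (nhds (8 * M + (0 * R + 0 * M))) := by
    refine tendsto_const_nhds.add (Tendsto.add ?_ ?_)
    · exact (tendsto_pow_atTop_nhds_zero_of_lt_one (by norm_num) (by norm_num)).mul_const _
    · exact (tendsto_pow_atTop_nhds_zero_of_lt_one (by norm_num) (by norm_num)).mul_const _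
  have := ge_of_tendsto' hl (b := d 0) (by
    intro j
    have := key j 0
    have e : (1 / 16 : ℝ) ^ j * (4 ^ (0 + j) * M) = (1 / 4) ^ j * M := by
      rw [zero_add, ← mul_assoc, ← mul_pow]; norm_num
    rw [mul_add, e] at this
    simpa using this)
  simpa using this

theorem weak_star (ι : Type) [Fintype ι] : ∃ C : ℝ, 0 < C ∧ ∀ b : ℝ → ℝ, IsB b → ∀ a : ι → ℝ → ℝ,
    (∀ j, LocallyIntegrable (a j) volume) → ∀ f, Nice b f → volume (ES a b f 1) ≤ ENNReal.ofReal C * XX a f := by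
  obtain ⟨l0, hl0, H⟩ := good_lam ι (η := 1 / 16) (by norm_num) (by norm_num)
  set n := Fintype.card ι with hn
  set l := max (max l0 (8 * (24 * 24 ^ n))) 1 with hl
  have hl1 : 1 ≤ l := le_max_right _ _
  have hl2 : l0 ≤ l := (le_max_left _ _).trans (le_max_left _ _)
  have hl3 : 8 * (24 * 24 ^ n) ≤ l := (le_max_right _ _).trans (le_max_left _ _)
  refine ⟨8 * 7010 * l ^ 2, by positivity, ?_⟩
  have main : ∀ b : ℝ → ℝ, IsB b → ∀ a : ι → ℝ → ℝ,
    (∀ j, LocallyIntegrable (a j) volume) → ∀ f, Nice b f → volume (ES a b f l) ≤ ENNReal.ofReal (8 * 7010) * XX a f := by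
    intro b hb a ha f hf
    by_cases hX : XX a f = ∞
    · rw [hX, ENNReal.mul_top (by simp)]; exact le_top
    obtain ⟨R, hR, hs⟩ := hf.supp
    set ak : ℕ → ι → ℝ → ℝ := fun k j y => 2 ^ k * a j y with hak
    set fk : ℕ → ℝ → ℝ := fun k y => 2 ^ k * f y with hfk
    have hakl : ∀ k j, LocallyIntegrable (ak k j) volume := fun k j => by
      have := (ha j).smul ((2:ℝ) ^ k)
      exact this
    have hfkn : ∀ k, Nice b (fk k) := fun k => hf.const_mul _
    have hXk : ∀ k, XX (ak k) (fk k) ≤ ENNReal.ofReal (4 ^ k) * XX a f := by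
      intro k
      have := XX_mul a f (s := 2 ^ k) (one_le_pow₀ (by norm_num))
      have e : ((2:ℝ) ^ k) ^ 2 = 4 ^ k := by rw [← pow_mul, mul_comm, pow_mul]; norm_num
      rwa [e] at this
    have hBk : ∀ k, volume (Bad (ak k) b (fk k) 1) ≤ ENNReal.ofReal (4 ^ k * (7010 * (XX a f).toReal)) := by
      intro k
      refine (vol_Bad_le hb _ _).trans ((mul_le_mul_right (hXk k) _).trans (le_of_eq ?_))
      conv_lhs => rw [← ENNReal.ofReal_toReal hX]
      rw [← ENNReal.ofReal_mul (by positivity), ← ENNReal.ofReal_mul (by positivity)]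
      congr 1; ring
    set M := 7010 * (XX a f).toReal with hM
    have hM0 : 0 ≤ M := by positivity
    set D : ℕ → ℝ≥0∞ := fun k => volume (ES (ak k) b (fk k) l) with hD
    have hD2 : ∀ k, D k ≤ ENNReal.ofReal (4 * R + 4 ^ k * M) := by
      intro k
      refine (measure_mono (apriori hb (hakl k) hR (fun y hy => by simp [hfk, hs y hy]) hl3)).trans ?_
      refine (measure_union_le _ _).trans ?_
      rw [ENNReal.ofReal_add (by positivity) (by positivity)]
      refine add_le_add ?_ (hBk k)
      rw [Real.volume_Icc]
      apply ENNReal.ofReal_le_ofReal; linarith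
    have hDf : ∀ k, D k < ∞ := fun k => (hD2 k).trans_lt ENNReal.ofReal_lt_top
    have hD1 : ∀ k, D k ≤ ENNReal.ofReal (4 * 4 ^ k * M) + ENNReal.ofReal (1 / 16) * D (k + 1) := by
      intro k
      have hsub : ES (ak k) b (fk k) l ⊆ ES (ak (k + 1)) b (fk (k + 1)) (2 * l) := by
        rintro x ⟨ε, hε, hx⟩
        refine ⟨ε, hε, ?_⟩
        have e := TK_mul (ak k) b (fk k) 2 2 ε x
        have e1 : (fun j y => 2 * ak k j y) = ak (k + 1) := by
          ext j y; simp only [hak]; ring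
        have e2 : (fun y => 2 * fk k y) = fk (k + 1) := by
          ext y; simp only [hfk]; ring
        rw [e1, e2] at e
        rw [e, abs_mul, abs_of_pos (by positivity)]
        have : (1:ℝ) ≤ 2 ^ Fintype.card ι := one_le_pow₀ (by norm_num)
        nlinarith [abs_nonneg (TK (ak k) b ε (fk k) x)]
      refine (measure_mono hsub).trans ((H b hb _ (hakl (k + 1)) _ (hfkn (k + 1)) l hl2 (hDf (k + 1))).trans ?_)
      refine add_le_add ((hBk (k + 1)).trans (le_of_eq ?_)) le_rfl
      congr 1; ring
    have hfin := iter_real (d := fun k => (D k).toReal) (M := M) (R := 4 * R) hM0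
      (by
        intro k
        have := hD1 k
        rw [← ENNReal.ofReal_toReal (hDf (k + 1)).ne, ← ENNReal.ofReal_mul (by norm_num),
          ← ENNReal.ofReal_add (by positivity) (by positivity)] at this
        have := ENNReal.toReal_le_of_le_ofReal (by positivity) this
        linarith)
      (fun k => ENNReal.toReal_le_of_le_ofReal (by positivity) (hD2 k))
    have e0 : ES a b f l = ES (ak 0) b (fk 0) l := by simp [hak, hfk]
    rw [e0]
    change D 0 ≤ _
    rw [← ENNReal.ofReal_toReal (hDf 0).ne, ← ENNReal.ofReal_toReal hX, ← ENNReal.ofReal_mul (by norm_num)]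
    apply ENNReal.ofReal_le_ofReal
    linarith
  intro b hb a ha f hf
  have h1 := main b hb a ha _ (hf.const_mul l)
  have hsub : ES a b f 1 ⊆ ES a b (fun y => l * f y) l := by
    rintro x ⟨ε, hε, hx⟩
    refine ⟨ε, hε, ?_⟩
    have e := TK_mul a b f 1 l ε x
    simp only [one_mul, one_pow] at e
    rw [show (fun j y => a j y) = a from rfl] at e
    rw [e, abs_mul, abs_of_pos (by linarith)]
    nlinarith
  refine (measure_mono hsub).trans (h1.trans ?_)
  rw [ENNReal.ofReal_mul (by norm_num : (0:ℝ) ≤ 8 * 7010), mul_assoc]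
  apply mul_le_mul_right
  unfold XX
  rw [mul_add]
  refine add_le_add ?_ (Phi_mul_le hl1 f)
  conv_lhs => rw [← one_mul (∑ j, dm (a j) univ)]
  gcongr
  rw [ENNReal.one_le_ofReal]
  exact one_le_pow₀ hl1

end CCA

end

section
namespace CCA
variable {ι : Type} [Fintype ι]

def LipC (g : ℝ → ℝ) : Prop :=
  HasCompactSupport g ∧ ∃ K : ℝ, 1 ≤ K ∧ (∀ x, |g x| ≤ K) ∧ ∀ x y, |g x - g y| ≤ K * |x - y|

theorem LipC.cont {g : ℝ → ℝ} (h : LipC g) : Continuous g := by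
  obtain ⟨_, K, hK, _, hl⟩ := h
  have : LipschitzWith (Real.toNNReal K) g := by
    apply LipschitzWith.of_dist_le_mul
    intro x y
    rw [Real.dist_eq, Real.dist_eq, Real.coe_toNNReal _ (by linarith)]
    exact hl x y
  exact this.continuous

theorem LipC.integrable {g : ℝ → ℝ} (h : LipC g) : Integrable g := h.cont.integrable_of_hasCompactSupport h.1

theorem slope_est {g : ℝ → ℝ} (hg : Continuous g) {K : ℝ} (hK : ∀ x, |g x| ≤ K) (hl : ∀ x y, |g x - g y| ≤ K * |x - y|)
    {x y : ℝ} (hxy : x ≠ y) : |AD g x y / (x - y)| ≤ K ∧ |AD g x y / (x - y) - g x| ≤ K * |x - y| := by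
  have hne : x - y ≠ 0 := sub_ne_zero.2 hxy
  have hp : 0 < |x - y| := abs_pos.2 hne
  have hK0 : 0 ≤ K := (abs_nonneg _).trans (hK x)
  constructor
  · rw [abs_div, div_le_iff₀ hp]
    exact intervalIntegral.norm_integral_le_of_norm_le_const (f := g) (a := y) (b := x) (C := K) (fun t _ => hK t)
  · have e : AD g x y / (x - y) - g x = AD (fun t => g t - g x) x y / (x - y) := by
      rw [AD_sub_const hg.locallyIntegrable]; field_simp
    rw [e, abs_div, div_le_iff₀ hp]
    refine intervalIntegral.norm_integral_le_of_norm_le_const (f := fun t => g t - g x) (a := y) (b := x) (C := K * |x - y|) ?_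
    intro t ht
    rw [Real.norm_eq_abs]
    refine (hl t x).trans ?_
    apply mul_le_mul_of_nonneg_left _ hK0
    rw [mem_uIoc] at ht
    rcases ht with h | h
    · rw [abs_of_nonpos (by linarith), abs_of_nonneg (by linarith)]; linarith
    · rw [abs_of_nonneg (by linarith), abs_of_nonpos (by linarith)]; linarith

def CVat (a : ι → ℝ → ℝ) (b f : ℝ → ℝ) (x : ℝ) : Prop :=
  ∃ l, Tendsto (fun ε => TK a b ε f x) (nhdsWithin 0 (Ioi 0)) (nhds l)

theorem nice_of_bdd {b f : ℝ → ℝ} (hb : IsB b) (hf : Measurable f) {K R : ℝ} (hK : ∀ x, |f x| ≤ K) (hR : 0 < R)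
    (hs : ∀ y, R < |y| → f y = 0) : Nice b f := by
  have hsupp : Function.support f ⊆ Icc (-R) R := by
    intro y hy
    by_contra h
    apply hy
    apply hs
    by_contra h'
    exact h (abs_le.1 (not_lt.1 h'))
  have hsupp2 : Function.support (fun y => b y * f y) ⊆ Icc (-R) R := by
    intro y hy
    apply hsupp
    intro h
    apply hy
    simp [h]
  refine ⟨hf, ?_, ?_, R, hR, hs⟩
  · rw [← integrableOn_iff_integrable_of_support_subset hsupp]
    exact Measure.integrableOn_of_bounded (M := K) (by simp) hf.aestronglyMeasurable (ae_of_all _ hK)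
  · rw [← integrableOn_iff_integrable_of_support_subset hsupp2]
    have h1 : IntegrableOn b (Icc (-R) R) := hb.loc.integrableOn_isCompact isCompact_Icc
    exact Integrable.mul_bdd (c := K) h1 hf.aestronglyMeasurable (ae_of_all _ hK)

theorem LipC.nice {b g : ℝ → ℝ} (hb : IsB b) (h : LipC g) : Nice b g := by
  obtain ⟨R, hR⟩ := h.1.isCompact.isBounded.subset_closedBall 0
  obtain ⟨K, hK, hb1, _⟩ := h.2
  refine nice_of_bdd hb h.cont.measurable hb1 (R := max R 1) (by positivity) ?_
  intro y hy
  by_contra hne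
  have := hR (subset_tsupport _ hne)
  rw [Metric.mem_closedBall, Real.dist_eq, sub_zero] at this
  have := le_max_left R 1
  linarith

/-- primitive of the linear kernel -/
theorem fund_int {A b : ℝ → ℝ} (hA : ∀ x, HasDerivAt A (b x) x) (hb : LocallyIntegrable b volume) (x : ℝ) {u v : ℝ} (huv : u ≤ v)
    (hx : x ∉ Icc u v) : IntervalIntegrable (fun y => (AD b x y / (x - y) - b y) / (x - y)) volume u v ∧
      ∫ y in u..v, (AD b x y / (x - y) - b y) / (x - y) = (A x - A v) / (x - v) - (A x - A u) / (x - u) := by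
  have hAD : ∀ y, AD b x y = A x - A y := fun y =>
    intervalIntegral.integral_eq_sub_of_hasDerivAt (fun t _ => hA t) (li_ii hb y x)
  have hAc : Continuous A := continuous_iff_continuousAt.2 fun t => (hA t).continuousAt
  have hne : ∀ y ∈ uIcc u v, x - y ≠ 0 := by
    intro y hy h
    rw [uIcc_of_le huv] at hy
    exact hx (by rw [sub_eq_zero.1 h]; exact hy)
  have hi : IntervalIntegrable (fun y => (AD b x y / (x - y) - b y) / (x - y)) volume u v := by
    have h1 : IntervalIntegrable (fun y => (A x - A y) / (x - y) ^ 2) volume u v := by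
      apply ContinuousOn.intervalIntegrable
      apply ContinuousOn.div (by fun_prop) (by fun_prop)
      intro y hy
      exact pow_ne_zero 2 (hne y hy)
    have h2 : IntervalIntegrable (fun y => b y * (x - y)⁻¹) volume u v := by
      apply (li_ii hb u v).mul_continuousOn
      apply ContinuousOn.inv₀ (by fun_prop)
      exact hne
    have h3 : IntervalIntegrable (fun y => (A x - A y) / (x - y) ^ 2 - b y * (x - y)⁻¹) volume u v := h1.sub h2
    refine h3.congr ?_
    intro y hy
    dsimp only
    rw [hAD]
    have := hne y (uIoc_subset_uIcc hy)
    field_simp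
  refine ⟨hi, ?_⟩
  apply intervalIntegral.integral_eq_sub_of_hasDerivAt (f := fun y => (A x - A y) / (x - y)) _ hi
  intro y hy
  have := ((hA y).const_sub (A x)).div ((hasDerivAt_id y).const_sub x) (hne y hy)
  refine this.congr_deriv ?_
  have := hne y hy
  rw [hAD]
  simp only [id]
  field_simp
  ring

theorem ring_set (x ε r : ℝ) (hε : 0 < ε) (hr : 0 < r) : {y : ℝ | ε < |x - y| ∧ |x - y| ≤ r} = Ico (x - r) (x - ε) ∪ Ioc (x + ε) (x + r) := by
  ext y
  simp only [mem_setOf_eq, mem_union, mem_Ico, mem_Ioc]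
  constructor
  · rintro ⟨h1, h2⟩
    rcases abs_cases (x - y) with ⟨h, _⟩ | ⟨h, _⟩
    · left; constructor <;> linarith
    · right; constructor <;> linarith
  · rintro (⟨h1, h2⟩ | ⟨h1, h2⟩)
    · rw [abs_of_pos (by linarith)]; constructor <;> linarith
    · rw [abs_of_neg (by linarith)]; constructor <;> linarith

theorem ring_int {A b : ℝ → ℝ} (hA : ∀ x, HasDerivAt A (b x) x) (hb : LocallyIntegrable b volume) (x : ℝ) {ε r : ℝ}
    (hε : 0 < ε) (hr : ε < r) :
    IntegrableOn (fun y => (AD b x y / (x - y) - b y) / (x - y)) {y | ε < |x - y| ∧ |x - y| ≤ r} ∧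
    ∫ y in {y | ε < |x - y| ∧ |x - y| ≤ r}, (AD b x y / (x - y) - b y) / (x - y) =
      ((A x - A (x - ε)) / ε - (A x - A (x - r)) / r) + ((A x - A (x + r)) / (-r) - (A x - A (x + ε)) / (-ε)) := by
  rw [ring_set x ε r hε (hε.trans hr)]
  obtain ⟨i1, e1⟩ := fund_int hA hb x (u := x - r) (v := x - ε) (by linarith) (fun h => by linarith [h.2])
  obtain ⟨i2, e2⟩ := fund_int hA hb x (u := x + ε) (v := x + r) (by linarith) (fun h => by linarith [h.1])
  rw [intervalIntegrable_iff_integrableOn_Ico_of_le (by linarith)] at i1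
  rw [intervalIntegrable_iff_integrableOn_Ioc_of_le (by linarith)] at i2
  refine ⟨i1.union i2, ?_⟩
  rw [setIntegral_union _ measurableSet_Ioc i1 i2]
  · rw [integral_Ico_eq_integral_Ioc, ← intervalIntegral.integral_of_le (by linarith), e1,
      ← intervalIntegral.integral_of_le (by linarith), e2]
    congr 2
    · rw [show x - (x - ε) = ε by ring]
    · rw [show x - (x - r) = r by ring]
    · rw [show x - (x + r) = -r by ring]
    · rw [show x - (x + ε) = -ε by ring]
  · rw [Set.disjoint_left]
    intro y h1 h2
    linarith [h1.2, h2.1]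

theorem ring_tendsto {A b : ℝ → ℝ} (hA : ∀ x, HasDerivAt A (b x) x) (hb : LocallyIntegrable b volume) (x : ℝ) {r : ℝ}
    (hr : 0 < r) : ∃ l, Tendsto (fun ε => ∫ y in {y | ε < |x - y| ∧ |x - y| ≤ r}, (AD b x y / (x - y) - b y) / (x - y))
      (nhdsWithin 0 (Ioi 0)) (nhds l) := by
  have hs := hasDerivAt_iff_tendsto_slope_zero.1 (hA x)
  have t1 : Tendsto (fun ε : ℝ => (A x - A (x + ε)) / (-ε)) (nhdsWithin 0 (Ioi 0)) (nhds (b x)) := by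
    have : Tendsto (fun ε : ℝ => ε⁻¹ • (A (x + ε) - A x)) (nhdsWithin 0 (Ioi 0)) (nhds (b x)) :=
      hs.mono_left (nhdsWithin_mono _ fun y hy => ne_of_gt hy)
    refine this.congr ?_
    intro ε
    rw [smul_eq_mul, div_eq_mul_inv, inv_neg]; ring
  have t2 : Tendsto (fun ε : ℝ => (A x - A (x - ε)) / ε) (nhdsWithin 0 (Ioi 0)) (nhds (b x)) := by
    have hneg : Tendsto (fun ε : ℝ => -ε) (nhdsWithin 0 (Ioi 0)) (nhdsWithin 0 {0}ᶜ) := by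
      apply tendsto_nhdsWithin_of_tendsto_nhds_of_eventually_within
      · have : Tendsto (fun ε : ℝ => -ε) (nhds 0) (nhds (-0)) := tendsto_neg 0
        rw [neg_zero] at this
        exact this.mono_left nhdsWithin_le_nhds
      · filter_upwards [self_mem_nhdsWithin] with ε hε
        simpa using ne_of_gt hε
    refine (hs.comp hneg).congr ?_
    intro ε
    simp only [Function.comp, smul_eq_mul]
    rw [div_eq_mul_inv, inv_neg, ← sub_eq_add_neg]; ring
  have t3 := (t2.sub (tendsto_const_nhds (x := (A x - A (x - r)) / r))).add
    ((tendsto_const_nhds (x := (A x - A (x + r)) / (-r))).sub t1)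
  refine ⟨_, t3.congr' ?_⟩
  filter_upwards [Ioo_mem_nhdsGT hr] with ε hε
  exact ((ring_int hA hb x hε.1 hε.2).2).symm

end CCA

end

section
namespace CCA
variable {ι : Type} [Fintype ι]

theorem base_cv {A b : ℝ → ℝ} (hA : ∀ x, HasDerivAt A (b x) x) (hb : IsB b) {a : ι → ℝ → ℝ} (ha : ∀ j, LipC (a j))
    {f : ℝ → ℝ} (hf : LipC f) (x : ℝ) : CVat a b f x := by
  classical
  have hal : ∀ j, LocallyIntegrable (a j) volume := fun j => (ha j).integrable.locallyIntegrable
  have hNf : Nice b f := hf.nice hb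
  choose K hK using fun j => (ha j).2
  obtain ⟨Kf, hKf1, hKf, hKfl⟩ := hf.2
  obtain ⟨L, hL1, hLf, hLj⟩ : ∃ L : ℝ, 1 ≤ L ∧ Kf ≤ L ∧ ∀ j, K j ≤ L := by
    have hs : 0 ≤ ∑ j, K j := Finset.sum_nonneg fun j _ => by linarith [(hK j).1]
    refine ⟨Kf + ∑ j, K j, by linarith, by linarith, ?_⟩
    intro j
    have := Finset.single_le_sum (f := K) (fun j _ => by linarith [(hK j).1]) (Finset.mem_univ j)
    linarith
  have hL0 : 0 ≤ L := by linarith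
  have hAD : ∀ y, AD b x y = A x - A y := fun y =>
    intervalIntegral.integral_eq_sub_of_hasDerivAt (fun t _ => hA t) (li_ii hb.loc y x)
  obtain ⟨B, hB⟩ := (hA x).isBigO_sub.bound
  obtain ⟨r, hr, hBr⟩ := Metric.eventually_nhds_iff.1 hB
  set r1 := r / 2 with hr1
  have hr1p : 0 < r1 := by positivity
  have hsl : ∀ y, x ≠ y → |x - y| ≤ r1 → |AD b x y / (x - y)| ≤ B := by
    intro y hxy hy
    have hp : 0 < |x - y| := abs_pos.2 (sub_ne_zero.2 hxy)
    rw [abs_div, div_le_iff₀ hp, hAD]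
    have := @hBr y (by rw [Real.dist_eq, abs_sub_comm]; linarith)
    rw [Real.norm_eq_abs, Real.norm_eq_abs, abs_sub_comm, abs_sub_comm y x] at this
    exact this
  set n := Fintype.card ι with hn
  set c0 := (∏ j, a j x) * f x with hc0
  set Q : ℝ → ℝ := fun y => (AD b x y / (x - y) - b y) / (x - y) with hQ
  set rem : ℝ → ℝ := fun y => KK a b x y * f y - c0 * Q y with hrem
  set D : ℝ := (n * L ^ n * L) * L + L ^ n * L with hD
  have hD0 : 0 ≤ D := by positivity
  have hcore : ∀ y, x ≠ y → |(∏ j, (AD (a j) x y / (x - y))) * f y - c0| ≤ D * |x - y| := by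
    intro y hxy
    have hse := fun j => slope_est (ha j).cont (hK j).2.1 (hK j).2.2 hxy
    have h1 : |∏ j, (AD (a j) x y / (x - y)) - ∏ j, a j x| ≤ n * L ^ n * (L * |x - y|) := by
      apply prod_diff_le hL1
      · intro j; exact (hse j).1.trans (hLj j)
      · intro j; exact ((hK j).2.1 x).trans (hLj j)
      · intro j; exact (hse j).2.trans (mul_le_mul_of_nonneg_right (hLj j) (abs_nonneg _))
    have h2 : |∏ j, a j x| ≤ L ^ n := abs_prod_le_pow fun j => ((hK j).2.1 x).trans (hLj j)
    have h3 : |f y| ≤ L := (hKf y).trans hLf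
    have h4 : |f y - f x| ≤ L * |x - y| := by
      rw [abs_sub_comm]; exact (hKfl x y).trans (mul_le_mul_of_nonneg_right hLf (abs_nonneg _))
    have e : (∏ j, (AD (a j) x y / (x - y))) * f y - c0 =
        (∏ j, (AD (a j) x y / (x - y)) - ∏ j, a j x) * f y + (∏ j, a j x) * (f y - f x) := by rw [hc0]; ring
    rw [e]
    refine (abs_add_le _ _).trans ?_
    rw [abs_mul, abs_mul]
    have h5 := mul_le_mul h1 h3 (abs_nonneg _) (by positivity)
    have h6 := mul_le_mul h2 h4 (abs_nonneg _) (by positivity)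
    rw [hD]
    nlinarith
  have hrb : ∀ y, x ≠ y → |x - y| ≤ r1 → |rem y| ≤ D * (B + |b y|) := by
    intro y hxy hy
    have hp : 0 < |x - y| := abs_pos.2 (sub_ne_zero.2 hxy)
    have e : rem y = (AD b x y / (x - y) - b y) / (x - y) * ((∏ j, (AD (a j) x y / (x - y))) * f y - c0) := by
      simp only [hrem, hQ, KK]; ring
    rw [e, abs_mul, abs_div]
    have h1 : |AD b x y / (x - y) - b y| ≤ B + |b y| := (abs_sub _ _).trans (by linarith [hsl y hxy hy])
    calc _ ≤ (B + |b y|) / |x - y| * (D * |x - y|) := by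
          apply mul_le_mul (div_le_div_of_nonneg_right h1 hp.le) (hcore y hxy) (abs_nonneg _)
          exact div_nonneg ((abs_nonneg _).trans h1) hp.le
      _ = D * (B + |b y|) := by field_simp
  let S : ℝ → Set ℝ := fun ε => {y | ε < |x - y| ∧ |x - y| ≤ r1}
  have hSm : ∀ ε, MeasurableSet (S ε) := fun ε =>
    (measurableSet_lt (f := fun _ => ε) (g := fun y => |x - y|) (by fun_prop) (by fun_prop)).inter
      (measurableSet_le (f := fun y => |x - y|) (g := fun _ => r1) (by fun_prop) (by fun_prop))
  have hQi : ∀ ε, 0 < ε → ε < r1 → Integrable ((S ε).indicator Q) := by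
    intro ε h1 h2
    rw [integrable_indicator_iff (hSm ε)]
    exact (ring_int hA hb.loc x h1 h2).1
  have hpt : ∀ ε, 0 < ε → ε < r1 → ∀ y, (S ε).indicator rem y =
      kk a b ε x y * f y - kk a b r1 x y * f y - c0 * (S ε).indicator Q y := by
    intro ε h1 h2 y
    by_cases hy : y ∈ S ε
    · rw [indicator_of_mem hy, indicator_of_mem hy]
      have ha1 : ε < |x - y| := hy.1
      have ha2 : ¬ r1 < |x - y| := not_lt.2 hy.2
      simp only [hrem, kk, if_pos ha1, if_neg ha2]; ring
    · rw [indicator_of_notMem hy, indicator_of_notMem hy]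
      by_cases ha1 : ε < |x - y|
      · have ha2 : r1 < |x - y| := by
          by_contra h
          exact hy ⟨ha1, not_lt.1 h⟩
        simp only [kk, if_pos ha1, if_pos ha2]; ring
      · have ha2 : ¬ r1 < |x - y| := fun h => ha1 (h2.trans h)
        simp only [kk, if_neg ha1, if_neg ha2]; ring
  have hri : ∀ ε, 0 < ε → ε < r1 → Integrable ((S ε).indicator rem) := by
    intro ε h1 h2
    have : Integrable (fun y => kk a b ε x y * f y - kk a b r1 x y * f y - c0 * (S ε).indicator Q y) :=
      ((kk_int hb hal hNf h1 x).sub (kk_int hb hal hNf hr1p x)).sub ((hQi ε h1 h2).const_mul c0)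
    exact this.congr (ae_of_all _ fun y => (hpt ε h1 h2 y).symm)
  have hdec : ∀ ε, 0 < ε → ε < r1 → TK a b ε f x = TK a b r1 f x + c0 * (∫ y in S ε, Q y) + ∫ y, (S ε).indicator rem y := by
    intro ε h1 h2
    have i1 : Integrable (fun y => kk a b ε x y * f y - kk a b r1 x y * f y) :=
      (kk_int hb hal hNf h1 x).sub (kk_int hb hal hNf hr1p x)
    rw [integral_congr_ae (ae_of_all _ (hpt ε h1 h2)), integral_sub i1 ((hQi ε h1 h2).const_mul c0),
      integral_sub (kk_int hb hal hNf h1 x) (kk_int hb hal hNf hr1p x), integral_const_mul, integral_indicator (hSm ε)]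
    unfold TK
    ring
  obtain ⟨l1, hl1⟩ := ring_tendsto hA hb.loc x hr1p
  have hev : ∀ᶠ ε in nhdsWithin (0:ℝ) (Ioi 0), 0 < ε ∧ ε < r1 := by
    filter_upwards [Ioo_mem_nhdsGT hr1p] with ε hε using hε
  have hbd : Integrable ((Icc (x - r1) (x + r1)).indicator fun y => D * (B + |b y|)) := by
    rw [integrable_indicator_iff measurableSet_Icc]
    have h1 : IntegrableOn (fun y => |b y|) (Icc (x - r1) (x + r1)) :=
      (hb.loc.integrableOn_isCompact isCompact_Icc).abs
    have h2 : IntegrableOn (fun _ : ℝ => B) (Icc (x - r1) (x + r1)) := integrableOn_const (by simp)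
    have h3 : IntegrableOn (fun y => B + |b y|) (Icc (x - r1) (x + r1)) := Integrable.add h2 h1
    exact h3.const_mul D
  have hl2 : Tendsto (fun ε => ∫ y, (S ε).indicator rem y) (nhdsWithin 0 (Ioi 0)) (nhds (∫ y, (S 0).indicator rem y)) := by
    apply tendsto_integral_filter_of_dominated_convergence ((Icc (x - r1) (x + r1)).indicator fun y => D * (B + |b y|))
    · filter_upwards [hev] with ε hε using (hri ε hε.1 hε.2).aestronglyMeasurable
    · filter_upwards [hev] with ε hε
      refine ae_of_all _ fun y => ?_
      by_cases hy : y ∈ S ε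
      · have hne : x ≠ y := by
          intro h
          have := hy.1
          rw [h, sub_self, abs_zero] at this
          linarith [hε.1]
        have h2 := hy.2
        have hm : y ∈ Icc (x - r1) (x + r1) := by
          have := abs_le.1 h2
          constructor <;> linarith
        rw [indicator_of_mem hy, indicator_of_mem hm]
        exact hrb y hne h2
      · rw [indicator_of_notMem hy, norm_zero]
        by_cases hm : y ∈ Icc (x - r1) (x + r1)
        · rw [indicator_of_mem hm]
          by_cases hne : x = y
          · have : |b y| ≥ 0 := abs_nonneg _
            have hB0 : 0 ≤ B := by
              have h3 : x ≠ x + r1 := by intro h; linarith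
              refine (abs_nonneg _).trans (hsl (x + r1) h3 ?_)
              rw [sub_add_cancel_left, abs_neg, abs_of_pos hr1p]
            positivity
          · have h2 : |x - y| ≤ r1 := by rw [abs_le]; constructor <;> linarith [hm.1, hm.2]
            exact (abs_nonneg _).trans (hrb y hne h2)
        · rw [indicator_of_notMem hm]
    · exact hbd
    · refine ae_of_all _ fun y => ?_
      by_cases hne : x = y
      · apply tendsto_const_nhds.congr'
        filter_upwards [hev] with ε hε
        rw [indicator_of_notMem, indicator_of_notMem]
        · intro h
          have := h.1
          rw [hne, sub_self, abs_zero] at this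
          linarith [hε.1]
        · intro h
          have := h.1
          rw [hne, sub_self, abs_zero] at this
          linarith
      · have hp : 0 < |x - y| := abs_pos.2 (sub_ne_zero.2 hne)
        apply tendsto_const_nhds.congr'
        filter_upwards [Ioo_mem_nhdsGT hp] with ε hε
        by_cases hy : |x - y| ≤ r1
        · rw [indicator_of_mem, indicator_of_mem]
          · exact ⟨hε.2, hy⟩
          · exact ⟨hp, hy⟩
        · rw [indicator_of_notMem, indicator_of_notMem]
          · exact fun h => hy h.2
          · exact fun h => hy h.2
  refine ⟨TK a b r1 f x + c0 * l1 + ∫ y, (S 0).indicator rem y, ?_⟩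
  refine (((tendsto_const_nhds).add (hl1.const_mul c0)).add hl2).congr' ?_
  filter_upwards [hev] with ε hε
  exact (hdec ε hε.1 hε.2).symm

end CCA

end

section
namespace CCA

theorem cv_of_approx {F : ℝ → ℝ → ℝ} (h : ∀ κ : ℝ, 0 < κ → ∀ δ : ℝ, 0 < δ → ∃ G R : ℝ → ℝ → ℝ,
    (∀ ε, 0 < ε → ∀ x, F ε x = G ε x + R ε x) ∧
    (∀ᵐ x : ℝ, ∃ l, Tendsto (fun ε => G ε x) (nhdsWithin 0 (Ioi 0)) (nhds l)) ∧
    volume {x : ℝ | ∃ ε, 0 < ε ∧ κ < |R ε x|} ≤ ENNReal.ofReal δ) :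
    ∀ᵐ x : ℝ, ∃ l, Tendsto (fun ε => F ε x) (nhdsWithin 0 (Ioi 0)) (nhds l) := by
  have key : ∀ κ : ℝ, 0 < κ → ∀ᵐ x : ℝ, ∃ η : ℝ, 0 < η ∧ ∀ ε ε', 0 < ε → ε < η → 0 < ε' → ε' < η →
      |F ε x - F ε' x| ≤ 3 * κ := by
    intro κ hκ
    rw [ae_iff]
    refine le_antisymm ?_ bot_le
    apply le_of_forall_pos_le_add
    intro d hd
    rw [zero_add]
    by_cases hdt : d = ⊤
    · rw [hdt]; exact le_top
    have hd' : 0 < d.toReal := ENNReal.toReal_pos hd.ne' hdt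
    obtain ⟨G, R, hF, hG, hR⟩ := h κ hκ d.toReal hd'
    rw [ENNReal.ofReal_toReal hdt] at hR
    rw [ae_iff] at hG
    refine (measure_mono (t := {x | ¬ ∃ l, Tendsto (fun ε => G ε x) (nhdsWithin 0 (Ioi 0)) (nhds l)} ∪
      {x : ℝ | ∃ ε, 0 < ε ∧ κ < |R ε x|}) ?_).trans ((measure_union_le _ _).trans ?_)
    · intro x hx
      by_contra hn
      rw [mem_union, not_or] at hn
      obtain ⟨h1, h2⟩ := hn
      simp only [mem_setOf_eq, not_not] at h1
      simp only [mem_setOf_eq, not_exists, not_and, not_lt] at h2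
      apply hx
      obtain ⟨l, hl⟩ := h1
      have h3 := (Metric.tendsto_nhds.1 hl) (κ / 2) (by positivity)
      rw [eventually_nhdsWithin_iff] at h3
      obtain ⟨η, hη, h4⟩ := Metric.eventually_nhds_iff.1 h3
      refine ⟨η, hη, ?_⟩
      intro ε ε' e1 e2 e3 e4
      have g1 := @h4 ε (by rw [Real.dist_eq, sub_zero, abs_of_pos e1]; exact e2) e1
      have g2 := @h4 ε' (by rw [Real.dist_eq, sub_zero, abs_of_pos e3]; exact e4) e3
      rw [Real.dist_eq, abs_lt] at g1 g2
      have r1 := abs_le.1 (h2 ε e1)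
      have r2 := abs_le.1 (h2 ε' e3)
      rw [hF ε e1, hF ε' e3, abs_le]
      constructor <;> linarith [g1.1, g1.2, g2.1, g2.2, r1.1, r1.2, r2.1, r2.2]
    · rw [hG, zero_add]; exact hR
  have hall : ∀ᵐ x : ℝ, ∀ k : ℕ, ∃ η : ℝ, 0 < η ∧ ∀ ε ε', 0 < ε → ε < η → 0 < ε' → ε' < η →
      |F ε x - F ε' x| ≤ 3 * (1 / ((k:ℝ) + 1)) := ae_all_iff.2 fun k => key _ (by positivity)
  filter_upwards [hall] with x hx
  rw [← cauchy_map_iff_exists_tendsto, Metric.cauchy_iff]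
  refine ⟨inferInstance, ?_⟩
  intro κ hκ
  obtain ⟨k, hk⟩ := exists_nat_one_div_lt (show (0:ℝ) < κ / 3 by positivity)
  obtain ⟨η, hη, h1⟩ := hx k
  refine ⟨(fun ε => F ε x) '' Ioo 0 η, image_mem_map (Ioo_mem_nhdsGT hη), ?_⟩
  rintro _ ⟨ε, he, rfl⟩ _ ⟨ε', he', rfl⟩
  rw [Real.dist_eq]
  have := h1 ε ε' he.1 he.2 he'.1 he'.2
  dsimp only
  linarith

/-- density of Lipschitz compactly supported functions in `L¹` -/
theorem dens_L1 {f : ℝ → ℝ} (hf : Integrable f) {δ : ℝ} (hδ : 0 < δ) :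
    ∃ g, LipC g ∧ dm (fun y => f y - g y) univ ≤ ENNReal.ofReal δ := by
  have hm : MemLp f 1 volume := memLp_one_iff_integrable.2 hf
  obtain ⟨g, hg1, hg2, hg3⟩ := hm.exist_eLpNorm_sub_le (by simp) le_rfl hδ
  have hgc : Continuous g := hg2.continuous
  refine ⟨g, ⟨hg1, ?_⟩, ?_⟩
  · obtain ⟨C, hC⟩ := ContDiff.lipschitzWith_of_hasCompactSupport hg1 hg2 (by simp)
    obtain ⟨D, hD⟩ := hgc.bounded_above_of_compact_support hg1
    refine ⟨max 1 (max C D), le_max_left _ _, ?_, ?_⟩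
    · intro x; exact (hD x).trans ((le_max_right _ _).trans (le_max_right _ _))
    · intro x y
      have := hC.dist_le_mul x y
      rw [Real.dist_eq, Real.dist_eq] at this
      exact this.trans (mul_le_mul_of_nonneg_right ((le_max_left _ _).trans (le_max_right _ _)) (abs_nonneg _))
  · rw [dm_apply _ MeasurableSet.univ, Measure.restrict_univ]
    rw [eLpNorm_one_eq_lintegral_enorm] at hg3
    refine le_trans (le_of_eq ?_) hg3
    apply lintegral_congr
    intro y
    rw [← ofReal_norm_eq_enorm]; rfl

theorem LipC.clip {g : ℝ → ℝ} (h : LipC g) {M : ℝ} (hM : 0 ≤ M) : LipC (fun x => max (-M) (min M (g x))) := by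
  obtain ⟨hc, K, hK1, hK, hl⟩ := h
  refine ⟨?_, max K M, le_max_of_le_left hK1, ?_, ?_⟩
  · exact hc.comp_left (g := fun t => max (-M) (min M t)) (by simp [hM])
  · intro x
    rw [abs_le]
    have := le_max_right K M
    constructor
    · exact le_trans (by linarith) (le_max_left _ _)
    · exact max_le (by linarith) ((min_le_left _ _).trans this)
  · intro x y
    refine le_trans (le_trans ?_ (hl x y)) (mul_le_mul_of_nonneg_right (le_max_left _ _) (abs_nonneg _))
    refine (abs_max_sub_max_le_max _ _ _ _).trans ?_
    rw [sub_self, abs_zero]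
    refine max_le (abs_nonneg _) ((abs_min_sub_min_le_max _ _ _ _).trans ?_)
    rw [sub_self, abs_zero]
    exact max_le (abs_nonneg _) le_rfl

theorem Phi_le_of_bdd {f : ℝ → ℝ} {M : ℝ} (hM : ∀ x, |f x| ≤ M) :
    Phi f ≤ ENNReal.ofReal (Real.log (Real.exp 1 + M)) * dm f univ := by
  rw [dm_apply _ MeasurableSet.univ, Measure.restrict_univ, ← lintegral_const_mul' _ _ ENNReal.ofReal_ne_top]
  unfold Phi
  apply lintegral_mono
  intro y
  dsimp only
  have hM0 : 0 ≤ M := (abs_nonneg _).trans (hM y)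
  have he := Real.exp_pos 1
  have h1 : Real.log (Real.exp 1 + |f y|) ≤ Real.log (Real.exp 1 + M) :=
    Real.log_le_log (by positivity) (by linarith [hM y])
  have h2 : 0 ≤ Real.log (Real.exp 1 + M) := le_trans (by linarith [log_e_ge (abs_nonneg (f y))]) h1
  rw [← ENNReal.ofReal_mul h2]
  apply ENNReal.ofReal_le_ofReal
  unfold phi
  nlinarith [abs_nonneg (f y)]

theorem phi_add_le (u v : ℝ) : phi (u + v) ≤ phi (2 * u) + phi (2 * v) := by
  rcases le_total |u| |v| with h | h
  · have : phi (u + v) ≤ phi (2 * v) := by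
      apply phi_mono
      rw [abs_mul, abs_two]
      linarith [abs_add_le u v]
    linarith [phi_nonneg (2 * u)]
  · have : phi (u + v) ≤ phi (2 * u) := by
      apply phi_mono
      rw [abs_mul, abs_two]
      linarith [abs_add_le u v]
    linarith [phi_nonneg (2 * v)]

theorem phi_meas : Measurable phi := by unfold phi; fun_prop

theorem Phi_add_le {u v : ℝ → ℝ} (hu : Measurable u) : 
    Phi (fun x => u x + v x) ≤ Phi (fun x => 2 * u x) + Phi (fun x => 2 * v x) := by
  unfold Phi
  rw [← lintegral_add_left]
  · apply lintegral_mono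
    intro y
    dsimp only
    rw [← ENNReal.ofReal_add (phi_nonneg _) (phi_nonneg _)]
    exact ENNReal.ofReal_le_ofReal (phi_add_le _ _)
  · exact (phi_meas.comp (hu.const_mul 2)).ennreal_ofReal

theorem dens_Phi {f : ℝ → ℝ} (hf : Measurable f) (hP : Phi f ≠ ⊤) {t : ℝ} (ht : 0 < t) {δ : ℝ} (hδ : 0 < δ) :
    ∃ g, LipC g ∧ Phi (fun y => t * (f y - g y)) ≤ ENNReal.ofReal δ := by
  set c : ℝ := max 1 (2 * t) with hc
  have hc1 : 1 ≤ c := le_max_left _ _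
  have hct : 2 * t ≤ c := le_max_right _ _
  -- tail
  have hcP : Phi (fun y => c * f y) ≠ ⊤ := by
    refine ne_top_of_le_ne_top ?_ (Phi_mul_le hc1 f)
    exact ENNReal.mul_ne_top ENNReal.ofReal_ne_top hP
  have htail : Tendsto (fun N : ℕ => Phi (fun y => if |f y| ≤ N then 0 else c * f y)) atTop (nhds 0) := by
    have h0 : (0:ℝ≥0∞) = ∫⁻ _ : ℝ, 0 := by simp
    rw [h0]
    unfold Phi
    apply tendsto_lintegral_of_dominated_convergence (fun y => ENNReal.ofReal (phi (c * f y)))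
    · intro N
      apply Measurable.ennreal_ofReal
      refine phi_meas.comp ?_
      exact Measurable.ite (measurableSet_le (f := fun y => |f y|) (g := fun _ => (N:ℝ)) (by fun_prop) (by fun_prop))
        measurable_const (hf.const_mul c)
    · intro N
      refine ae_of_all _ fun y => ?_
      apply ENNReal.ofReal_le_ofReal
      apply phi_mono
      dsimp only
      split_ifs
      · rw [abs_zero]; exact abs_nonneg _
      · exact le_rfl
    · exact hcP
    · refine ae_of_all _ fun y => ?_
      apply tendsto_const_nhds.congr'
      obtain ⟨N0, hN0⟩ := exists_nat_ge |f y|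
      filter_upwards [eventually_ge_atTop N0] with N hN
      have : |f y| ≤ N := hN0.trans (by exact_mod_cast hN)
      rw [if_pos this]
      simp [phi]
  obtain ⟨N, hN⟩ := (htail.eventually (gt_mem_nhds (show (0:ℝ≥0∞) < ENNReal.ofReal (δ / 2) by simpa using hδ))).exists
  -- truncated part
  set u : ℝ → ℝ := fun y => if |f y| ≤ N then f y else 0 with hu
  have hum : Measurable u := Measurable.ite (measurableSet_le (f := fun y => |f y|) (g := fun _ => (N:ℝ)) (by fun_prop) (by fun_prop)) hf measurable_const
  have hub : ∀ y, |u y| ≤ N := by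
    intro y
    simp only [hu]
    split_ifs with h
    · exact h
    · simp
  have hufin : Integrable u := by
    refine ⟨hum.aestronglyMeasurable, ?_⟩
    refine lt_of_le_of_lt ?_ (lt_top_iff_ne_top.2 hP)
    apply lintegral_mono
    intro y
    dsimp only
    rw [← ofReal_norm_eq_enorm]
    apply ENNReal.ofReal_le_ofReal
    refine le_trans ?_ (abs_le_phi (f y))
    simp only [hu, Real.norm_eq_abs]
    split_ifs
    · exact le_rfl
    · simp
  set W : ℝ := Real.log (Real.exp 1 + c * (2 * N)) * c with hW
  have hN0 : (0:ℝ) ≤ N := Nat.cast_nonneg N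
  have hW0 : 0 < W := by
    apply mul_pos _ (by linarith)
    apply Real.log_pos
    have := Real.add_one_lt_exp (show (1:ℝ) ≠ 0 by norm_num)
    have : 0 ≤ c * (2 * N) := by positivity
    linarith
  obtain ⟨g0, hg0, hg0d⟩ := dens_L1 hufin (show 0 < δ / 2 / W by positivity)
  refine ⟨fun x => max (-N) (min N (g0 x)), hg0.clip hN0, ?_⟩
  set g : ℝ → ℝ := fun x => max (-N) (min N (g0 x)) with hg
  have hgb : ∀ x, |g x| ≤ N := by
    intro x
    rw [abs_le]
    exact ⟨le_max_left _ _, max_le (by linarith) (min_le_left _ _)⟩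
  have hgu : ∀ x, |u x - g x| ≤ |u x - g0 x| := by
    intro x
    have e : u x = max (-(N:ℝ)) (min (N:ℝ) (u x)) := by
      have := abs_le.1 (hub x)
      rw [min_eq_right this.2, max_eq_right this.1]
    conv_lhs => rw [e]
    refine (abs_max_sub_max_le_max _ _ _ _).trans ?_
    rw [sub_self, abs_zero]
    refine max_le (abs_nonneg _) ((abs_min_sub_min_le_max _ _ _ _).trans ?_)
    rw [sub_self, abs_zero]
    exact max_le (abs_nonneg _) le_rfl
  have hgm : Measurable g := (hg0.clip hN0).cont.measurable
  have e1 : Phi (fun y => t * (f y - g y)) ≤ Phi (fun y => 2 * (t * (u y - g y))) + Phi (fun y => 2 * (t * (f y - u y))) := by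
    have := Phi_add_le (u := fun y => t * (u y - g y)) (v := fun y => t * (f y - u y)) (by fun_prop)
    refine le_trans (le_of_eq ?_) this
    congr 1; ext y; ring
  have e2 : Phi (fun y => 2 * (t * (f y - u y))) ≤ ENNReal.ofReal (δ / 2) := by
    refine le_trans ?_ hN.le
    apply Phi_mono
    intro y
    simp only [hu]
    split_ifs
    · simp
    · rw [sub_zero, ← mul_assoc, abs_mul, abs_mul c]
      apply mul_le_mul_of_nonneg_right _ (abs_nonneg _)
      rw [abs_of_pos (by positivity), abs_of_pos (by linarith)]
      exact hct
  have e3 : Phi (fun y => 2 * (t * (u y - g y))) ≤ ENNReal.ofReal (δ / 2) := by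
    have h1 : Phi (fun y => 2 * (t * (u y - g y))) ≤ Phi (fun y => c * (u y - g y)) := by
      apply Phi_mono
      intro y
      rw [← mul_assoc, abs_mul, abs_mul c]
      apply mul_le_mul_of_nonneg_right _ (abs_nonneg _)
      rw [abs_of_pos (by positivity), abs_of_pos (by linarith)]
      exact hct
    have h2 : Phi (fun y => c * (u y - g y)) ≤ ENNReal.ofReal (Real.log (Real.exp 1 + c * (2 * N))) * dm (fun y => c * (u y - g y)) univ := by
      apply Phi_le_of_bdd
      intro x
      rw [abs_mul, abs_of_pos (by linarith)]
      apply mul_le_mul_of_nonneg_left _ (by linarith)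
      have := abs_sub (u x) (g x)
      linarith [hub x, hgb x]
    have h3 : dm (fun y => u y - g y) univ ≤ ENNReal.ofReal (δ / 2 / W) := by
      refine le_trans ?_ hg0d
      rw [dm_apply _ MeasurableSet.univ, dm_apply _ MeasurableSet.univ]
      apply lintegral_mono
      intro y
      exact ENNReal.ofReal_le_ofReal (hgu y)
    refine h1.trans (h2.trans ?_)
    rw [dm_mul, ← mul_assoc, abs_of_pos (by linarith : 0 < c), mul_comm (ENNReal.ofReal _) (ENNReal.ofReal c),
      ← ENNReal.ofReal_mul (by linarith), mul_comm c]
    refine (mul_le_mul_right h3 _).trans ?_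
    rw [← ENNReal.ofReal_mul hW0.le]
    apply ENNReal.ofReal_le_ofReal
    apply le_of_eq
    field_simp
  refine e1.trans ((add_le_add e3 e2).trans ?_)
  rw [← ENNReal.ofReal_add (by positivity) (by positivity)]
  apply ENNReal.ofReal_le_ofReal
  linarith

end CCA

end

section
namespace CCA
variable {ι : Type} [Fintype ι]

theorem TK_mul' (a : ι → ℝ → ℝ) (b f : ℝ → ℝ) (s : ι → ℝ) (t ε x : ℝ) :
    TK (fun j y => s j * a j y) b ε (fun y => t * f y) x = (∏ j, s j) * t * TK a b ε f x := by
  unfold TK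
  rw [← integral_const_mul]
  congr 1; ext y
  have : kk (fun j y => s j * a j y) b ε x y = (∏ j, s j) * kk a b ε x y := by
    unfold kk KK
    split_ifs
    · simp only [AD_mul, mul_div_assoc]
      rw [Finset.prod_mul_distrib]
      ring
    · simp
  rw [this]; ring

theorem weak_scaled (ι : Type) [Fintype ι] : ∃ C : ℝ, 0 < C ∧ ∀ b, IsB b → ∀ a : ι → ℝ → ℝ, (∀ j, LocallyIntegrable (a j) volume) →
    ∀ f, Nice b f → ∀ (s : ι → ℝ) (t κ : ℝ), (∀ j, 0 < s j) → 0 < t → 1 ≤ (∏ j, s j) * t * κ →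
      volume {x | ∃ ε, 0 < ε ∧ κ < |TK a b ε f x|} ≤
        ENNReal.ofReal C * ((∑ j, ENNReal.ofReal (s j) * dm (a j) univ) + Phi (fun y => t * f y)) := by
  obtain ⟨C, hC, h⟩ := weak_star ι
  refine ⟨C, hC, ?_⟩
  intro b hb a ha f hf s t κ hs ht h1
  have h2 := h b hb (fun j y => s j * a j y) (fun j => (ha j).smul (s j)) (fun y => t * f y) (hf.const_mul t)
  unfold XX at h2
  simp only [dm_mul, abs_of_pos (hs _)] at h2
  refine le_trans (measure_mono ?_) h2
  rintro x ⟨ε, hε, hx⟩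
  refine ⟨ε, hε, ?_⟩
  have hp : 0 < (∏ j, s j) * t := mul_pos (Finset.prod_pos fun j _ => hs j) ht
  rw [TK_mul', abs_mul, abs_of_pos hp]
  exact lt_of_le_of_lt h1 (mul_lt_mul_of_pos_left hx hp)

theorem small_sigma {C : ℝ} (hC : 0 < C) {X : ℝ≥0∞} (hX : X ≠ ⊤) {δ : ℝ} (hδ : 0 < δ) :
    ∃ σ : ℝ, 0 < σ ∧ σ ≤ 1 ∧ ENNReal.ofReal C * (ENNReal.ofReal σ * X) ≤ ENNReal.ofReal δ := by
  set X' := X.toReal with hX'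
  have hX0 : 0 ≤ X' := ENNReal.toReal_nonneg
  refine ⟨min 1 (δ / (C * (X' + 1))), by positivity, min_le_left _ _, ?_⟩
  rw [← ENNReal.ofReal_toReal hX, ← ENNReal.ofReal_mul (by positivity), ← ENNReal.ofReal_mul hC.le]
  apply ENNReal.ofReal_le_ofReal
  calc C * (min 1 (δ / (C * (X' + 1))) * X.toReal) ≤ C * (δ / (C * (X' + 1)) * (X' + 1)) := by
        apply mul_le_mul_of_nonneg_left _ hC.le
        apply mul_le_mul (min_le_right _ _) (by linarith) hX0 (by positivity)
    _ = δ := by field_simp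

theorem dm_ne_top {g : ℝ → ℝ} (hg : Integrable g) : dm g univ ≠ ⊤ := by
  rw [dm_apply _ MeasurableSet.univ, Measure.restrict_univ]
  have := hg.abs.lintegral_lt_top
  exact this.ne

theorem LipC.Phi_ne_top {g : ℝ → ℝ} (h : LipC g) : Phi g ≠ ⊤ := by
  obtain ⟨K, _, hK, _⟩ := h.2
  exact ne_top_of_le_ne_top (ENNReal.mul_ne_top ENNReal.ofReal_ne_top (dm_ne_top h.integrable)) (Phi_le_of_bdd hK)

theorem KK_update [DecidableEq ι] (a : ι → ℝ → ℝ) (b : ℝ → ℝ) (j0 : ι) (u : ℝ → ℝ)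
    (h0 : LocallyIntegrable (a j0) volume) (hu : LocallyIntegrable u volume) (x y : ℝ) :
    KK a b x y = KK (Function.update a j0 u) b x y + KK (Function.update a j0 (fun t => a j0 t - u t)) b x y := by
  have hprod : ∀ v : ℝ → ℝ, ∏ j, (AD (Function.update a j0 v j) x y / (x - y)) =
      (AD v x y / (x - y)) * ∏ j ∈ Finset.univ.erase j0, (AD (a j) x y / (x - y)) := by
    intro v
    rw [← Finset.mul_prod_erase Finset.univ _ (Finset.mem_univ j0), Function.update_self]
    congr 1
    apply Finset.prod_congr rfl
    intro j hj
    rw [Function.update_of_ne (Finset.ne_of_mem_erase hj)]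
  have hAD : AD (fun t => a j0 t - u t) x y = AD (a j0) x y - AD u x y :=
    intervalIntegral.integral_sub (li_ii h0 y x) (li_ii hu y x)
  unfold KK
  rw [hprod, hprod, ← Finset.mul_prod_erase Finset.univ _ (Finset.mem_univ j0), hAD]
  ring

theorem TK_update [DecidableEq ι] {a : ι → ℝ → ℝ} {b f : ℝ → ℝ} (hb : IsB b) (ha : ∀ j, LocallyIntegrable (a j) volume)
    (hf : Nice b f) (j0 : ι) {u : ℝ → ℝ} (hu : LocallyIntegrable u volume) {ε : ℝ} (hε : 0 < ε) (x : ℝ) :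
    TK a b ε f x = TK (Function.update a j0 u) b ε f x + TK (Function.update a j0 (fun t => a j0 t - u t)) b ε f x := by
  have hloc : ∀ v : ℝ → ℝ, LocallyIntegrable v volume → ∀ j, LocallyIntegrable (Function.update a j0 v j) volume := by
    intro v hv j
    by_cases h : j = j0
    · subst h; rw [Function.update_self]; exact hv
    · rw [Function.update_of_ne h]; exact ha j
  have hd : LocallyIntegrable (fun t => a j0 t - u t) volume := (ha j0).sub hu
  unfold TK
  rw [← integral_add (kk_int hb (hloc u hu) hf hε x) (kk_int hb (hloc _ hd) hf hε x)]
  congr 1; ext y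
  rw [← add_mul]
  congr 1
  unfold kk
  split_ifs
  · exact KK_update a b j0 u (ha j0) hu x y
  · simp

theorem cv_a {A b : ℝ → ℝ} (hA : ∀ x, HasDerivAt A (b x) x) (hb : IsB b) {f : ℝ → ℝ} (hf : LipC f) (S : Finset ι) :
    ∀ a : ι → ℝ → ℝ, (∀ j, Integrable (a j)) → (∀ j, j ∉ S → LipC (a j)) → ∀ᵐ x, CVat a b f x := by
  classical
  obtain ⟨C, hC, hw⟩ := weak_scaled ι
  induction S using Finset.induction_on with
  | empty =>
    intro a _ h
    exact ae_of_all _ fun x => base_cv hA hb (fun j => h j (by simp)) hf x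
  | insert j0 S hj0 ih =>
    intro a hai h
    have hNf := hf.nice hb
    have hal : ∀ j, LocallyIntegrable (a j) volume := fun j => (hai j).locallyIntegrable
    apply cv_of_approx
    intro κ hκ δ hδ
    have hXt : XX a f ≠ ⊤ := by
      unfold XX
      exact ENNReal.add_ne_top.2 ⟨ENNReal.sum_ne_top.2 fun j _ => dm_ne_top (hai j), hf.Phi_ne_top⟩
    obtain ⟨σ, hσ0, hσ1, hσ⟩ := small_sigma hC hXt (show 0 < δ / 2 by positivity)
    set P : ℝ := ∏ j ∈ Finset.univ \ {j0}, σ with hP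
    have hP0 : 0 < P := Finset.prod_pos fun _ _ => hσ0
    set τ : ℝ := 1 / (P * σ * κ) with hτ
    have hτ0 : 0 < τ := by positivity
    obtain ⟨u, hu, hud⟩ := dens_L1 (hai j0) (show 0 < δ / 2 / (C * τ) by positivity)
    refine ⟨fun ε x => TK (Function.update a j0 u) b ε f x,
      fun ε x => TK (Function.update a j0 (fun t => a j0 t - u t)) b ε f x, ?_, ?_, ?_⟩
    · intro ε hε x
      exact TK_update hb hal hNf j0 hu.integrable.locallyIntegrable hε x
    · refine ih (Function.update a j0 u) ?_ ?_
      · intro j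
        by_cases h : j = j0
        · subst h; rw [Function.update_self]; exact hu.integrable
        · rw [Function.update_of_ne h]; exact hai j
      · intro j hj
        by_cases h' : j = j0
        · subst h'; rw [Function.update_self]; exact hu
        · rw [Function.update_of_ne h']; exact h j (by simp [h', hj])
    · have hri : Integrable (fun t => a j0 t - u t) := (hai j0).sub hu.integrable
      have h1 := hw b hb (Function.update a j0 (fun t => a j0 t - u t)) (by
        intro j
        by_cases h : j = j0
        · subst h; rw [Function.update_self]; exact hri.locallyIntegrable
        · rw [Function.update_of_ne h]; exact hal j) f hNf (Function.update (fun _ => σ) j0 τ) σ κ (by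
          intro j
          by_cases h : j = j0
          · subst h; rw [Function.update_self]; exact hτ0
          · rw [Function.update_of_ne h]; exact hσ0) hσ0 (by
          rw [Finset.prod_update_of_mem (Finset.mem_univ j0)]
          apply le_of_eq
          rw [← hP, hτ]; field_simp)
      refine h1.trans ?_
      have h2 : (∑ j, ENNReal.ofReal (Function.update (fun _ => σ) j0 τ j) * dm (Function.update a j0 (fun t => a j0 t - u t) j) univ)
          + Phi (fun y => σ * f y) ≤ ENNReal.ofReal σ * XX a f + ENNReal.ofReal τ * dm (fun t => a j0 t - u t) univ := by
        unfold XX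
        rw [mul_add, Finset.mul_sum, add_right_comm]
        refine add_le_add ?_ (Phi_mul_le' hσ0.le hσ1 f)
        rw [← Finset.add_sum_erase Finset.univ _ (Finset.mem_univ j0), Function.update_self, Function.update_self, add_comm]
        apply add_le_add _ le_rfl
        refine le_trans (le_of_eq ?_) (Finset.sum_le_sum_of_subset (Finset.erase_subset j0 Finset.univ))
        apply Finset.sum_congr rfl
        intro j hj
        rw [Function.update_of_ne (Finset.ne_of_mem_erase hj), Function.update_of_ne (Finset.ne_of_mem_erase hj)]
      refine (mul_le_mul_right h2 _).trans ?_
      rw [mul_add]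
      have h3 : ENNReal.ofReal C * (ENNReal.ofReal τ * dm (fun t => a j0 t - u t) univ) ≤ ENNReal.ofReal (δ / 2) := by
        rw [← mul_assoc, ← ENNReal.ofReal_mul hC.le]
        refine (mul_le_mul_right hud _).trans ?_
        rw [← ENNReal.ofReal_mul (by positivity)]
        apply ENNReal.ofReal_le_ofReal
        apply le_of_eq; field_simp
      refine (add_le_add hσ h3).trans ?_
      rw [← ENNReal.ofReal_add (by positivity) (by positivity)]
      apply ENNReal.ofReal_le_ofReal
      linarith

theorem cv_ae {A b : ℝ → ℝ} (hA : ∀ x, HasDerivAt A (b x) x) (hb : IsB b) {a : ι → ℝ → ℝ} (hai : ∀ j, Integrable (a j))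
    {f : ℝ → ℝ} (hf : Nice b f) (hP : Phi f ≠ ⊤) : ∀ᵐ x, CVat a b f x := by
  classical
  obtain ⟨C, hC, hw⟩ := weak_scaled ι
  have hal : ∀ j, LocallyIntegrable (a j) volume := fun j => (hai j).locallyIntegrable
  apply cv_of_approx
  intro κ hκ δ hδ
  have hXt : (∑ j, dm (a j) univ) ≠ ⊤ := ENNReal.sum_ne_top.2 fun j _ => dm_ne_top (hai j)
  obtain ⟨σ, hσ0, hσ1, hσ⟩ := small_sigma hC hXt (show 0 < δ / 2 by positivity)
  set P : ℝ := ∏ _j : ι, σ with hPd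
  have hP0 : 0 < P := Finset.prod_pos fun _ _ => hσ0
  obtain ⟨g, hg, hgd⟩ := dens_Phi hf.meas hP (t := 1 / (P * κ)) (by positivity) (show 0 < δ / 2 / C by positivity)
  have hNg := hg.nice hb
  have hNr : Nice b (fun y => f y - g y) := by
    have := hf.add (hNg.const_mul (-1))
    refine cast ?_ this
    congr 1; ext y; ring
  refine ⟨fun ε x => TK a b ε g x, fun ε x => TK a b ε (fun y => f y - g y) x, ?_, ?_, ?_⟩
  · intro ε hε x
    rw [← TK_add hb hal hNg hNr hε x]
    congr 1; ext y; ring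
  · exact cv_a hA hb hg Finset.univ a hai (fun j hj => absurd (Finset.mem_univ j) hj)
  · have h1 := hw b hb a hal _ hNr (fun _ => σ) (1 / (P * κ)) κ (fun _ => hσ0) (by positivity) (by
      apply le_of_eq
      rw [← hPd]; field_simp)
    refine h1.trans ?_
    rw [mul_add, ← Finset.mul_sum]
    have h3 : ENNReal.ofReal C * Phi (fun y => 1 / (P * κ) * (f y - g y)) ≤ ENNReal.ofReal (δ / 2) := by
      refine (mul_le_mul_right hgd _).trans ?_
      rw [← ENNReal.ofReal_mul (by positivity)]
      apply ENNReal.ofReal_le_ofReal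
      apply le_of_eq; field_simp
    refine (add_le_add hσ h3).trans ?_
    rw [← ENNReal.ofReal_add (by positivity) (by positivity)]
    apply ENNReal.ofReal_le_ofReal
    linarith

end CCA

end

section
namespace CCA
variable {ι : Type} [Fintype ι]

theorem Nice_trunc {b f : ℝ → ℝ} (hb : IsB b) (hf : Measurable f) (hP : Phi f ≠ ⊤) {R : ℝ} (hR : 0 < R) :
    Nice b ((Icc (-R) R).indicator f) := by
  have hs : ∀ y, R < |y| → (Icc (-R) R).indicator f y = 0 := by
    intro y hy
    apply indicator_of_notMem
    intro h
    have := abs_le.2 h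
    linarith
  have hif : Integrable f := by
    refine ⟨hf.aestronglyMeasurable, lt_of_le_of_lt ?_ (lt_top_iff_ne_top.2 hP)⟩
    apply lintegral_mono
    intro y
    dsimp only
    rw [← ofReal_norm_eq_enorm]
    exact ENNReal.ofReal_le_ofReal (abs_le_phi (f y))
  refine ⟨hf.indicator measurableSet_Icc, hif.indicator measurableSet_Icc, ?_, R, hR, hs⟩
  have huv : -(R + 1) < R + 1 := by linarith
  set c := avg b (-(R + 1)) (R + 1) with hc
  have h1 := loc_young hb f huv
  have hfin : ∫⁻ y in Ioo (-(R+1)) (R+1), ENNReal.ofReal (|f y| * (1 + |b y - c|)) < ⊤ := by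
    refine lt_of_le_of_lt h1 (ENNReal.add_lt_top.2 ⟨?_, ENNReal.ofReal_lt_top⟩)
    refine ENNReal.mul_lt_top (by norm_num) ?_
    exact lt_of_le_of_lt (setLIntegral_le_lintegral _ _) (lt_top_iff_ne_top.2 hP)
  have hbm := hb.meas
  have hbi : IntegrableOn (fun y => b y * f y) (Ioo (-(R+1)) (R+1)) := by
    refine ⟨(hbm.mul hf).aestronglyMeasurable, ?_⟩
    have h2 : ∫⁻ y in Ioo (-(R+1)) (R+1), ENNReal.ofReal (1 + |c|) * ENNReal.ofReal (|f y| * (1 + |b y - c|)) < ⊤ := by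
      rw [lintegral_const_mul' _ _ ENNReal.ofReal_ne_top]
      exact ENNReal.mul_lt_top ENNReal.ofReal_lt_top hfin
    refine lt_of_le_of_lt ?_ h2
    apply lintegral_mono
    intro y
    dsimp only
    rw [← ofReal_norm_eq_enorm, ← ENNReal.ofReal_mul (by positivity)]
    apply ENNReal.ofReal_le_ofReal
    rw [Real.norm_eq_abs, abs_mul]
    have e1 : |b y| ≤ |b y - c| + |c| := by
      have := abs_add_le (b y - c) c
      rwa [sub_add_cancel] at this
    have e2 := abs_nonneg (f y)
    have e3 := abs_nonneg c
    have e4 := abs_nonneg (b y - c)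
    have e5 : |b y| ≤ (1 + |c|) * (1 + |b y - c|) := by nlinarith
    calc |b y| * |f y| ≤ (1 + |c|) * (1 + |b y - c|) * |f y| := mul_le_mul_of_nonneg_right e5 e2
      _ = _ := by ring
  have hb2 : IntegrableOn (fun y => b y * f y) (Icc (-R) R) := by
    refine hbi.mono_set ?_
    intro y hy
    constructor <;> linarith [hy.1, hy.2]
  have := (integrable_indicator_iff measurableSet_Icc).2 hb2
  refine this.congr (ae_of_all _ fun y => ?_)
  by_cases hy : y ∈ Icc (-R) R
  · simp only [indicator_of_mem hy]
  · simp only [indicator_of_notMem hy, mul_zero]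

theorem CVat_full {a : ι → ℝ → ℝ} {b f : ℝ → ℝ} (hb : IsB b) (ha : ∀ j, LocallyIntegrable (a j) volume) (hf : Measurable f)
    (hP : Phi f ≠ ⊤) {R x : ℝ} (hR : 0 < R) (hx : |x| ≤ R) (h : CVat a b ((Icc (-(R + 2)) (R + 2)).indicator f) x) :
    CVat a b f x := by
  have hN := Nice_trunc hb hf hP (show 0 < R + 2 by linarith)
  set S := Icc (-(R + 2)) (R + 2) with hS
  set h0 : ℝ → ℝ := fun y => kk a b 1 x y * Sᶜ.indicator f y with hh0
  have hdec : ∀ ε, 0 < ε → ε ≤ 1 → ∀ y, kk a b ε x y * f y = kk a b ε x y * S.indicator f y + h0 y := by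
    intro ε he he1 y
    by_cases hy : y ∈ S
    · have : y ∉ Sᶜ := by simpa using hy
      simp only [hh0, indicator_of_mem hy, indicator_of_notMem this, mul_zero, add_zero]
    · have hy' : y ∈ Sᶜ := hy
      simp only [hh0, indicator_of_notMem hy, indicator_of_mem hy', mul_zero, zero_add]
      have h1 : 1 < |x - y| := by
        by_contra hc
        apply hy
        have h2 := abs_le.1 (not_lt.1 hc)
        have h3 := abs_le.1 hx
        constructor <;> linarith [h2.1, h2.2, h3.1, h3.2]
      simp only [kk, if_pos h1, if_pos (lt_of_le_of_lt he1 h1)]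
  have hev : ∀ᶠ ε in nhdsWithin (0:ℝ) (Ioi 0), 0 < ε ∧ ε ≤ 1 := by
    filter_upwards [Ioo_mem_nhdsGT (show (0:ℝ) < 1 by norm_num)] with ε hε using ⟨hε.1, hε.2.le⟩
  by_cases hi : Integrable h0
  · obtain ⟨l, hl⟩ := h
    refine ⟨l + ∫ y, h0 y, (hl.add tendsto_const_nhds).congr' ?_⟩
    filter_upwards [hev] with ε hε
    unfold TK
    rw [integral_congr_ae (ae_of_all _ (hdec ε hε.1 hε.2)), integral_add (kk_int hb ha hN hε.1 x) hi]
  · refine ⟨0, tendsto_const_nhds.congr' ?_⟩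
    filter_upwards [hev] with ε hε
    unfold TK
    rw [integral_undef]
    intro hc
    apply hi
    have : Integrable (fun y => kk a b ε x y * f y - kk a b ε x y * S.indicator f y) := hc.sub (kk_int hb ha hN hε.1 x)
    refine this.congr (ae_of_all _ fun y => ?_)
    dsimp only
    rw [hdec ε hε.1 hε.2 y]; ring

theorem CVat_ae_full {A b : ℝ → ℝ} (hA : ∀ x, HasDerivAt A (b x) x) (hb : IsB b) {a : ι → ℝ → ℝ} (hai : ∀ j, Integrable (a j))
    {f : ℝ → ℝ} (hf : Measurable f) (hP : Phi f ≠ ⊤) : ∀ᵐ x, CVat a b f x := by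
  have hall : ∀ᵐ x, ∀ n : ℕ, CVat a b ((Icc (-((n:ℝ) + 1 + 2)) ((n:ℝ) + 1 + 2)).indicator f) x := by
    rw [ae_all_iff]
    intro n
    refine cv_ae hA hb hai (Nice_trunc hb hf hP (by positivity)) ?_
    refine ne_top_of_le_ne_top hP (Phi_mono fun x => ?_)
    by_cases hx : x ∈ Icc (-((n:ℝ) + 1 + 2)) ((n:ℝ) + 1 + 2)
    · rw [indicator_of_mem hx]
    · rw [indicator_of_notMem hx, abs_zero]; exact abs_nonneg _
  filter_upwards [hall] with x hx
  obtain ⟨n, hn⟩ := exists_nat_ge |x|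
  exact CVat_full hb (fun j => (hai j).locallyIntegrable) hf hP (R := n + 1) (by positivity) (by linarith) (hx n)

theorem weak_full (ι : Type) [Fintype ι] : ∃ C : ℝ, 0 < C ∧ ∀ b, IsB b → ∀ a : ι → ℝ → ℝ, (∀ j, LocallyIntegrable (a j) volume) →
    ∀ f, Measurable f → Phi f ≠ ⊤ → volume (ES a b f 1) ≤ ENNReal.ofReal C * XX a f := by
  obtain ⟨C, hC, hw⟩ := weak_star ι
  refine ⟨C, hC, ?_⟩
  intro b hb a ha f hf hP
  let fR : ℕ → ℝ → ℝ := fun n => (Icc (-((n:ℝ) + 1)) ((n:ℝ) + 1)).indicator f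
  have hN : ∀ n, Nice b (fR n) := fun n => Nice_trunc hb hf hP (by positivity)
  have hX : ∀ n, volume (ES a b (fR n) 1) ≤ ENNReal.ofReal C * XX a f := by
    intro n
    refine (hw b hb a ha _ (hN n)).trans (mul_le_mul_right ?_ _)
    unfold XX
    refine add_le_add le_rfl (Phi_mono fun x => ?_)
    by_cases hx : x ∈ Icc (-((n:ℝ) + 1)) ((n:ℝ) + 1)
    · simp only [fR, indicator_of_mem hx]; exact le_rfl
    · simp only [fR, indicator_of_notMem hx, abs_zero]; exact abs_nonneg _
  let D : ℕ → Set ℝ := fun N => {x | ∀ n, N ≤ n → x ∈ ES a b (fR n) 1}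
  have hsub : ES a b f 1 ⊆ ⋃ N, D N := by
    rintro x ⟨ε, hε, hx⟩
    have hi : Integrable (fun y => kk a b ε x y * f y) := by
      by_contra h
      unfold TK at hx
      rw [integral_undef h, abs_zero] at hx
      linarith
    have ht : Tendsto (fun n => TK a b ε (fR n) x) atTop (nhds (TK a b ε f x)) := by
      unfold TK
      apply tendsto_integral_of_dominated_convergence (fun y => |kk a b ε x y * f y|)
      · intro n
        exact (kk_int hb ha (hN n) hε x).aestronglyMeasurable
      · exact hi.abs
      · intro n
        refine ae_of_all _ fun y => ?_
        rw [Real.norm_eq_abs]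
        by_cases hy : y ∈ Icc (-((n:ℝ) + 1)) ((n:ℝ) + 1)
        · simp only [fR, indicator_of_mem hy]; exact le_rfl
        · simp only [fR, indicator_of_notMem hy, mul_zero, abs_zero]; exact abs_nonneg _
      · refine ae_of_all _ fun y => ?_
        apply tendsto_const_nhds.congr'
        obtain ⟨N, hN⟩ := exists_nat_ge |y|
        filter_upwards [eventually_ge_atTop N] with n hn
        have h1 : |y| ≤ (n:ℝ) + 1 := by
          have : (N:ℝ) ≤ n := by exact_mod_cast hn
          linarith
        have hy : y ∈ Icc (-((n:ℝ) + 1)) ((n:ℝ) + 1) := abs_le.1 h1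
        simp only [fR, indicator_of_mem hy]
    have h2 := ht.abs.eventually (lt_mem_nhds hx)
    obtain ⟨N, hN⟩ := eventually_atTop.1 h2
    exact mem_iUnion.2 ⟨N, fun n hn => ⟨ε, hε, hN n hn⟩⟩
  refine (measure_mono hsub).trans ?_
  have hmono : Monotone D := fun N M h x hx n hn => hx n (h.trans hn)
  rw [hmono.measure_iUnion]
  refine iSup_le fun N => ?_
  exact (measure_mono (show D N ⊆ ES a b (fR N) 1 from fun x hx => hx N le_rfl)).trans (hX N)

/-- maximal set of measurability -/
theorem exists_max_meas (f : ℝ → ℝ) : ∃ E : Set ℝ, MeasurableSet E ∧ AEMeasurable f (volume.restrict E) ∧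
    ∀ B : Set ℝ, MeasurableSet B → AEMeasurable f (volume.restrict B) → volume (B \ E) = 0 := by
  let μ : Measure ℝ := (volume : Measure ℝ).toFinite
  let S : Set ℝ≥0∞ := {t | ∃ B : Set ℝ, MeasurableSet B ∧ AEMeasurable f (volume.restrict B) ∧ μ B = t}
  have hS : S.Nonempty := ⟨0, ∅, MeasurableSet.empty, by simp, by simp⟩
  obtain ⟨u, _, hu, huS⟩ := exists_seq_tendsto_sSup hS (OrderTop.bddAbove S)
  choose B hB1 hB2 hB3 using huS
  have hE1 : MeasurableSet (⋃ n, B n) := MeasurableSet.iUnion hB1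
  have hE2 : AEMeasurable f (volume.restrict (⋃ n, B n)) := aemeasurable_iUnion_iff.2 hB2
  refine ⟨⋃ n, B n, hE1, hE2, ?_⟩
  intro G hG1 hG2
  have hle : sSup S ≤ μ (⋃ n, B n) := by
    apply le_of_tendsto' hu
    intro n
    rw [← hB3 n]
    exact measure_mono (subset_iUnion B n)
  have hG3 : μ (G ∪ ⋃ n, B n) ≤ μ (⋃ n, B n) := by
    have hmem : μ (G ∪ ⋃ n, B n) ∈ S := ⟨_, hG1.union hE1, aemeasurable_union_iff.2 ⟨hG2, hE2⟩, rfl⟩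
    exact (le_sSup hmem).trans hle
  have h0 : μ (G \ ⋃ n, B n) = 0 := by
    have h1 : μ (G \ ⋃ n, B n) + μ (⋃ n, B n) ≤ 0 + μ (⋃ n, B n) := by
      rw [zero_add, ← measure_union disjoint_sdiff_left hE1, diff_union_self]
      exact hG3
    have := (ENNReal.add_le_add_iff_right (measure_ne_top μ _)).1 h1
    exact le_antisymm this bot_le
  exact absolutelyContinuous_toFinite volume h0

end CCA

end

section
namespace CCA
variable {ι : Type} [Fintype ι]

theorem main_any (ι : Type) [Fintype ι] : ∃ C : ℝ, 0 < C ∧ ∀ A b : ℝ → ℝ, (∀ x, HasDerivAt A (b x) x) → IsB b →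
    ∀ a : ι → ℝ → ℝ, (∀ j, Integrable (a j)) → ∀ f : ℝ → ℝ, Phi f ≠ ⊤ →
      volume {x | 1 < |limUnder (nhdsWithin 0 (Ioi 0)) fun ε : ℝ => TK a b ε f x|} ≤ ENNReal.ofReal C * XX a f := by
  obtain ⟨C, hC, hw⟩ := weak_full ι
  refine ⟨C, hC, ?_⟩
  intro A b hA hb a hai f hP
  have hal : ∀ j, LocallyIntegrable (a j) volume := fun j => (hai j).locallyIntegrable
  obtain ⟨E, hE, hfE, hmax⟩ := exists_max_meas f
  set g : ℝ → ℝ := E.indicator (hfE.mk f) with hg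
  have hgm : Measurable g := hfE.measurable_mk.indicator hE
  have hgf : ∀ᵐ y, y ∈ E → g y = f y := by
    have h1 := (ae_restrict_iff' hE).1 hfE.ae_eq_mk
    filter_upwards [h1] with y hy hyE
    rw [hg, indicator_of_mem hyE, hy hyE]
  have hPg : Phi g ≤ Phi f := by
    unfold Phi
    apply lintegral_mono_ae
    filter_upwards [hgf] with y hy
    apply ENNReal.ofReal_le_ofReal
    apply phi_mono
    by_cases hyE : y ∈ E
    · rw [hy hyE]
    · rw [hg, indicator_of_notMem hyE, abs_zero]; exact abs_nonneg _
  have hPg' : Phi g ≠ ⊤ := ne_top_of_le_ne_top hP hPg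
  have hXX : XX a g ≤ XX a f := add_le_add le_rfl hPg
  -- comparison
  have hcmp : ∀ x ε, AEStronglyMeasurable (fun y => kk a b ε x y * f y) volume → TK a b ε f x = TK a b ε g x := by
    intro x ε hm
    have hkm := kk_meas1 hb hal ε x
    set Z : Set ℝ := {y | kk a b ε x y ≠ 0} with hZ
    have hZm : MeasurableSet Z := (measurableSet_eq_fun hkm measurable_const).compl
    have hfZ : AEMeasurable f (volume.restrict Z) := by
      have h1 : AEMeasurable (fun y => (kk a b ε x y)⁻¹ * (kk a b ε x y * f y)) (volume.restrict Z) :=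
        (hkm.inv.aemeasurable).mul hm.aemeasurable.restrict
      refine h1.congr ?_
      rw [EventuallyEq, ae_restrict_iff' hZm]
      refine ae_of_all _ fun y hy => ?_
      exact inv_mul_cancel_left₀ hy _
    have h0 := hmax Z hZm hfZ
    have h0' : ∀ᵐ y, y ∉ Z \ E := measure_eq_zero_iff_ae_notMem.1 h0
    unfold TK
    apply integral_congr_ae
    filter_upwards [hgf, h0'] with y h1 h2
    by_cases hy : y ∈ Z
    · have : y ∈ E := by
        by_contra hc
        exact h2 ⟨hy, hc⟩
      rw [h1 this]
    · have : kk a b ε x y = 0 := by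
        by_contra hc
        exact hy hc
      rw [this, zero_mul, zero_mul]
  have hzero : ∀ x ε, ¬ AEStronglyMeasurable (fun y => kk a b ε x y * f y) volume → TK a b ε f x = 0 := by
    intro x ε hm
    unfold TK
    exact integral_undef fun h => hm h.1
  have hmono : ∀ x ε ε', ε ≤ ε' → AEStronglyMeasurable (fun y => kk a b ε x y * f y) volume →
      AEStronglyMeasurable (fun y => kk a b ε' x y * f y) volume := by
    intro x ε ε' he hm
    have hS : MeasurableSet {y : ℝ | ε' < |x - y|} :=
      measurableSet_lt (f := fun _ => ε') (g := fun y => |x - y|) (by fun_prop) (by fun_prop)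
    refine (hm.indicator hS).congr (ae_of_all _ fun y => ?_)
    by_cases hy : ε' < |x - y|
    · rw [indicator_of_mem (show y ∈ {y : ℝ | ε' < |x - y|} from hy)]
      simp only [kk, if_pos hy, if_pos (lt_of_le_of_lt he hy)]
    · rw [indicator_of_notMem (show y ∉ {y : ℝ | ε' < |x - y|} from hy)]
      simp only [kk, if_neg hy, zero_mul]
  have hcv : ∀ x, CVat a b g x → CVat a b f x := by
    intro x ⟨l, hl⟩
    by_cases hall : ∀ ε, 0 < ε → AEStronglyMeasurable (fun y => kk a b ε x y * f y) volume
    · refine ⟨l, hl.congr' ?_⟩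
      filter_upwards [self_mem_nhdsWithin] with ε hε
      exact (hcmp x ε (hall ε hε)).symm
    · push Not at hall
      obtain ⟨ε0, h0, hn⟩ := hall
      refine ⟨0, tendsto_const_nhds.congr' ?_⟩
      filter_upwards [Ioo_mem_nhdsGT h0] with ε hε
      exact (hzero x ε fun h => hn (hmono x ε ε0 hε.2.le h)).symm
  have hae := CVat_ae_full hA hb hai hgm hPg'
  have hsub : {x | 1 < |limUnder (nhdsWithin 0 (Ioi 0)) fun ε : ℝ => TK a b ε f x|} ⊆ {x | ¬ CVat a b g x} ∪ ES a b g 1 := by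
    intro x hx
    by_cases hc : CVat a b g x
    · right
      obtain ⟨l, hl⟩ := hcv x hc
      rw [mem_setOf_eq, hl.limUnder_eq] at hx
      have h1 := hl.abs.eventually (lt_mem_nhds hx)
      obtain ⟨ε, h2, h3⟩ := (h1.and self_mem_nhdsWithin).exists
      refine ⟨ε, h3, ?_⟩
      by_cases hm : AEStronglyMeasurable (fun y => kk a b ε x y * f y) volume
      · rw [← hcmp x ε hm]; exact h2
      · rw [hzero x ε hm, abs_zero] at h2
        linarith
    · left; exact hc
  refine (measure_mono hsub).trans ((measure_union_le _ _).trans ?_)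
  rw [ae_iff.1 hae, zero_add]
  exact (hw b hb a hal g hgm hPg').trans (mul_le_mul_right hXX _)

end CCA

end

/-- Theorem 2.1: weak type `L log L` endpoint estimate for the
generalized Calderón commutator. -/
theorem endpoint_estimate_CcommA (m : ℕ) :
    ∃ C : ℝ, 0 < C ∧
      ∀ A A' : ℝ → ℝ, (∀ x, HasDerivAt A (A' x) x) → bmoNorm A' = 1 →
        ∀ a : Fin m → ℝ → ℝ, (∀ j, Integrable (a j)) →
          ∀ f : ℝ → ℝ,
            volume {x : ℝ | 1 < |CcommA m A A' a f x|} ≤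
              ENNReal.ofReal C *
                ((∑ j : Fin m, ∫⁻ y, ENNReal.ofReal |a j y|) +
                  ∫⁻ y, ENNReal.ofReal (|f y| * Real.log (Real.exp 1 + |f y|))) := by
  classical
  obtain ⟨C, hC, hmain⟩ := CCA.main_any (Fin m)
  refine ⟨C, hC, ?_⟩
  intro A A' hA hbmo a ha f
  have hX : (∑ j : Fin m, ∫⁻ y, ENNReal.ofReal |a j y|) +
      ∫⁻ y, ENNReal.ofReal (|f y| * Real.log (Real.exp 1 + |f y|)) = CCA.XX a f := by
    unfold CCA.XX
    simp only [CCA.dm_apply _ MeasurableSet.univ, Measure.restrict_univ]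
    rfl
  rw [hX]
  by_cases hP : CCA.Phi f = ⊤
  · have : CCA.XX a f = ⊤ := by unfold CCA.XX; rw [hP, add_top]
    rw [this, ENNReal.mul_top (by simpa using hC)]
    exact le_top
  have hbdd : BddAbove {c : ℝ | ∃ u v : ℝ, u < v ∧
      c = (v - u)⁻¹ * ∫ y in Ioc u v, |A' y - (v - u)⁻¹ * ∫ z in Ioc u v, A' z|} := by
    by_contra h
    unfold bmoNorm at hbmo
    rw [Real.sSup_of_not_bddAbove h] at hbmo
    norm_num at hbmo
  have hosc : ∀ u v : ℝ, u < v → ∫ y in Ioc u v, |A' y - (v - u)⁻¹ * ∫ z in Ioc u v, A' z| ≤ v - u := by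
    intro u v huv
    have h1 := le_csSup hbdd ⟨u, v, huv, rfl⟩
    have h2 : sSup {c : ℝ | ∃ u v : ℝ, u < v ∧
      c = (v - u)⁻¹ * ∫ y in Ioc u v, |A' y - (v - u)⁻¹ * ∫ z in Ioc u v, A' z|} = 1 := hbmo
    rw [h2, inv_mul_le_iff₀ (by linarith), mul_one] at h1
    exact h1
  have hAd : A' = deriv A := by ext x; exact (hA x).deriv.symm
  have hmeas : Measurable A' := by rw [hAd]; exact measurable_deriv A
  have hB : CCA.IsB A' := ⟨hmeas, CCA.loc_int_of_bmo hA hosc, hosc⟩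
  refine le_trans (le_of_eq ?_) (hmain A A' hA hB a ha f hP)
  congr 1
  ext x
  have hAD : ∀ y, CCA.AD A' x y = A x - A y := fun y =>
    intervalIntegral.integral_eq_sub_of_hasDerivAt (fun t _ => hA t) (CCA.li_ii hB.loc y x)
  have hfun : ∀ ε : ℝ, 0 < ε → (∫ y in {y : ℝ | ε < |x - y|},
      (P2 A A' x y * ∏ j, Adiff (a j) x y) / (x - y) ^ (m + 2) * f y) = CCA.TK a A' ε f x := by
    intro ε hε
    have hS : MeasurableSet {y : ℝ | ε < |x - y|} :=
      measurableSet_lt (f := fun _ => ε) (g := fun y => |x - y|) (by fun_prop) (by fun_prop)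
    rw [← integral_indicator hS]
    unfold CCA.TK
    congr 1
    ext y
    by_cases hy : ε < |x - y|
    · rw [indicator_of_mem (show y ∈ {y : ℝ | ε < |x - y|} from hy)]
      have hne : x - y ≠ 0 := abs_pos.1 (hε.trans hy)
      have hp : ∏ j, (CCA.AD (a j) x y / (x - y)) = (∏ j, Adiff (a j) x y) / (x - y) ^ m := by
        rw [Finset.prod_div_distrib, Finset.prod_const, Finset.card_univ, Fintype.card_fin]
        rfl
      unfold CCA.kk CCA.KK P2
      rw [if_pos hy, hp, hAD]
      congr 1
      field_simp
      ring
    · rw [indicator_of_notMem (show y ∉ {y : ℝ | ε < |x - y|} from hy)]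
      unfold CCA.kk
      rw [if_neg hy, zero_mul]
  have hlim : CcommA m A A' a f x = limUnder (nhdsWithin 0 (Ioi 0)) fun ε : ℝ => CCA.TK a A' ε f x := by
    unfold CcommA limUnder
    congr 1
    apply Filter.map_congr
    filter_upwards [self_mem_nhdsWithin] with ε hε
    exact hfun ε hε
  rw [mem_setOf_eq, mem_setOf_eq, hlim]
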